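/- arXiv:0810.2214 — 7 statements merged into one kernel-verified Lean document; each statement's English description precedes it below -/
import Mathlib

section
/- For every integer k with 9 ≤ k ≤ 37 and every integer m with m ≥ k, there exists a k-homogeneous Latin bitrade of volume k·m. -/
/-- A partial Latin square: a finite set of (row, column, entry) triples such that
no two distinct triples agree in (row, column), in (row, entry), or in (column, entry). -/
def IsPartialLatinSquare (T : Finset (ℕ × ℕ × ℕ)) : Prop :=
  (∀ x ∈ T, ∀ y ∈ T, x.1 = y.1 → x.2.1 = y.2.1 → x = y) ∧
  (∀ x ∈ T, ∀ y ∈ T, x.1 = y.1 → x.2.2 = y.2.2 → x = y) ∧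
  (∀ x ∈ T, ∀ y ∈ T, x.2.1 = y.2.1 → x.2.2 = y.2.2 → x = y)

/-- A Latin bitrade: a pair of disjoint partial Latin squares with the same filled
cells, the same entry set in each row, and the same entry set in each column. -/
def IsLatinBitrade (T T' : Finset (ℕ × ℕ × ℕ)) : Prop :=
  IsPartialLatinSquare T ∧ IsPartialLatinSquare T' ∧
  Disjoint T T' ∧
  (∀ r c, (∃ e, (r, c, e) ∈ T) ↔ (∃ e, (r, c, e) ∈ T')) ∧
  (∀ r e, (∃ c, (r, c, e) ∈ T) ↔ (∃ c, (r, c, e) ∈ T')) ∧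
  (∀ c e, (∃ r, (r, c, e) ∈ T) ↔ (∃ r, (r, c, e) ∈ T'))

/-- A Latin bitrade is k-homogeneous if each nonempty row and column of T contains
exactly k filled cells, and each entry value occurring in T occurs exactly k times. -/
def IsHomogeneousLatinBitrade (k : ℕ) (T T' : Finset (ℕ × ℕ × ℕ)) : Prop :=
  IsLatinBitrade T T' ∧
  (∀ r, (∃ x ∈ T, x.1 = r) → (T.filter (fun x => x.1 = r)).card = k) ∧
  (∀ c, (∃ x ∈ T, x.2.1 = c) → (T.filter (fun x => x.2.1 = c)).card = k) ∧
  (∀ e, (∃ x ∈ T, x.2.2 = e) → (T.filter (fun x => x.2.2 = e)).card = k)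

/-- A Latin bitrade (T, T') is primary if every nonempty Latin bitrade (U, U') with
U ⊆ T and U' ⊆ T' satisfies U = T and U' = T'. -/
def IsPrimaryLatinBitrade (T T' : Finset (ℕ × ℕ × ℕ)) : Prop :=
  IsLatinBitrade T T' ∧
  ∀ U U' : Finset (ℕ × ℕ × ℕ), IsLatinBitrade U U' → U.Nonempty →
    U ⊆ T → U' ⊆ T' → U = T ∧ U' = T'

/-- Transport of a homogeneous bitrade on `ZMod m` to natural number triples. -/
theorem bitrade_transport (k m : ℕ) [NeZero m]
    (S S' : Finset (ZMod m × ZMod m × ZMod m))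
    (h1 : ∀ r c e e', (r, c, e) ∈ S → (r, c, e') ∈ S → e = e')
    (h2 : ∀ r c c' e, (r, c, e) ∈ S → (r, c', e) ∈ S → c = c')
    (h3 : ∀ r r' c e, (r, c, e) ∈ S → (r', c, e) ∈ S → r = r')
    (h1' : ∀ r c e e', (r, c, e) ∈ S' → (r, c, e') ∈ S' → e = e')
    (h2' : ∀ r c c' e, (r, c, e) ∈ S' → (r, c', e) ∈ S' → c = c')
    (h3' : ∀ r r' c e, (r, c, e) ∈ S' → (r', c, e) ∈ S' → r = r')
    (hd : ∀ r c e, (r, c, e) ∈ S → (r, c, e) ∉ S')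
    (hrc : ∀ r c, (∃ e, (r, c, e) ∈ S) ↔ (∃ e, (r, c, e) ∈ S'))
    (hre : ∀ r e, (∃ c, (r, c, e) ∈ S) ↔ (∃ c, (r, c, e) ∈ S'))
    (hce : ∀ c e, (∃ r, (r, c, e) ∈ S) ↔ (∃ r, (r, c, e) ∈ S'))
    (kr : ∀ r, (S.filter (fun x => x.1 = r)).card = k)
    (kc : ∀ c, (S.filter (fun x => x.2.1 = c)).card = k)
    (ke : ∀ e, (S.filter (fun x => x.2.2 = e)).card = k) :
    ∃ T T' : Finset (ℕ × ℕ × ℕ),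
      IsHomogeneousLatinBitrade k T T' ∧ T.card = k * m := by
  have vi : Function.Injective (ZMod.val : ZMod m → ℕ) := ZMod.val_injective m
  let v : ZMod m × ZMod m × ZMod m ↪ ℕ × ℕ × ℕ :=
    ⟨fun x => (x.1.val, x.2.1.val, x.2.2.val), by
      rintro ⟨a, b, c⟩ ⟨a', b', c'⟩ h
      simp only [Prod.mk.injEq] at h
      rw [vi h.1, vi h.2.1, vi h.2.2]⟩
  have hv : ∀ a b c, v (a, b, c) = (a.val, b.val, c.val) := fun _ _ _ => rfl
  have mem : ∀ (U : Finset (ZMod m × ZMod m × ZMod m)) (r c e : ℕ), (r, c, e) ∈ U.map v ↔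
      ∃ a b d, (a, b, d) ∈ U ∧ a.val = r ∧ b.val = c ∧ d.val = e := by
    intro U r c e
    simp only [Finset.mem_map, Prod.exists, hv, Prod.mk.injEq]
  have pls : ∀ U : Finset (ZMod m × ZMod m × ZMod m),
      (∀ r c e e', (r, c, e) ∈ U → (r, c, e') ∈ U → e = e') →
      (∀ r c c' e, (r, c, e) ∈ U → (r, c', e) ∈ U → c = c') →
      (∀ r r' c e, (r, c, e) ∈ U → (r', c, e) ∈ U → r = r') →
      IsPartialLatinSquare (U.map v) := by
    intro U g1 g2 g3
    refine ⟨?_, ?_, ?_⟩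
    · rintro ⟨r, c, e⟩ hx ⟨r', c', e'⟩ hy h h'
      obtain ⟨a, b, d, hu, rfl, rfl, rfl⟩ := (mem _ _ _ _).1 hx
      obtain ⟨a', b', d', hu', rfl, rfl, rfl⟩ := (mem _ _ _ _).1 hy
      obtain rfl := vi h
      obtain rfl := vi h'
      rw [g1 _ _ _ _ hu hu']
    · rintro ⟨r, c, e⟩ hx ⟨r', c', e'⟩ hy h h'
      obtain ⟨a, b, d, hu, rfl, rfl, rfl⟩ := (mem _ _ _ _).1 hx
      obtain ⟨a', b', d', hu', rfl, rfl, rfl⟩ := (mem _ _ _ _).1 hy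
      obtain rfl := vi h
      obtain rfl := vi h'
      rw [g2 _ _ _ _ hu hu']
    · rintro ⟨r, c, e⟩ hx ⟨r', c', e'⟩ hy h h'
      obtain ⟨a, b, d, hu, rfl, rfl, rfl⟩ := (mem _ _ _ _).1 hx
      obtain ⟨a', b', d', hu', rfl, rfl, rfl⟩ := (mem _ _ _ _).1 hy
      obtain rfl := vi h
      obtain rfl := vi h'
      rw [g3 _ _ _ _ hu hu']
  refine ⟨S.map v, S'.map v, ⟨⟨pls S h1 h2 h3, pls S' h1' h2' h3', ?_, ?_, ?_, ?_⟩, ?_, ?_, ?_⟩, ?_⟩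
  · rw [Finset.disjoint_map, Finset.disjoint_left]
    rintro ⟨r, c, e⟩ h
    exact hd r c e h
  · intro r c
    simp only [mem]
    constructor
    · rintro ⟨_, a, b, d, hu, rfl, rfl, rfl⟩
      obtain ⟨e, he⟩ := (hrc a b).1 ⟨d, hu⟩
      exact ⟨_, a, b, e, he, rfl, rfl, rfl⟩
    · rintro ⟨_, a, b, d, hu, rfl, rfl, rfl⟩
      obtain ⟨e, he⟩ := (hrc a b).2 ⟨d, hu⟩
      exact ⟨_, a, b, e, he, rfl, rfl, rfl⟩
  · intro r e
    simp only [mem]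
    constructor
    · rintro ⟨_, a, b, d, hu, rfl, rfl, rfl⟩
      obtain ⟨c, he⟩ := (hre a d).1 ⟨b, hu⟩
      exact ⟨_, a, c, d, he, rfl, rfl, rfl⟩
    · rintro ⟨_, a, b, d, hu, rfl, rfl, rfl⟩
      obtain ⟨c, he⟩ := (hre a d).2 ⟨b, hu⟩
      exact ⟨_, a, c, d, he, rfl, rfl, rfl⟩
  · intro c e
    simp only [mem]
    constructor
    · rintro ⟨_, a, b, d, hu, rfl, rfl, rfl⟩
      obtain ⟨r, he⟩ := (hce b d).1 ⟨a, hu⟩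
      exact ⟨_, r, b, d, he, rfl, rfl, rfl⟩
    · rintro ⟨_, a, b, d, hu, rfl, rfl, rfl⟩
      obtain ⟨r, he⟩ := (hce b d).2 ⟨a, hu⟩
      exact ⟨_, r, b, d, he, rfl, rfl, rfl⟩
  · rintro _ ⟨⟨r, c, e⟩, hx, rfl⟩
    obtain ⟨a, b, d, hu, rfl, rfl, rfl⟩ := (mem _ _ _ _).1 hx
    rw [Finset.filter_map, Finset.card_map, ← kr a]
    congr 1
    apply Finset.filter_congr
    rintro ⟨a', b', d'⟩ -
    simp [hv, vi.eq_iff]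
  · rintro _ ⟨⟨r, c, e⟩, hx, rfl⟩
    obtain ⟨a, b, d, hu, rfl, rfl, rfl⟩ := (mem _ _ _ _).1 hx
    rw [Finset.filter_map, Finset.card_map, ← kc b]
    congr 1
    apply Finset.filter_congr
    rintro ⟨a', b', d'⟩ -
    simp [hv, vi.eq_iff]
  · rintro _ ⟨⟨r, c, e⟩, hx, rfl⟩
    obtain ⟨a, b, d, hu, rfl, rfl, rfl⟩ := (mem _ _ _ _).1 hx
    rw [Finset.filter_map, Finset.card_map, ← ke d]
    congr 1
    apply Finset.filter_congr
    rintro ⟨a', b', d'⟩ -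
    simp [hv, vi.eq_iff]
  · rw [Finset.card_map, Finset.card_eq_sum_card_fiberwise (f := fun x => x.1)
      (t := Finset.univ) (fun _ _ => Finset.mem_coe.2 (Finset.mem_univ _))]
    simp [kr, ZMod.card, mul_comm]

/-- One half of a base row: `k` points of the hexagon of side `s + 1`, all three
coordinates pairwise distinct. -/
def HexGood (k s : ℕ) (P : List (ℕ × ℕ)) : Prop :=
  P.length = k ∧
  (∀ p ∈ P, p.1 ≤ 2 * s ∧ p.2 ≤ 2 * s ∧ s ≤ p.1 + p.2 ∧ p.1 + p.2 ≤ 3 * s) ∧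
  P.Pairwise (fun p q => p.1 ≠ q.1 ∧ p.2 ≠ q.2 ∧ p.1 + p.2 ≠ q.1 + q.2)

instance (k s : ℕ) (P : List (ℕ × ℕ)) : Decidable (HexGood k s P) := by
  unfold HexGood; infer_instance

/-- The coordinates of the points of `P` all occur in `Q`. -/
def HexSub (P Q : List (ℕ × ℕ)) : Prop :=
  ∀ p ∈ P, p ∉ Q ∧ (∃ q ∈ Q, p.1 = q.1) ∧ (∃ q ∈ Q, p.2 = q.2) ∧
    (∃ q ∈ Q, p.1 + p.2 = q.1 + q.2)

instance (P Q : List (ℕ × ℕ)) : Decidable (HexSub P Q) := by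
  unfold HexSub; infer_instance

theorem zmod_cast_inj (m s a b : ℕ) (hm : 2 * s < m) (lo : ℕ) (h1 : lo ≤ a) (h2 : a ≤ lo + 2 * s)
    (h3 : lo ≤ b) (h4 : b ≤ lo + 2 * s) (h : (a : ZMod m) = b) : a = b := by
  obtain ⟨a, rfl⟩ := Nat.exists_eq_add_of_le h1
  obtain ⟨b, rfl⟩ := Nat.exists_eq_add_of_le h3
  push_cast at h
  have h := add_left_cancel h
  rw [ZMod.natCast_eq_natCast_iff] at h
  have := Nat.ModEq.eq_of_lt_of_lt h (by omega) (by omega)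
  omega

theorem HexGood.inj {k s : ℕ} {P : List (ℕ × ℕ)} (h : HexGood k s P) {m : ℕ} (hm : 2 * s < m)
    {p q : ℕ × ℕ} (hp : p ∈ P) (hq : q ∈ P)
    (hor : (p.1 : ZMod m) = q.1 ∨ (p.2 : ZMod m) = q.2 ∨
      (p.1 + p.2 : ZMod m) = q.1 + q.2) : p = q := by
  obtain ⟨-, hb, hpw⟩ := h
  have bp := hb p hp
  have bq := hb q hq
  have key : p.1 = q.1 ∨ p.2 = q.2 ∨ p.1 + p.2 = q.1 + q.2 := by
    rcases hor with h | h | h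
    · exact Or.inl (zmod_cast_inj m s _ _ hm 0 (by omega) (by omega) (by omega) (by omega) h)
    · exact Or.inr (Or.inl
        (zmod_cast_inj m s _ _ hm 0 (by omega) (by omega) (by omega) (by omega) h))
    · exact Or.inr (Or.inr (zmod_cast_inj m s _ _ hm s (by omega) (by omega) (by omega)
        (by omega) (by push_cast; exact h)))
  by_contra hne
  have : Std.Symm (fun p q : ℕ × ℕ => p.1 ≠ q.1 ∧ p.2 ≠ q.2 ∧ p.1 + p.2 ≠ q.1 + q.2) :=
    ⟨fun a b hab => ⟨hab.1.symm, hab.2.1.symm, hab.2.2.symm⟩⟩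
  have := hpw.forall hp hq hne
  tauto

/-- The circulant partial Latin square generated by a base row. -/
def circ (m : ℕ) [NeZero m] (P : List (ℕ × ℕ)) : Finset (ZMod m × ZMod m × ZMod m) :=
  (Finset.univ ×ˢ P.toFinset).image
    (fun x : ZMod m × (ℕ × ℕ) => (x.1, x.1 + (x.2.1 : ZMod m), x.1 - (x.2.2 : ZMod m)))

theorem mem_circ (m : ℕ) [NeZero m] (P : List (ℕ × ℕ)) (r c e : ZMod m) :
    (r, c, e) ∈ circ m P ↔ ∃ p ∈ P, c = r + (p.1 : ZMod m) ∧ e = r - (p.2 : ZMod m) := by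
  unfold circ
  simp only [Finset.mem_image, Finset.mem_product, Finset.mem_univ, true_and,
    List.mem_toFinset, Prod.mk.injEq]
  constructor
  · rintro ⟨⟨r', p⟩, hp, rfl, rfl, rfl⟩
    exact ⟨p, hp, rfl, rfl⟩
  · rintro ⟨p, hp, rfl, rfl⟩
    exact ⟨(r, p), hp, rfl, rfl, rfl⟩

theorem HexGood.card {k s : ℕ} {P : List (ℕ × ℕ)} (h : HexGood k s P) :
    P.toFinset.card = k := by
  rw [List.toFinset_card_of_nodup, h.1]
  exact h.2.2.imp (fun hab he => hab.1 (by rw [he]))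

theorem circ_latin {k s m : ℕ} [NeZero m] {P : List (ℕ × ℕ)} (h : HexGood k s P)
    (hm : 2 * s < m) :
    (∀ r c e e', (r, c, e) ∈ circ m P → (r, c, e') ∈ circ m P → e = e') ∧
    (∀ r c c' e, (r, c, e) ∈ circ m P → (r, c', e) ∈ circ m P → c = c') ∧
    (∀ r r' c e, (r, c, e) ∈ circ m P → (r', c, e) ∈ circ m P → r = r') := by
  simp only [mem_circ]
  refine ⟨?_, ?_, ?_⟩
  · rintro r c e e' ⟨p, hp, h1, h2⟩ ⟨q, hq, h3, h4⟩
    have : p = q := h.inj hm hp hq (Or.inl (by linear_combination h3 - h1))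
    subst this
    rw [h2, h4]
  · rintro r c c' e ⟨p, hp, h1, h2⟩ ⟨q, hq, h3, h4⟩
    have : p = q := h.inj hm hp hq (Or.inr (Or.inl (by linear_combination h2 - h4)))
    subst this
    rw [h1, h3]
  · rintro r r' c e ⟨p, hp, h1, h2⟩ ⟨q, hq, h3, h4⟩
    have : p = q := h.inj hm hp hq (Or.inr (Or.inr (by linear_combination h3 - h1 + h2 - h4)))
    subst this
    linear_combination h3 - h1

theorem circ_sub {m : ℕ} [NeZero m] {P Q : List (ℕ × ℕ)} (h : HexSub P Q) :
    (∀ r c, (∃ e, (r, c, e) ∈ circ m P) → (∃ e, (r, c, e) ∈ circ m Q)) ∧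
    (∀ r e, (∃ c, (r, c, e) ∈ circ m P) → (∃ c, (r, c, e) ∈ circ m Q)) ∧
    (∀ c e, (∃ r, (r, c, e) ∈ circ m P) → (∃ r, (r, c, e) ∈ circ m Q)) := by
  simp only [mem_circ]
  refine ⟨?_, ?_, ?_⟩
  · rintro r c ⟨e, p, hp, rfl, rfl⟩
    obtain ⟨-, ⟨q, hq, hpq⟩, -, -⟩ := h p hp
    exact ⟨_, q, hq, by rw [hpq], rfl⟩
  · rintro r e ⟨c, p, hp, rfl, rfl⟩
    obtain ⟨-, -, ⟨q, hq, hpq⟩, -⟩ := h p hp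
    exact ⟨_, q, hq, rfl, by rw [hpq]⟩
  · rintro c e ⟨r, p, hp, rfl, rfl⟩
    obtain ⟨-, -, -, ⟨q, hq, hpq⟩⟩ := h p hp
    have hpq' : (p.1 + p.2 : ZMod m) = q.1 + q.2 := by exact_mod_cast congrArg Nat.cast hpq
    exact ⟨r + p.1 - q.1, q, hq, by ring, by linear_combination -hpq'⟩

theorem bitrade_of_base (k s m : ℕ) (hm : 2 * s < m) (P Q : List (ℕ × ℕ))
    (hP : HexGood k s P) (hQ : HexGood k s Q) (hPQ : HexSub P Q) (hQP : HexSub Q P) :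
    ∃ T T' : Finset (ℕ × ℕ × ℕ),
      IsHomogeneousLatinBitrade k T T' ∧ T.card = k * m := by
  have : NeZero m := ⟨by omega⟩
  obtain ⟨a1, a2, a3⟩ := circ_latin hP hm
  obtain ⟨b1, b2, b3⟩ := circ_latin hQ hm
  obtain ⟨c1, c2, c3⟩ := circ_sub (m := m) hPQ
  obtain ⟨d1, d2, d3⟩ := circ_sub (m := m) hQP
  refine bitrade_transport k m (circ m P) (circ m Q) a1 a2 a3 b1 b2 b3 ?_
    (fun r c => ⟨c1 r c, d1 r c⟩) (fun r c => ⟨c2 r c, d2 r c⟩) (fun r c => ⟨c3 r c, d3 r c⟩)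
    ?_ ?_ ?_
  · intro r c e
    rw [mem_circ, mem_circ]
    rintro ⟨p, hp, h1, h2⟩ ⟨q, hq, h3, h4⟩
    have bp := hP.2.1 p hp
    have bq := hQ.2.1 q hq
    have e1 : p.1 = q.1 := zmod_cast_inj m s _ _ hm 0 (by omega) (by omega) (by omega) (by omega)
      (by linear_combination h3 - h1)
    have e2 : p.2 = q.2 := zmod_cast_inj m s _ _ hm 0 (by omega) (by omega) (by omega) (by omega)
      (by linear_combination h2 - h4)
    exact (hPQ p hp).1 (by rw [Prod.ext e1 e2]; exact hq)
  · intro r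
    rw [← hP.card]
    symm
    apply Finset.card_bij (fun p _ => (r, r + (p.1 : ZMod m), r - (p.2 : ZMod m)))
    · intro p hp
      rw [Finset.mem_filter, mem_circ]
      exact ⟨⟨p, List.mem_toFinset.1 hp, rfl, rfl⟩, rfl⟩
    · intro p hp q hq hpq
      simp only [Prod.mk.injEq] at hpq
      exact hP.inj hm (List.mem_toFinset.1 hp) (List.mem_toFinset.1 hq)
        (Or.inl (by linear_combination hpq.2.1))
    · rintro ⟨r', c, e⟩ hx
      rw [Finset.mem_filter, mem_circ] at hx
      obtain ⟨⟨p, hp, rfl, rfl⟩, hr⟩ := hx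
      obtain rfl : r' = r := hr
      exact ⟨p, List.mem_toFinset.2 hp, rfl⟩
  · intro c
    rw [← hP.card]
    symm
    apply Finset.card_bij
      (fun p _ => (c - (p.1 : ZMod m), c, c - (p.1 : ZMod m) - (p.2 : ZMod m)))
    · intro p hp
      rw [Finset.mem_filter, mem_circ]
      exact ⟨⟨p, List.mem_toFinset.1 hp, by ring, rfl⟩, rfl⟩
    · intro p hp q hq hpq
      simp only [Prod.mk.injEq] at hpq
      exact hP.inj hm (List.mem_toFinset.1 hp) (List.mem_toFinset.1 hq)
        (Or.inl (by linear_combination -hpq.1))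
    · rintro ⟨r', c', e⟩ hx
      rw [Finset.mem_filter, mem_circ] at hx
      obtain ⟨⟨p, hp, h1, h2⟩, hr⟩ := hx
      obtain rfl : c' = c := hr
      refine ⟨p, List.mem_toFinset.2 hp, ?_⟩
      rw [h2, h1]
      simp
  · intro e
    rw [← hP.card]
    symm
    apply Finset.card_bij
      (fun p _ => (e + (p.2 : ZMod m), e + (p.2 : ZMod m) + (p.1 : ZMod m), e))
    · intro p hp
      rw [Finset.mem_filter, mem_circ]
      exact ⟨⟨p, List.mem_toFinset.1 hp, rfl, by ring⟩, rfl⟩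
    · intro p hp q hq hpq
      simp only [Prod.mk.injEq] at hpq
      exact hP.inj hm (List.mem_toFinset.1 hp) (List.mem_toFinset.1 hq)
        (Or.inr (Or.inl (by linear_combination hpq.1)))
    · rintro ⟨r', c', e'⟩ hx
      rw [Finset.mem_filter, mem_circ] at hx
      obtain ⟨⟨p, hp, h1, h2⟩, hr⟩ := hx
      obtain rfl : e' = e := hr
      refine ⟨p, List.mem_toFinset.2 hp, ?_⟩
      rw [h2, h1]
      simp

/-- Full Latin squares: the case `m = k`. -/
theorem bitrade_full (m : ℕ) (hm : 2 ≤ m) :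
    ∃ T T' : Finset (ℕ × ℕ × ℕ),
      IsHomogeneousLatinBitrade m T T' ∧ T.card = m * m := by
  have : NeZero m := ⟨by omega⟩
  have : Fact (1 < m) := ⟨by omega⟩
  have hcard : (Finset.univ : Finset (ZMod m)).card = m := by
    rw [Finset.card_univ, ZMod.card]
  refine bitrade_transport m m (Finset.univ.filter fun x => x.2.2 = x.1 + x.2.1)
    (Finset.univ.filter fun x => x.2.2 = x.1 + x.2.1 + 1) ?_ ?_ ?_ ?_ ?_ ?_ ?_ ?_ ?_ ?_ ?_ ?_ ?_ <;>
    try simp only [Finset.mem_filter, Finset.mem_univ, true_and]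
  · intro r c e e' h h'; rw [h, h']
  · intro r c c' e h h'; linear_combination h' - h
  · intro r r' c e h h'; linear_combination h' - h
  · intro r c e e' h h'; rw [h, h']
  · intro r c c' e h h'; linear_combination h' - h
  · intro r r' c e h h'; linear_combination h' - h
  · intro r c e h h'
    exact one_ne_zero (α := ZMod m) (by linear_combination h - h')
  · intro r c; exact ⟨fun _ => ⟨_, rfl⟩, fun _ => ⟨_, rfl⟩⟩
  · intro r e; exact ⟨fun _ => ⟨e - r - 1, by ring⟩, fun _ => ⟨e - r, by ring⟩⟩
  · intro c e; exact ⟨fun _ => ⟨e - c - 1, by ring⟩, fun _ => ⟨e - c, by ring⟩⟩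
  · intro r
    conv_rhs => rw [← hcard]
    symm
    apply Finset.card_bij (fun c _ => (r, c, r + c))
    · intro c _; simp
    · intro c _ c' _ h; simp only [Prod.mk.injEq] at h; exact h.2.1
    · rintro ⟨r', c, e⟩ h
      simp only [Finset.mem_filter, Finset.mem_univ, true_and] at h
      obtain ⟨rfl, rfl⟩ := h
      exact ⟨c, Finset.mem_univ _, rfl⟩
  · intro c
    conv_rhs => rw [← hcard]
    symm
    apply Finset.card_bij (fun r _ => (r, c, r + c))
    · intro c _; simp
    · intro c _ c' _ h; simp only [Prod.mk.injEq] at h; exact h.1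
    · rintro ⟨r', c, e⟩ h
      simp only [Finset.mem_filter, Finset.mem_univ, true_and] at h
      obtain ⟨rfl, rfl⟩ := h
      exact ⟨r', Finset.mem_univ _, rfl⟩
  · intro e
    conv_rhs => rw [← hcard]
    symm
    apply Finset.card_bij (fun r _ => (r, e - r, e))
    · intro c _; simp
    · intro c _ c' _ h; simp only [Prod.mk.injEq] at h; exact h.1
    · rintro ⟨r', c, e⟩ h
      simp only [Finset.mem_filter, Finset.mem_univ, true_and] at h
      obtain ⟨rfl, rfl⟩ := h
      exact ⟨r', Finset.mem_univ _, by simp⟩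

/-- The standard solution on the hexagon of side `s + 1`. -/
def hexP (s : ℕ) : List (ℕ × ℕ) :=
  (List.range (2 * s + 1)).map fun x => (x, if x < s then 2 * s - 1 - 2 * x else 4 * s - 2 * x)

/-- Its image under the point reflection. -/
def hexNeg (s : ℕ) : List (ℕ × ℕ) :=
  (hexP s).map fun p => (2 * s - p.1, 2 * s - p.2)

/-- A mate sharing exactly one point with `hexP s`. -/
def hexQ (s : ℕ) : List (ℕ × ℕ) :=
  if s = 7 then
    (List.range 15).zip [11, 6, 14, 12, 5, 13, 2, 7, 4, 1, 10, 8, 9, 0, 3]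
  else if s = 10 then
    (List.range 21).zip
      [17, 9, 18, 19, 10, 6, 20, 8, 15, 16, 3, 7, 0, 14, 2, 13, 5, 12, 1, 11, 4]
  else if s = 13 then
    (List.range 27).zip [13, 26, 12, 21, 11, 24, 15, 19, 22, 25, 10, 7, 5, 20, 2, 23, 3, 18,
      4, 17, 8, 16, 9, 0, 1, 14, 6]
  else if s = 16 then
    (List.range 33).zip [16, 27, 15, 31, 14, 30, 32, 29, 12, 23, 11, 22, 10, 26, 9, 25, 3, 24,
      7, 28, 6, 21, 5, 20, 0, 4, 18, 19, 2, 8, 1, 17, 13]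
  else (hexP s).map fun p => (p.2, p.1)

def hexP' (s : ℕ) : List (ℕ × ℕ) := (hexP s).filter fun p => p ∉ hexQ s

def hexQ' (s : ℕ) : List (ℕ × ℕ) := (hexQ s).filter fun p => p ∉ hexP s

set_option maxRecDepth 100000 in
theorem odd_ok : ∀ s ∈ List.range' 4 15, HexGood (2 * s + 1) s (hexP s) ∧
    HexGood (2 * s + 1) s (hexNeg s) ∧ HexSub (hexP s) (hexNeg s) ∧
    HexSub (hexNeg s) (hexP s) := by
  decide +kernel

set_option maxRecDepth 100000 in
theorem even_ok : ∀ s ∈ List.range' 5 14, HexGood (2 * s) s (hexP' s) ∧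
    HexGood (2 * s) s (hexQ' s) ∧ HexSub (hexP' s) (hexQ' s) ∧
    HexSub (hexQ' s) (hexP' s) := by
  decide +kernel

theorem stmt_10 (k m : ℕ) (hk9 : 9 ≤ k) (hk37 : k ≤ 37) (hm : k ≤ m) :
    ∃ T T' : Finset (ℕ × ℕ × ℕ),
      IsHomogeneousLatinBitrade k T T' ∧ T.card = k * m := by
  rcases Nat.even_or_odd' k with ⟨s, rfl | rfl⟩
  · rcases Nat.eq_or_lt_of_le hm with rfl | hlt
    · exact bitrade_full _ (by omega)
    · obtain ⟨h1, h2, h3, h4⟩ := even_ok s (by rw [List.mem_range'_1]; omega)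
      exact bitrade_of_base _ s m hlt _ _ h1 h2 h3 h4
  · obtain ⟨h1, h2, h3, h4⟩ := odd_ok s (by rw [List.mem_range'_1]; omega)
    exact bitrade_of_base _ s m (by omega) _ _ h1 h2 h3 h4
end

section
/- For every integer k with 3 ≤ k ≤ 37 and every integer m with m ≥ k, there exists a k-homogeneous Latin bitrade of volume k·m. -/
/-- The cyclic shifts of a base row: row `r` has the entry `r + f i` in column `r + c i`. -/
def shiftTable {m : ℕ} [NeZero m] {k : ℕ} (c f : Fin k → ZMod m) : Finset (ℕ × ℕ × ℕ) :=
  (Finset.univ : Finset (ZMod m × Fin k)).image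
    (fun p => (p.1.val, (p.1 + c p.2).val, (p.1 + f p.2).val))

theorem mem_shiftTable {m : ℕ} [NeZero m] {k : ℕ} (c f : Fin k → ZMod m) (x : ℕ × ℕ × ℕ) :
    x ∈ shiftTable c f ↔
      ∃ (r : ZMod m) (i : Fin k), x = (r.val, (r + c i).val, (r + f i).val) := by
  unfold shiftTable
  simp only [Finset.mem_image, Finset.mem_univ, true_and, Prod.exists]
  constructor
  · rintro ⟨r, i, h⟩; exact ⟨r, i, h.symm⟩
  · rintro ⟨r, i, h⟩; exact ⟨r, i, h.symm⟩

theorem shiftTable_isPartial {m : ℕ} [NeZero m] {k : ℕ} (c f : Fin k → ZMod m)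
    (hc : Function.Injective c) (hf : Function.Injective f)
    (hd : Function.Injective (fun i => f i - c i)) :
    IsPartialLatinSquare (shiftTable c f) := by
  have vi := ZMod.val_injective m
  refine ⟨?_, ?_, ?_⟩
  · intro x hx y hy h1 h2
    obtain ⟨r, i, rfl⟩ := (mem_shiftTable c f x).1 hx
    obtain ⟨s, j, rfl⟩ := (mem_shiftTable c f y).1 hy
    have e1 : r = s := vi h1
    subst e1
    have e2 : r + c i = r + c j := vi h2
    have e3 : i = j := hc (add_left_cancel e2)
    rw [e3]
  · intro x hx y hy h1 h2
    obtain ⟨r, i, rfl⟩ := (mem_shiftTable c f x).1 hx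
    obtain ⟨s, j, rfl⟩ := (mem_shiftTable c f y).1 hy
    have e1 : r = s := vi h1
    subst e1
    have e2 : r + f i = r + f j := vi h2
    have e3 : i = j := hf (add_left_cancel e2)
    rw [e3]
  · intro x hx y hy h1 h2
    obtain ⟨r, i, rfl⟩ := (mem_shiftTable c f x).1 hx
    obtain ⟨s, j, rfl⟩ := (mem_shiftTable c f y).1 hy
    have e1 : r + c i = s + c j := vi h1
    have e2 : r + f i = s + f j := vi h2
    have e3 : i = j := hd (by linear_combination e2 - e1)
    subst e3
    have e4 : r = s := add_right_cancel e1
    rw [e4]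

theorem shiftTable_card {m : ℕ} [NeZero m] {k : ℕ} (c f : Fin k → ZMod m)
    (hc : Function.Injective c) : (shiftTable c f).card = k * m := by
  have vi := ZMod.val_injective m
  unfold shiftTable
  rw [Finset.card_image_of_injective]
  · simp [ZMod.card, mul_comm]
  · rintro ⟨r, i⟩ ⟨s, j⟩ h
    simp only [Prod.mk.injEq] at h
    have e1 : r = s := vi h.1
    subst e1
    have e3 : i = j := hc (add_left_cancel (vi h.2.1))
    rw [e3]

/-- Counting a line of the table through an injective parametrisation. -/
theorem card_line {k : ℕ} (S : Finset (ℕ × ℕ × ℕ)) (g : Fin k → ℕ × ℕ × ℕ)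
    (hg : Function.Injective g) (hS : ∀ x, x ∈ S ↔ ∃ i, x = g i) : S.card = k := by
  have : S = Finset.univ.image g := by
    ext x
    rw [hS]
    simp [eq_comm]
  rw [this, Finset.card_image_of_injective _ hg]
  simp

theorem shiftTable_bitrade {m : ℕ} [NeZero m] {k : ℕ} (c a b : Fin k → ZMod m)
    (hc : Function.Injective c) (ha : Function.Injective a) (hb : Function.Injective b)
    (hda : Function.Injective (fun i => a i - c i))
    (hdb : Function.Injective (fun i => b i - c i))
    (hab : ∀ i, a i ≠ b i)
    (h1 : ∀ i, ∃ j, a i = b j) (h2 : ∀ i, ∃ j, b i = a j)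
    (h3 : ∀ i, ∃ j, a i - c i = b j - c j) (h4 : ∀ i, ∃ j, b i - c i = a j - c j) :
    IsHomogeneousLatinBitrade k (shiftTable c a) (shiftTable c b) := by
  have vi := ZMod.val_injective m
  have cells : ∀ f g : Fin k → ZMod m, ∀ r s : ℕ, (∃ e, (r, s, e) ∈ shiftTable c f) →
      (∃ e, (r, s, e) ∈ shiftTable c g) := by
    rintro f g r s ⟨e, he⟩
    obtain ⟨t, i, h⟩ := (mem_shiftTable c f _).1 he
    simp only [Prod.mk.injEq] at h
    refine ⟨(t + g i).val, (mem_shiftTable c g _).2 ⟨t, i, ?_⟩⟩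
    rw [h.1, h.2.1]
  have rows : ∀ f g : Fin k → ZMod m, (∀ i, ∃ j, f i = g j) → ∀ r e : ℕ,
      (∃ s, (r, s, e) ∈ shiftTable c f) → (∃ s, (r, s, e) ∈ shiftTable c g) := by
    rintro f g hfg r e ⟨s, he⟩
    obtain ⟨t, i, h⟩ := (mem_shiftTable c f _).1 he
    simp only [Prod.mk.injEq] at h
    obtain ⟨j, hj⟩ := hfg i
    refine ⟨(t + c j).val, (mem_shiftTable c g _).2 ⟨t, j, ?_⟩⟩
    rw [h.1, h.2.2, hj]
  have cols : ∀ f g : Fin k → ZMod m, (∀ i, ∃ j, f i - c i = g j - c j) → ∀ s e : ℕ,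
      (∃ r, (r, s, e) ∈ shiftTable c f) → (∃ r, (r, s, e) ∈ shiftTable c g) := by
    rintro f g hfg s e ⟨r, he⟩
    obtain ⟨t, i, h⟩ := (mem_shiftTable c f _).1 he
    simp only [Prod.mk.injEq] at h
    obtain ⟨j, hj⟩ := hfg i
    refine ⟨(t + c i - c j).val, (mem_shiftTable c g _).2 ⟨t + c i - c j, j, ?_⟩⟩
    have e1 : t + c i - c j + c j = t + c i := by ring
    have e2 : t + c i - c j + g j = t + f i := by linear_combination -hj
    rw [e1, e2, h.2.1, h.2.2]
  refine ⟨⟨shiftTable_isPartial c a hc ha hda, shiftTable_isPartial c b hc hb hdb, ?_,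
    fun r s => ⟨cells a b r s, cells b a r s⟩,
    fun r e => ⟨rows a b h1 r e, rows b a h2 r e⟩,
    fun s e => ⟨cols a b h3 s e, cols b a h4 s e⟩⟩, ?_, ?_, ?_⟩
  · rw [Finset.disjoint_left]
    intro x hx hy
    obtain ⟨r, i, rfl⟩ := (mem_shiftTable c a x).1 hx
    obtain ⟨s, j, h⟩ := (mem_shiftTable c b _).1 hy
    simp only [Prod.mk.injEq] at h
    have e1 : r = s := vi h.1
    subst e1
    have e2 : i = j := hc (add_left_cancel (vi h.2.1))
    subst e2
    exact hab i (add_left_cancel (vi h.2.2))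
  · rintro _ ⟨x, hx, rfl⟩
    obtain ⟨r, i₀, rfl⟩ := (mem_shiftTable c a x).1 hx
    refine card_line _ (fun i => (r.val, (r + c i).val, (r + a i).val)) ?_ ?_
    · intro i j h
      simp only [Prod.mk.injEq] at h
      exact hc (add_left_cancel (vi h.2.1))
    · intro y
      rw [Finset.mem_filter, mem_shiftTable]
      constructor
      · rintro ⟨⟨s, j, rfl⟩, h⟩
        have e1 : s = r := vi h
        exact ⟨j, by rw [e1]⟩
      · rintro ⟨j, rfl⟩
        exact ⟨⟨r, j, rfl⟩, rfl⟩
  · rintro _ ⟨x, hx, rfl⟩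
    obtain ⟨r, i₀, rfl⟩ := (mem_shiftTable c a x).1 hx
    generalize r + c i₀ = u
    refine card_line _ (fun i => ((u - c i).val, (u - c i + c i).val, (u - c i + a i).val)) ?_ ?_
    · intro i j h
      simp only [Prod.mk.injEq] at h
      exact hc (sub_right_injective (vi h.1))
    · intro y
      rw [Finset.mem_filter, mem_shiftTable]
      constructor
      · rintro ⟨⟨s, j, rfl⟩, h⟩
        have e1 : s + c j = u := vi h
        have e2 : u - c j = s := by rw [← e1]; ring
        exact ⟨j, by rw [e2]⟩
      · rintro ⟨j, rfl⟩
        exact ⟨⟨u - c j, j, rfl⟩, by simp⟩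
  · rintro _ ⟨x, hx, rfl⟩
    obtain ⟨r, i₀, rfl⟩ := (mem_shiftTable c a x).1 hx
    generalize r + a i₀ = u
    refine card_line _ (fun i => ((u - a i).val, (u - a i + c i).val, (u - a i + a i).val)) ?_ ?_
    · intro i j h
      simp only [Prod.mk.injEq] at h
      exact ha (sub_right_injective (vi h.1))
    · intro y
      rw [Finset.mem_filter, mem_shiftTable]
      constructor
      · rintro ⟨⟨s, j, rfl⟩, h⟩
        have e1 : s + a j = u := vi h
        have e2 : u - a j = s := by rw [← e1]; ring
        exact ⟨j, by rw [e2]⟩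
      · rintro ⟨j, rfl⟩
        exact ⟨⟨u - a j, j, rfl⟩, by simp⟩

/-- The third coordinate of a zero-sum triple. -/
def thirdCoord (p : ℤ × ℤ) : ℤ := -(p.1 + p.2)

/-- A list of zero-sum triples `(x, y, z)` with coordinates in `[-l, l]`, in which each of
the coordinates takes distinct values, `y` and `z` have the same range, and `y ≠ z`. -/
def GoodBase (l : ℤ) (L : List (ℤ × ℤ)) : Prop :=
  (L.map Prod.fst).Nodup ∧ (L.map Prod.snd).Nodup ∧ (L.map thirdCoord).Nodup ∧
  (∀ p ∈ L, -l ≤ p.1 ∧ p.1 ≤ l ∧ -l ≤ p.2 ∧ p.2 ≤ l ∧ -l ≤ thirdCoord p ∧ thirdCoord p ≤ l ∧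
    p.2 ≠ thirdCoord p ∧ p.2 ∈ L.map thirdCoord ∧ thirdCoord p ∈ L.map Prod.snd)

instance (l : ℤ) (L : List (ℤ × ℤ)) : Decidable (GoodBase l L) := by
  unfold GoodBase; infer_instance

theorem cast_inj_of_small {m : ℕ} {l u v : ℤ} (hl : 2 * l < m) (hu : -l ≤ u) (hu' : u ≤ l)
    (hv : -l ≤ v) (hv' : v ≤ l) (h : (u : ZMod m) = (v : ZMod m)) : u = v := by
  rw [ZMod.intCast_eq_intCast_iff_dvd_sub] at h
  have := Int.eq_zero_of_abs_lt_dvd h (by rw [abs_lt]; constructor <;> linarith)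
  linarith

theorem exists_of_goodBase {k m : ℕ} {l : ℤ} (L : List (ℤ × ℤ)) (hL : GoodBase l L)
    (hlen : L.length = k) (hlm : 2 * l < m) (hm0 : 0 < m) :
    ∃ T T' : Finset (ℕ × ℕ × ℕ),
      IsHomogeneousLatinBitrade k T T' ∧ T.card = k * m := by
  subst hlen
  haveI : NeZero m := ⟨hm0.ne'⟩
  obtain ⟨n1, n2, n3, hp⟩ := hL
  have hq := fun i : Fin L.length => hp (L.get i) (L.get_mem i)
  have inj : ∀ g : ℤ × ℤ → ℤ, (L.map g).Nodup → ∀ i j : Fin L.length,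
      g (L.get i) = g (L.get j) → i = j := by
    intro g hn i j h
    have := (hn.getElem_inj_iff (i := i.1) (j := j.1) (hi := by simp) (hj := by simp)).1
      (by simpa using h)
    exact Fin.ext this
  have ex : ∀ (g : ℤ × ℤ → ℤ) (v : ℤ), v ∈ L.map g → ∃ j : Fin L.length, v = g (L.get j) := by
    intro g v hv
    obtain ⟨p, hpL, rfl⟩ := List.mem_map.1 hv
    obtain ⟨j, hj⟩ := List.get_of_mem hpL
    exact ⟨j, by rw [hj]⟩
  let c : Fin L.length → ZMod m := fun i => ((L.get i).1 : ZMod m)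
  let a : Fin L.length → ZMod m := fun i => ((-(L.get i).2 : ℤ) : ZMod m)
  let b : Fin L.length → ZMod m := fun i => ((-thirdCoord (L.get i) : ℤ) : ZMod m)
  have hac : ∀ i, a i - c i = ((thirdCoord (L.get i) : ℤ) : ZMod m) := by
    intro i; simp only [a, c, thirdCoord]; push_cast; ring
  have hbc : ∀ i, b i - c i = (((L.get i).2 : ℤ) : ZMod m) := by
    intro i; simp only [b, c, thirdCoord]; push_cast; ring
  have hc : Function.Injective c := by
    intro i j h
    have hi := hq i
    have hj := hq j
    exact inj _ n1 i j (cast_inj_of_small hlm hi.1 hi.2.1 hj.1 hj.2.1 h)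
  have hy : ∀ i j : Fin L.length, (((L.get i).2 : ℤ) : ZMod m) = ((L.get j).2 : ℤ) → i = j := by
    intro i j h
    have hi := hq i
    have hj := hq j
    exact inj _ n2 i j (cast_inj_of_small hlm hi.2.2.1 hi.2.2.2.1 hj.2.2.1 hj.2.2.2.1 h)
  have hz : ∀ i j : Fin L.length,
      ((thirdCoord (L.get i) : ℤ) : ZMod m) = (thirdCoord (L.get j) : ℤ) → i = j := by
    intro i j h
    have hi := hq i
    have hj := hq j
    exact inj _ n3 i j (cast_inj_of_small hlm hi.2.2.2.2.1 hi.2.2.2.2.2.1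
      hj.2.2.2.2.1 hj.2.2.2.2.2.1 h)
  refine ⟨shiftTable c a, shiftTable c b, shiftTable_bitrade c a b hc ?_ ?_ ?_ ?_ ?_ ?_ ?_ ?_ ?_,
    shiftTable_card c a hc⟩
  · intro i j h
    exact hy i j (by simpa [a] using h)
  · intro i j h
    exact hz i j (by simpa [b] using h)
  · intro i j h
    simp only [hac] at h
    exact hz i j h
  · intro i j h
    simp only [hbc] at h
    exact hy i j h
  · intro i h
    have hi := hq i
    have h' : (((L.get i).2 : ℤ) : ZMod m) = (thirdCoord (L.get i) : ℤ) := by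
      simpa [a, b] using h
    exact hi.2.2.2.2.2.2.1 (cast_inj_of_small hlm hi.2.2.1 hi.2.2.2.1
      hi.2.2.2.2.1 hi.2.2.2.2.2.1 h')
  · intro i
    obtain ⟨j, hj⟩ := ex _ _ (hq i).2.2.2.2.2.2.2.1
    exact ⟨j, by simp only [a, b, hj]⟩
  · intro i
    obtain ⟨j, hj⟩ := ex _ _ (hq i).2.2.2.2.2.2.2.2
    exact ⟨j, by simp only [a, b, hj]⟩
  · intro i
    obtain ⟨j, hj⟩ := ex _ _ (hq i).2.2.2.2.2.2.2.2
    exact ⟨j, by rw [hac, hbc, hj]⟩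
  · intro i
    obtain ⟨j, hj⟩ := ex _ _ (hq i).2.2.2.2.2.2.2.1
    exact ⟨j, by rw [hac, hbc, hj]⟩

/-- The addition table of `ZMod k`, shifted by `d`. -/
def addTable (k : ℕ) [NeZero k] (d : ZMod k) : Finset (ℕ × ℕ × ℕ) :=
  (Finset.univ : Finset (ZMod k × ZMod k)).image
    (fun p => (p.1.val, p.2.val, (p.1 + p.2 + d).val))

theorem mem_addTable (k : ℕ) [NeZero k] (d : ZMod k) (x : ℕ × ℕ × ℕ) :
    x ∈ addTable k d ↔ ∃ r s : ZMod k, x = (r.val, s.val, (r + s + d).val) := by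
  unfold addTable
  simp only [Finset.mem_image, Finset.mem_univ, true_and, Prod.exists]
  constructor
  · rintro ⟨r, i, h⟩; exact ⟨r, i, h.symm⟩
  · rintro ⟨r, i, h⟩; exact ⟨r, i, h.symm⟩

theorem addTable_isPartial (k : ℕ) [NeZero k] (d : ZMod k) :
    IsPartialLatinSquare (addTable k d) := by
  have vi := ZMod.val_injective k
  refine ⟨?_, ?_, ?_⟩ <;> intro x hx y hy h1 h2 <;>
    obtain ⟨r, s, rfl⟩ := (mem_addTable k d x).1 hx <;>
    obtain ⟨r', s', rfl⟩ := (mem_addTable k d y).1 hy <;>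
    have e1 := vi h1 <;> have e2 := vi h2
  · rw [e1, e2]
  · subst e1
    have e3 : s = s' := by linear_combination e2
    rw [e3]
  · subst e1
    have e3 : r = r' := by linear_combination e2
    rw [e3]

/-- Counting a line of the addition table through an injective parametrisation. -/
theorem card_line_zmod {k : ℕ} [NeZero k] (S : Finset (ℕ × ℕ × ℕ)) (g : ZMod k → ℕ × ℕ × ℕ)
    (hg : Function.Injective g) (hS : ∀ x, x ∈ S ↔ ∃ i, x = g i) : S.card = k := by
  have : S = Finset.univ.image g := by
    ext x
    rw [hS]
    simp [eq_comm]
  rw [this, Finset.card_image_of_injective _ hg]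
  simp [ZMod.card]

/-- The case `m = k`: the addition table of `ZMod k` and its shift by one. -/
theorem exists_of_eq (k : ℕ) (hk : 2 ≤ k) :
    ∃ T T' : Finset (ℕ × ℕ × ℕ),
      IsHomogeneousLatinBitrade k T T' ∧ T.card = k * k := by
  haveI : NeZero k := ⟨by omega⟩
  haveI : Fact (1 < k) := ⟨by omega⟩
  have vi := ZMod.val_injective k
  have cells : ∀ d d' : ZMod k, ∀ r s : ℕ, (∃ e, (r, s, e) ∈ addTable k d) →
      (∃ e, (r, s, e) ∈ addTable k d') := by
    rintro d d' r s ⟨e, he⟩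
    obtain ⟨t, u, h⟩ := (mem_addTable k d _).1 he
    simp only [Prod.mk.injEq] at h
    refine ⟨(t + u + d').val, (mem_addTable k d' _).2 ⟨t, u, ?_⟩⟩
    rw [h.1, h.2.1]
  have rows : ∀ d d' : ZMod k, ∀ r e : ℕ, (∃ s, (r, s, e) ∈ addTable k d) →
      (∃ s, (r, s, e) ∈ addTable k d') := by
    rintro d d' r e ⟨s, he⟩
    obtain ⟨t, u, h⟩ := (mem_addTable k d _).1 he
    simp only [Prod.mk.injEq] at h
    refine ⟨(u + d - d').val, (mem_addTable k d' _).2 ⟨t, u + d - d', ?_⟩⟩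
    have e1 : t + (u + d - d') + d' = t + u + d := by ring
    rw [e1, h.1, h.2.2]
  have cols : ∀ d d' : ZMod k, ∀ s e : ℕ, (∃ r, (r, s, e) ∈ addTable k d) →
      (∃ r, (r, s, e) ∈ addTable k d') := by
    rintro d d' s e ⟨r, he⟩
    obtain ⟨t, u, h⟩ := (mem_addTable k d _).1 he
    simp only [Prod.mk.injEq] at h
    refine ⟨(t + d - d').val, (mem_addTable k d' _).2 ⟨t + d - d', u, ?_⟩⟩
    have e1 : t + d - d' + u + d' = t + u + d := by ring
    rw [e1, h.2.1, h.2.2]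
  refine ⟨addTable k 0, addTable k 1, ⟨⟨addTable_isPartial k 0, addTable_isPartial k 1, ?_,
    fun r s => ⟨cells 0 1 r s, cells 1 0 r s⟩,
    fun r e => ⟨rows 0 1 r e, rows 1 0 r e⟩,
    fun s e => ⟨cols 0 1 s e, cols 1 0 s e⟩⟩, ?_, ?_, ?_⟩, ?_⟩
  · rw [Finset.disjoint_left]
    intro x hx hy
    obtain ⟨r, s, rfl⟩ := (mem_addTable k 0 x).1 hx
    obtain ⟨r', s', h⟩ := (mem_addTable k 1 _).1 hy
    simp only [Prod.mk.injEq] at h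
    have e1 : r = r' := vi h.1
    have e2 : s = s' := vi h.2.1
    subst e1 e2
    exact zero_ne_one (add_left_cancel (vi h.2.2))
  · rintro _ ⟨x, hx, rfl⟩
    obtain ⟨r, s₀, rfl⟩ := (mem_addTable k 0 x).1 hx
    refine card_line_zmod _ (fun s : ZMod k => (r.val, s.val, (r + s + 0).val)) ?_ ?_
    · intro i j h
      simp only [Prod.mk.injEq] at h
      exact vi h.2.1
    · intro y
      rw [Finset.mem_filter, mem_addTable]
      constructor
      · rintro ⟨⟨t, s, rfl⟩, h⟩
        have e1 : t = r := vi h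
        exact ⟨s, by rw [e1]⟩
      · rintro ⟨s, rfl⟩
        exact ⟨⟨r, s, rfl⟩, rfl⟩
  · rintro _ ⟨x, hx, rfl⟩
    obtain ⟨r₀, s, rfl⟩ := (mem_addTable k 0 x).1 hx
    refine card_line_zmod _ (fun r : ZMod k => (r.val, s.val, (r + s + 0).val)) ?_ ?_
    · intro i j h
      simp only [Prod.mk.injEq] at h
      exact vi h.1
    · intro y
      rw [Finset.mem_filter, mem_addTable]
      constructor
      · rintro ⟨⟨r, t, rfl⟩, h⟩
        have e1 : t = s := vi h
        exact ⟨r, by rw [e1]⟩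
      · rintro ⟨r, rfl⟩
        exact ⟨⟨r, s, rfl⟩, rfl⟩
  · rintro _ ⟨x, hx, rfl⟩
    obtain ⟨r₀, s₀, rfl⟩ := (mem_addTable k 0 x).1 hx
    generalize r₀ + s₀ + 0 = u
    refine card_line_zmod _ (fun r : ZMod k => (r.val, (u - r).val, (r + (u - r) + 0).val)) ?_ ?_
    · intro i j h
      simp only [Prod.mk.injEq] at h
      exact vi h.1
    · intro y
      rw [Finset.mem_filter, mem_addTable]
      constructor
      · rintro ⟨⟨r, t, rfl⟩, h⟩
        have e1 : r + t + 0 = u := vi h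
        have e2 : u - r = t := by rw [← e1]; ring
        exact ⟨r, by rw [e2]⟩
      · rintro ⟨r, rfl⟩
        exact ⟨⟨r, u - r, rfl⟩, by simp⟩
  · unfold addTable
    rw [Finset.card_image_of_injective]
    · simp [ZMod.card]
    · rintro ⟨r, s⟩ ⟨r', s'⟩ h
      simp only [Prod.mk.injEq] at h
      rw [vi h.1, vi h.2.1]

/-- Explicit base triples for each size `k` (only `x` and `y` are listed). -/
def baseTriples : ℕ → List (ℤ × ℤ)
  | 3 => [(-1, 0), (0, 1), (1, -1)]
  | 4 => [(-1, -1), (0, 2), (1, 0), (2, -2)]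
  | 5 => [(-2, 0), (-1, 2), (0, -1), (1, 1), (2, -2)]
  | 6 => [(-3, 1), (-2, -1), (-1, 3), (1, 2), (2, -3), (3, -2)]
  | 7 => [(-3, 0), (-2, 2), (-1, -1), (0, 3), (1, 1), (2, -3), (3, -2)]
  | 8 => [(-4, 1), (-3, 4), (-2, -2), (-1, 3), (1, -3), (2, 2), (3, -4), (4, -1)]
  | 9 => [(-4, 4), (-3, 2), (-2, 3), (-1, -2), (0, -4), (1, -3), (2, 1), (3, -1), (4, 0)]
  | 10 => [(-5, 1), (-4, -1), (-3, 2), (-2, 4), (-1, 5), (1, -4), (2, 3), (3, -5), (4, -3), (5,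
      -2)]
  | 11 => [(-5, 5), (-4, 3), (-3, 4), (-2, 0), (-1, -3), (0, -5), (1, -4), (2, 2), (3, -1), (4,
      1), (5, -2)]
  | 12 => [(-6, 4), (-5, 2), (-4, -2), (-3, 5), (-2, -3), (-1, 6), (1, 3), (2, -6), (3, -4), (4,
      -1), (5, 1), (6, -5)]
  | 13 => [(-6, 6), (-5, 4), (-4, 5), (-3, 1), (-2, -1), (-1, -4), (0, -6), (1, -5), (2, 3), (3,
      0), (4, 2), (5, -3), (6, -2)]
  | 14 => [(-7, 6), (-6, 7), (-5, 3), (-4, 1), (-3, 5), (-2, -4), (-1, -6), (1, -5), (2, -7),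
      (3, 4), (4, 2), (5, -2), (6, -1), (7, -3)]
  | 15 => [(-7, 7), (-6, 5), (-5, 6), (-4, 1), (-3, -1), (-2, 4), (-1, -5), (0, -7), (1, -6),
      (2, -4), (3, 2), (4, 3), (5, -2), (6, 0), (7, -3)]
  | 16 => [(-8, 7), (-7, 8), (-6, 4), (-5, 2), (-4, 6), (-3, -1), (-2, -5), (-1, -7), (1, -6),
      (2, -8), (3, 5), (4, 3), (5, 1), (6, -2), (7, -4), (8, -3)]
  | 17 => [(-8, 3), (-7, 4), (-6, 5), (-5, 6), (-4, -2), (-3, 7), (-2, -6), (-1, 8), (0, -4),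
      (1, -8), (2, 0), (3, -5), (4, -1), (5, 1), (6, 2), (7, -7), (8, -3)]
  | 18 => [(-9, 6), (-8, 7), (-7, 5), (-6, 9), (-5, -3), (-4, 8), (-3, -6), (-2, -5), (-1, -4),
      (1, 1), (2, -8), (3, 3), (4, 4), (5, -9), (6, -1), (7, 2), (8, -7), (9, -2)]
  | 19 => [(-9, 4), (-8, 5), (-7, 7), (-6, 8), (-5, 6), (-4, -4), (-3, -3), (-2, -7), (-1, -1),
      (0, 9), (1, -5), (2, -9), (3, 1), (4, 3), (5, 0), (6, 2), (7, -8), (8, -2), (9, -6)]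
  | 20 => [(-10, 4), (-9, 5), (-8, 7), (-7, 8), (-6, 9), (-5, 3), (-4, -6), (-3, -5), (-2, -7),
      (-1, 10), (1, 6), (2, -9), (3, -8), (4, 1), (5, -3), (6, -2), (7, -10), (8, 2), (9, -1),
      (10, -4)]
  | 21 => [(-10, 10), (-9, 5), (-8, 6), (-7, 4), (-6, 9), (-5, -5), (-4, 3), (-3, 7), (-2, 8),
      (-1, -8), (0, -7), (1, -6), (2, -10), (3, -9), (4, -3), (5, 2), (6, -4), (7, -2), (8, 1),
      (9, -1), (10, 0)]
  | 22 => [(-11, 5), (-10, 6), (-9, 7), (-8, 9), (-7, 4), (-6, 10), (-5, 11), (-4, -5), (-3,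
      -8), (-2, -6), (-1, 8), (1, -11), (2, -9), (3, -4), (4, -1), (5, -10), (6, 3), (7, -2),
      (8, 2), (9, -7), (10, 1), (11, -3)]
  | 23 => [(-11, 4), (-10, 7), (-9, 8), (-8, 6), (-7, 9), (-6, 10), (-5, 5), (-4, -7), (-3, -5),
      (-2, -8), (-1, -3), (0, 11), (1, -6), (2, -11), (3, -9), (4, 3), (5, -2), (6, 2), (7, -1),
      (8, 1), (9, -4), (10, 0), (11, -10)]
  | 24 => [(-12, 5), (-11, 9), (-10, 6), (-9, 4), (-8, 10), (-7, 8), (-6, 11), (-5, 12), (-4,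
      -5), (-3, 7), (-2, -8), (-1, -11), (1, -12), (2, -10), (3, -9), (4, -7), (5, -6), (6, 3),
      (7, -4), (8, 2), (9, -3), (10, -2), (11, 1), (12, -1)]
  | 25 => [(-12, 12), (-11, 6), (-10, 8), (-9, 5), (-8, 11), (-7, 4), (-6, 7), (-5, 9), (-4,
      10), (-3, -6), (-2, -9), (-1, -7), (0, -12), (1, -11), (2, -8), (3, -10), (4, -5), (5, 3),
      (6, -4), (7, 2), (8, -3), (9, -2), (10, 1), (11, -1), (12, 0)]
  | 26 => [(-13, 5), (-12, 7), (-11, 9), (-10, 4), (-9, 6), (-8, 11), (-7, 8), (-6, 12), (-5,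
      13), (-4, -6), (-3, 10), (-2, -11), (-1, -10), (1, -13), (2, -9), (3, -12), (4, -8), (5,
      -3), (6, -7), (7, -2), (8, 3), (9, -5), (10, 2), (11, -1), (12, 1), (13, -4)]
  | 27 => [(-13, 5), (-12, 8), (-11, 6), (-10, 9), (-9, 7), (-8, 10), (-7, 4), (-6, 11), (-5,
      12), (-4, -5), (-3, -10), (-2, -9), (-1, -11), (0, 13), (1, -8), (2, 2), (3, -13), (4,
      -4), (5, -2), (6, -12), (7, -6), (8, 3), (9, -1), (10, 0), (11, 1), (12, -3), (13, -7)]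
  | 28 => [(-14, 9), (-13, 6), (-12, 10), (-11, 7), (-10, 11), (-9, 13), (-8, 5), (-7, 14), (-6,
      12), (-5, 8), (-4, -9), (-3, -8), (-2, -6), (-1, -13), (1, -11), (2, -14), (3, -12), (4,
      -10), (5, 4), (6, -7), (7, -5), (8, 3), (9, -4), (10, 2), (11, -3), (12, -2), (13, 1),
      (14, -1)]
  | 29 => [(-14, 8), (-13, 6), (-12, 7), (-11, 9), (-10, 11), (-9, 5), (-8, 12), (-7, 13), (-6,
      14), (-5, 10), (-4, 4), (-3, -10), (-2, -9), (-1, -8), (0, -14), (1, -13), (2, -12), (3,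
      -11), (4, -7), (5, -6), (6, -4), (7, 3), (8, -5), (9, 2), (10, -3), (11, -2), (12, 1),
      (13, -1), (14, 0)]
  | 30 => [(-15, 10), (-14, 11), (-13, 6), (-12, 8), (-11, 5), (-10, 9), (-9, 14), (-8, 12),
      (-7, 15), (-6, 13), (-5, 7), (-4, -11), (-3, -9), (-2, -12), (-1, -8), (1, -14), (2, -10),
      (3, -13), (4, -15), (5, -7), (6, 4), (7, -6), (8, -5), (9, 3), (10, -4), (11, 2), (12,
      -3), (13, -2), (14, 1), (15, -1)]
  | 31 => [(-15, 11), (-14, 8), (-13, 10), (-12, 7), (-11, 9), (-10, 14), (-9, 12), (-8, 15),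
      (-7, 13), (-6, 5), (-5, 6), (-4, -7), (-3, -10), (-2, -13), (-1, -11), (0, -8), (1, -15),
      (2, -9), (3, -12), (4, -14), (5, 4), (6, -6), (7, -5), (8, 3), (9, -4), (10, 2), (11, -3),
      (12, -2), (13, 1), (14, -1), (15, 0)]
  | 32 => [(-16, 7), (-15, 5), (-14, 9), (-13, 11), (-12, 13), (-11, 10), (-10, 15), (-9, 6),
      (-8, 14), (-7, 16), (-6, -10), (-5, 8), (-4, -11), (-3, -4), (-2, -9), (-1, -7), (1, -15),
      (2, -14), (3, -16), (4, 12), (5, -3), (6, -12), (7, 4), (8, -1), (9, -13), (10, 3), (11,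
      1), (12, -8), (13, 2), (14, -6), (15, -5), (16, -2)]
  | 33 => [(-16, 12), (-15, 9), (-14, 11), (-13, 6), (-12, 7), (-11, 10), (-10, 15), (-9, 13),
      (-8, 16), (-7, 14), (-6, 8), (-5, 5), (-4, -10), (-3, -9), (-2, -8), (-1, -15), (0, -13),
      (1, -16), (2, -11), (3, -14), (4, -12), (5, -7), (6, 4), (7, -6), (8, -5), (9, 3), (10,
      -4), (11, 2), (12, -3), (13, -2), (14, 1), (15, -1), (16, 0)]
  | 34 => [(-17, 7), (-16, 9), (-15, 10), (-14, 8), (-13, 11), (-12, 13), (-11, 14), (-10, 12),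
      (-9, 15), (-8, 16), (-7, 17), (-6, -11), (-5, -8), (-4, -5), (-3, -13), (-2, -9), (-1,
      -7), (1, -16), (2, -14), (3, -17), (4, 3), (5, 4), (6, -2), (7, 5), (8, -12), (9, -10),
      (10, 6), (11, -6), (12, -15), (13, 2), (14, -3), (15, -1), (16, 1), (17, -4)]
  | 35 => [(-17, 10), (-16, 11), (-15, 16), (-14, 6), (-13, 7), (-12, 8), (-11, 9), (-10, 13),
      (-9, 14), (-8, 17), (-7, 15), (-6, 12), (-5, 5), (-4, -10), (-3, -9), (-2, -14), (-1,
      -16), (0, -15), (1, -12), (2, -11), (3, -13), (4, -17), (5, -8), (6, -7), (7, 4), (8, -6),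
      (9, -5), (10, 3), (11, -4), (12, 2), (13, -3), (14, -2), (15, 1), (16, -1), (17, 0)]
  | 36 => [(-18, 7), (-17, 9), (-16, 10), (-15, 6), (-14, 11), (-13, 12), (-12, 8), (-11, 13),
      (-10, 14), (-9, 15), (-8, 16), (-7, 5), (-6, 17), (-5, -13), (-4, -10), (-3, -14), (-2,
      -8), (-1, 18), (1, -17), (2, -15), (3, -18), (4, -16), (5, -12), (6, -11), (7, -6), (8,
      -5), (9, 4), (10, -1), (11, -4), (12, 3), (13, 1), (14, -9), (15, -3), (16, 2), (17, -7),
      (18, -2)]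
  | 37 => [(-18, 6), (-17, 13), (-16, 7), (-15, 9), (-14, 11), (-13, 8), (-12, 10), (-11, 16),
      (-10, 17), (-9, 12), (-8, -2), (-7, -11), (-6, -1), (-5, 14), (-4, -9), (-3, -14), (-2,
      15), (-1, 18), (0, -16), (1, -15), (2, -13), (3, -18), (4, -12), (5, 5), (6, -5), (7, -8),
      (8, 4), (9, -7), (10, -6), (11, 3), (12, -4), (13, 2), (14, -3), (15, 1), (16, -10), (17,
      -17), (18, 0)]
  | _ => []

set_option maxRecDepth 100000 in
theorem exists_base (k : ℕ) (h3 : 3 ≤ k) (h37 : k ≤ 37) :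
    ∃ L : List (ℤ × ℤ), L.length = k ∧ GoodBase ((k / 2 : ℕ) : ℤ) L := by
  refine ⟨baseTriples k, ?_⟩
  interval_cases k <;> exact ⟨by decide +kernel, by decide +kernel⟩

theorem stmt_11 (k m : ℕ) (hk3 : 3 ≤ k) (hk37 : k ≤ 37) (hm : k ≤ m) :
    ∃ T T' : Finset (ℕ × ℕ × ℕ),
      IsHomogeneousLatinBitrade k T T' ∧ T.card = k * m := by
  obtain rfl | hlt := hm.eq_or_lt
  · exact exists_of_eq k (by omega)
  · obtain ⟨L, hlen, hL⟩ := exists_base k hk3 hk37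
    exact exists_of_goodBase L hL hlen (by omega) (by omega)
end

section
/- For every integer m with m ≥ 5, there exists a 4-homogeneous Latin bitrade of volume 4·m. -/
namespace Circ

/-- The circulant square of order `m` with columns `r, r+1, r+2, r+3` in row `r`
holding `r+p0, r+p1, r+p2, r+p3` (mod `m`). -/
def P (m p0 p1 p2 p3 r c e : ℕ) : Prop :=
  r < m ∧ c < m ∧ e < m ∧
  ((c = r ∧ (e = r + p0 ∨ e + m = r + p0)) ∨
   ((c = r + 1 ∨ c + m = r + 1) ∧ (e = r + p1 ∨ e + m = r + p1)) ∨
   ((c = r + 2 ∨ c + m = r + 2) ∧ (e = r + p2 ∨ e + m = r + p2)) ∨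
   ((c = r + 3 ∨ c + m = r + 3) ∧ (e = r + p3 ∨ e + m = r + p3)))

open Classical in
noncomputable def C (m p0 p1 p2 p3 : ℕ) : Finset (ℕ × ℕ × ℕ) :=
  (Finset.range m ×ˢ (Finset.range m ×ˢ Finset.range m)).filter
    (fun x => P m p0 p1 p2 p3 x.1 x.2.1 x.2.2)

open Classical in
theorem mem_C (m p0 p1 p2 p3 r c e : ℕ) :
    (r, c, e) ∈ C m p0 p1 p2 p3 ↔ P m p0 p1 p2 p3 r c e := by
  unfold C
  rw [Finset.mem_filter, Finset.mem_product, Finset.mem_product, Finset.mem_range,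
    Finset.mem_range, Finset.mem_range]
  exact ⟨fun h => h.2, fun h => ⟨⟨h.1, h.2.1, h.2.2.1⟩, h⟩⟩

/-- Reduction mod `m` for numbers below `2m`. -/
def s (m k : ℕ) : ℕ := if k < m then k else k - m

theorem s_spec (m k : ℕ) (hk : k < 2 * m) :
    s m k < m ∧ (s m k = k ∨ s m k + m = k) := by
  unfold s; split_ifs <;> omega

theorem pls1 (m : ℕ) (hm : 5 ≤ m) : IsPartialLatinSquare (C m 1 3 0 2) := by
  refine ⟨?_, ?_, ?_⟩ <;>
  · rintro ⟨r, c, e⟩ hx ⟨r', c', e'⟩ hy h1 h2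
    rw [mem_C] at hx hy
    simp only at h1 h2
    subst h1 h2
    obtain ⟨a1, a2, a3, hx⟩ := hx
    obtain ⟨b1, b2, b3, hy⟩ := hy
    simp only [Prod.mk.injEq, true_and, and_true]
    rcases hx with hx | hx | hx | hx <;> rcases hy with hy | hy | hy | hy <;> omega

theorem pls2 (m : ℕ) (hm : 5 ≤ m) : IsPartialLatinSquare (C m 2 0 3 1) := by
  refine ⟨?_, ?_, ?_⟩ <;>
  · rintro ⟨r, c, e⟩ hx ⟨r', c', e'⟩ hy h1 h2
    rw [mem_C] at hx hy
    simp only at h1 h2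
    subst h1 h2
    obtain ⟨a1, a2, a3, hx⟩ := hx
    obtain ⟨b1, b2, b3, hy⟩ := hy
    simp only [Prod.mk.injEq, true_and, and_true]
    rcases hx with hx | hx | hx | hx <;> rcases hy with hy | hy | hy | hy <;> omega

theorem disj (m : ℕ) (hm : 5 ≤ m) : Disjoint (C m 1 3 0 2) (C m 2 0 3 1) := by
  rw [Finset.disjoint_left]
  rintro ⟨r, c, e⟩ hx hy
  rw [mem_C] at hx hy
  obtain ⟨a1, a2, a3, hx⟩ := hx
  obtain ⟨b1, b2, b3, hy⟩ := hy
  rcases hx with hx | hx | hx | hx <;> rcases hy with hy | hy | hy | hy <;> omega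

theorem cells (m p0 p1 p2 p3 q0 q1 q2 q3 : ℕ) (hm : 5 ≤ m)
    (h0 : q0 < m) (h1 : q1 < m) (h2 : q2 < m) (h3 : q3 < m) (r c : ℕ)
    (h : ∃ e, (r, c, e) ∈ C m p0 p1 p2 p3) : ∃ e, (r, c, e) ∈ C m q0 q1 q2 q3 := by
  obtain ⟨e, h⟩ := h
  rw [mem_C] at h
  simp only [mem_C]
  obtain ⟨a1, a2, a3, h⟩ := h
  rcases h with h | h | h | h
  · have := s_spec m (r + q0) (by omega)
    exact ⟨s m (r + q0), a1, a2, this.1, Or.inl ⟨h.1, this.2⟩⟩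
  · have := s_spec m (r + q1) (by omega)
    exact ⟨s m (r + q1), a1, a2, this.1, Or.inr (Or.inl ⟨h.1, this.2⟩)⟩
  · have := s_spec m (r + q2) (by omega)
    exact ⟨s m (r + q2), a1, a2, this.1, Or.inr (Or.inr (Or.inl ⟨h.1, this.2⟩))⟩
  · have := s_spec m (r + q3) (by omega)
    exact ⟨s m (r + q3), a1, a2, this.1, Or.inr (Or.inr (Or.inr ⟨h.1, this.2⟩))⟩

theorem rows12 (m : ℕ) (hm : 5 ≤ m) (r e : ℕ)
    (h : ∃ c, (r, c, e) ∈ C m 1 3 0 2) : ∃ c, (r, c, e) ∈ C m 2 0 3 1 := by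
  obtain ⟨c, h⟩ := h
  rw [mem_C] at h
  simp only [mem_C]
  obtain ⟨a1, a2, a3, h⟩ := h
  have k1 := s_spec m (r + 1) (by omega)
  have k2 := s_spec m (r + 2) (by omega)
  have k3 := s_spec m (r + 3) (by omega)
  rcases h with h | h | h | h
  · exact ⟨s m (r + 3), by unfold P; omega⟩
  · exact ⟨s m (r + 2), by unfold P; omega⟩
  · exact ⟨s m (r + 1), by unfold P; omega⟩
  · exact ⟨r, by unfold P; omega⟩

theorem rows21 (m : ℕ) (hm : 5 ≤ m) (r e : ℕ)
    (h : ∃ c, (r, c, e) ∈ C m 2 0 3 1) : ∃ c, (r, c, e) ∈ C m 1 3 0 2 := by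
  obtain ⟨c, h⟩ := h
  rw [mem_C] at h
  simp only [mem_C]
  obtain ⟨a1, a2, a3, h⟩ := h
  have k1 := s_spec m (r + 1) (by omega)
  have k2 := s_spec m (r + 2) (by omega)
  have k3 := s_spec m (r + 3) (by omega)
  rcases h with h | h | h | h
  · exact ⟨s m (r + 3), by unfold P; omega⟩
  · exact ⟨s m (r + 2), by unfold P; omega⟩
  · exact ⟨s m (r + 1), by unfold P; omega⟩
  · exact ⟨r, by unfold P; omega⟩

theorem cols12 (m : ℕ) (hm : 5 ≤ m) (c e : ℕ)
    (h : ∃ r, (r, c, e) ∈ C m 1 3 0 2) : ∃ r, (r, c, e) ∈ C m 2 0 3 1 := by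
  obtain ⟨r, h⟩ := h
  rw [mem_C] at h
  simp only [mem_C]
  obtain ⟨a1, a2, a3, h⟩ := h
  rcases h with h | h | h | h
  · have k := s_spec m (c + m - 2) (by omega)
    exact ⟨s m (c + m - 2), by omega, by omega, by omega, Or.inr (Or.inr (Or.inl ⟨by omega, by omega⟩))⟩
  · exact ⟨c, by omega, by omega, by omega, Or.inl ⟨by omega, by omega⟩⟩
  · have k := s_spec m (c + m - 3) (by omega)
    exact ⟨s m (c + m - 3), by omega, by omega, by omega, Or.inr (Or.inr (Or.inr ⟨by omega, by omega⟩))⟩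
  · have k := s_spec m (c + m - 1) (by omega)
    exact ⟨s m (c + m - 1), by omega, by omega, by omega, Or.inr (Or.inl ⟨by omega, by omega⟩)⟩

theorem cols21 (m : ℕ) (hm : 5 ≤ m) (c e : ℕ)
    (h : ∃ r, (r, c, e) ∈ C m 2 0 3 1) : ∃ r, (r, c, e) ∈ C m 1 3 0 2 := by
  obtain ⟨r, h⟩ := h
  rw [mem_C] at h
  simp only [mem_C]
  obtain ⟨a1, a2, a3, h⟩ := h
  rcases h with h | h | h | h
  · have k := s_spec m (c + m - 1) (by omega)
    exact ⟨s m (c + m - 1), by omega, by omega, by omega, Or.inr (Or.inl ⟨by omega, by omega⟩)⟩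
  · have k := s_spec m (c + m - 3) (by omega)
    exact ⟨s m (c + m - 3), by omega, by omega, by omega, Or.inr (Or.inr (Or.inr ⟨by omega, by omega⟩))⟩
  · exact ⟨c, by omega, by omega, by omega, Or.inl ⟨by omega, by omega⟩⟩
  · have k := s_spec m (c + m - 2) (by omega)
    exact ⟨s m (c + m - 2), by omega, by omega, by omega, Or.inr (Or.inr (Or.inl ⟨by omega, by omega⟩))⟩

/-- A set whose coordinate `f` is injective on it and has image an explicit 4-set has size 4. -/
theorem card4 (S : Finset (ℕ × ℕ × ℕ)) (f : ℕ × ℕ × ℕ → ℕ) (a b c d : ℕ)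
    (hinj : ∀ x ∈ S, ∀ y ∈ S, f x = f y → x = y)
    (hab : a ≠ b) (hac : a ≠ c) (had : a ≠ d) (hbc : b ≠ c) (hbd : b ≠ d) (hcd : c ≠ d)
    (hS : ∀ x ∈ S, f x = a ∨ f x = b ∨ f x = c ∨ f x = d)
    (ha : ∃ x ∈ S, f x = a) (hb : ∃ x ∈ S, f x = b)
    (hc : ∃ x ∈ S, f x = c) (hd : ∃ x ∈ S, f x = d) : S.card = 4 := by
  have h1 : (S.image f).card = S.card :=
    Finset.card_image_of_injOn (fun x hx y hy h => hinj x hx y hy h)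
  have h2 : S.image f = {a, b, c, d} := by
    ext z
    simp only [Finset.mem_image, Finset.mem_insert, Finset.mem_singleton]
    constructor
    · rintro ⟨x, hx, rfl⟩
      exact hS x hx
    · rintro (rfl | rfl | rfl | rfl) <;> assumption
  rw [← h1, h2]
  simp [Finset.card_insert_of_notMem, *]

set_option maxHeartbeats 2000000 in
theorem row_card (m : ℕ) (hm : 5 ≤ m) (r : ℕ) (hr : r < m) :
    ((C m 1 3 0 2).filter (fun x => x.1 = r)).card = 4 := by
  have k1 := s_spec m (r + 1) (by omega)
  have k2 := s_spec m (r + 2) (by omega)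
  have k3 := s_spec m (r + 3) (by omega)
  refine card4 _ (fun x => x.2.1) r (s m (r + 1)) (s m (r + 2)) (s m (r + 3)) ?_
    (by omega) (by omega) (by omega) (by omega) (by omega) (by omega) ?_
    ⟨(r, r, s m (r + 1)), ?_, rfl⟩ ⟨(r, s m (r + 1), s m (r + 3)), ?_, rfl⟩
    ⟨(r, s m (r + 2), r), ?_, rfl⟩ ⟨(r, s m (r + 3), s m (r + 2)), ?_, rfl⟩
  · intro x hx y hy h
    rw [Finset.mem_filter] at hx hy
    exact (pls1 m hm).1 x hx.1 y hy.1 (hx.2.trans hy.2.symm) h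
  · rintro ⟨r', c, e⟩ hx
    rw [Finset.mem_filter, mem_C] at hx
    simp only at hx ⊢
    obtain ⟨⟨a1, a2, a3, h⟩, rfl⟩ := hx
    rcases h with h | h | h | h <;> omega
  · rw [Finset.mem_filter, mem_C]
    exact ⟨⟨by omega, by omega, by omega, Or.inl ⟨by omega, by omega⟩⟩, rfl⟩
  · rw [Finset.mem_filter, mem_C]
    exact ⟨⟨by omega, by omega, by omega, Or.inr (Or.inl ⟨by omega, by omega⟩)⟩, rfl⟩
  · rw [Finset.mem_filter, mem_C]
    exact ⟨⟨by omega, by omega, by omega, Or.inr (Or.inr (Or.inl ⟨by omega, by omega⟩))⟩, rfl⟩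
  · rw [Finset.mem_filter, mem_C]
    exact ⟨⟨by omega, by omega, by omega, Or.inr (Or.inr (Or.inr ⟨by omega, by omega⟩))⟩, rfl⟩

set_option maxHeartbeats 2000000 in
theorem col_card (m : ℕ) (hm : 5 ≤ m) (c : ℕ) (hr : c < m) :
    ((C m 1 3 0 2).filter (fun x => x.2.1 = c)).card = 4 := by
  have k1 := s_spec m (c + m - 1) (by omega)
  have k2 := s_spec m (c + m - 2) (by omega)
  have k3 := s_spec m (c + m - 3) (by omega)
  have l1 := s_spec m (c + 1) (by omega)
  have l2 := s_spec m (c + 2) (by omega)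
  refine card4 _ (fun x => x.1) c (s m (c + m - 1)) (s m (c + m - 2)) (s m (c + m - 3)) ?_
    (by omega) (by omega) (by omega) (by omega) (by omega) (by omega) ?_
    ⟨(c, c, s m (c + 1)), ?_, rfl⟩ ⟨(s m (c + m - 1), c, s m (c + 2)), ?_, rfl⟩
    ⟨(s m (c + m - 2), c, s m (c + m - 2)), ?_, rfl⟩
    ⟨(s m (c + m - 3), c, s m (c + m - 1)), ?_, rfl⟩
  · intro x hx y hy h
    rw [Finset.mem_filter] at hx hy
    exact (pls1 m hm).1 x hx.1 y hy.1 h (hx.2.trans hy.2.symm)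
  · rintro ⟨r', c', e⟩ hx
    rw [Finset.mem_filter, mem_C] at hx
    simp only at hx ⊢
    obtain ⟨⟨a1, a2, a3, h⟩, rfl⟩ := hx
    rcases h with h | h | h | h <;> omega
  · rw [Finset.mem_filter, mem_C]
    exact ⟨⟨by omega, by omega, by omega, Or.inl ⟨by omega, by omega⟩⟩, rfl⟩
  · rw [Finset.mem_filter, mem_C]
    exact ⟨⟨by omega, by omega, by omega, Or.inr (Or.inl ⟨by omega, by omega⟩)⟩, rfl⟩
  · rw [Finset.mem_filter, mem_C]
    exact ⟨⟨by omega, by omega, by omega, Or.inr (Or.inr (Or.inl ⟨by omega, by omega⟩))⟩, rfl⟩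
  · rw [Finset.mem_filter, mem_C]
    exact ⟨⟨by omega, by omega, by omega, Or.inr (Or.inr (Or.inr ⟨by omega, by omega⟩))⟩, rfl⟩

set_option maxHeartbeats 2000000 in
theorem entry_card (m : ℕ) (hm : 5 ≤ m) (e : ℕ) (hr : e < m) :
    ((C m 1 3 0 2).filter (fun x => x.2.2 = e)).card = 4 := by
  have k1 := s_spec m (e + m - 1) (by omega)
  have k2 := s_spec m (e + m - 2) (by omega)
  have k3 := s_spec m (e + m - 3) (by omega)
  have l1 := s_spec m (e + 1) (by omega)
  have l2 := s_spec m (e + 2) (by omega)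
  refine card4 _ (fun x => x.1) e (s m (e + m - 1)) (s m (e + m - 2)) (s m (e + m - 3)) ?_
    (by omega) (by omega) (by omega) (by omega) (by omega) (by omega) ?_
    ⟨(e, s m (e + 2), e), ?_, rfl⟩ ⟨(s m (e + m - 1), s m (e + m - 1), e), ?_, rfl⟩
    ⟨(s m (e + m - 2), s m (e + 1), e), ?_, rfl⟩
    ⟨(s m (e + m - 3), s m (e + m - 2), e), ?_, rfl⟩
  · intro x hx y hy h
    rw [Finset.mem_filter] at hx hy
    exact (pls1 m hm).2.1 x hx.1 y hy.1 h (hx.2.trans hy.2.symm)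
  · rintro ⟨r', c', e'⟩ hx
    rw [Finset.mem_filter, mem_C] at hx
    simp only at hx ⊢
    obtain ⟨⟨a1, a2, a3, h⟩, rfl⟩ := hx
    rcases h with h | h | h | h <;> omega
  · rw [Finset.mem_filter, mem_C]
    exact ⟨⟨by omega, by omega, by omega, Or.inr (Or.inr (Or.inl ⟨by omega, by omega⟩))⟩, rfl⟩
  · rw [Finset.mem_filter, mem_C]
    exact ⟨⟨by omega, by omega, by omega, Or.inl ⟨by omega, by omega⟩⟩, rfl⟩
  · rw [Finset.mem_filter, mem_C]
    exact ⟨⟨by omega, by omega, by omega, Or.inr (Or.inr (Or.inr ⟨by omega, by omega⟩))⟩, rfl⟩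
  · rw [Finset.mem_filter, mem_C]
    exact ⟨⟨by omega, by omega, by omega, Or.inr (Or.inl ⟨by omega, by omega⟩)⟩, rfl⟩

end Circ

theorem stmt_12 (m : ℕ) (hm : 5 ≤ m) :
    ∃ T T' : Finset (ℕ × ℕ × ℕ),
      IsHomogeneousLatinBitrade 4 T T' ∧ T.card = 4 * m := by
  refine ⟨Circ.C m 1 3 0 2, Circ.C m 2 0 3 1, ⟨⟨Circ.pls1 m hm, Circ.pls2 m hm, Circ.disj m hm,
    ?_, ?_, ?_⟩, ?_, ?_, ?_⟩, ?_⟩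
  · intro r c
    exact ⟨Circ.cells m _ _ _ _ _ _ _ _ hm (by omega) (by omega) (by omega) (by omega) r c,
      Circ.cells m _ _ _ _ _ _ _ _ hm (by omega) (by omega) (by omega) (by omega) r c⟩
  · intro r e
    exact ⟨Circ.rows12 m hm r e, Circ.rows21 m hm r e⟩
  · intro c e
    exact ⟨Circ.cols12 m hm c e, Circ.cols21 m hm c e⟩
  · rintro r ⟨⟨r', c, e⟩, hx, rfl⟩
    exact Circ.row_card m hm _ ((Circ.mem_C ..).1 hx).1
  · rintro c ⟨⟨r, c', e⟩, hx, rfl⟩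
    exact Circ.col_card m hm _ ((Circ.mem_C ..).1 hx).2.1
  · rintro e ⟨⟨r, c, e'⟩, hx, rfl⟩
    exact Circ.entry_card m hm _ ((Circ.mem_C ..).1 hx).2.2.1
  · have h : ∀ x ∈ Circ.C m 1 3 0 2, x.1 ∈ Finset.range m := by
      rintro ⟨r, c, e⟩ hx
      exact Finset.mem_range.2 ((Circ.mem_C ..).1 hx).1
    rw [Finset.card_eq_sum_card_fiberwise h,
      Finset.sum_congr rfl (fun r hr => Circ.row_card m hm r (Finset.mem_range.1 hr))]
    simp [mul_comm]
end

section
/- Let ℓ and p be positive integers with ℓ ≠ 2 and ℓ ≠ 6, and let k_1, …, k_ℓ be nonnegative integers whose sum is positive, such that for each i with k_i > 0 there exists a k_i-homogeneous Latin bitrade of volume k_i·p. Then there exists a (k_1 + ⋯ + k_ℓ)-homogeneous Latin bitrade of volume (k_1 + ⋯ + k_ℓ)·ℓ·p. -/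
/-- Existence of a transversal design TD(4,n), equivalently two orthogonal Latin squares. -/
def OAEx (n : ℕ) : Prop :=
  ∃ (α ι : Type) (_ : Fintype α) (_ : Fintype ι) (f : ι → Fin 4 → α),
    Fintype.card α = n ∧ Fintype.card ι ≤ n ^ 2 ∧
    ∀ i j, i ≠ j → ∀ a b, ∃ x, f x i = a ∧ f x j = b

theorem OAEx.mul {m n : ℕ} (hm : OAEx m) (hn : OAEx n) : OAEx (m * n) := by
  obtain ⟨α, ι, _, _, f, h1, h2, h3⟩ := hm
  obtain ⟨β, κ, _, _, g, k1, k2, k3⟩ := hn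
  refine ⟨α × β, ι × κ, inferInstance, inferInstance, fun x i => (f x.1 i, g x.2 i), ?_, ?_, ?_⟩
  · simp [h1, k1]
  · rw [Fintype.card_prod, mul_pow]
    exact Nat.mul_le_mul h2 k2
  · rintro i j hij ⟨a, a'⟩ ⟨b, b'⟩
    obtain ⟨x, hx, hx'⟩ := h3 i j hij a b
    obtain ⟨y, hy, hy'⟩ := k3 i j hij a' b'
    exact ⟨(x, y), by simp [hx, hy], by simp [hx', hy']⟩

/-- Solving the 2x2 system. -/
theorem solve_pair {R : Type*} [CommRing R] (s t p q : R) (h : IsUnit (s - t)) :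
    ∃ x y : R, x + s * y = p ∧ x + t * y = q := by
  obtain ⟨u, hu⟩ := h.exists_right_inv
  refine ⟨p - s * (u * (p - q)), u * (p - q), by ring, ?_⟩
  linear_combination (-(p - q)) * hu

theorem OAEx.ring (R : Type) [CommRing R] [Fintype R] (w : R) (hw : IsUnit w)
    (hw1 : IsUnit (w - 1)) : OAEx (Fintype.card R) := by
  refine ⟨R, R × R, inferInstance, inferInstance,
    fun x => ![x.1, x.2, x.1 + x.2, x.1 + w * x.2], rfl, by simp [sq], ?_⟩
  obtain ⟨u, hu⟩ := hw.exists_right_inv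
  obtain ⟨v, hv⟩ := hw1.exists_right_inv
  intro i j hij a b
  fin_cases i <;> fin_cases j <;> simp at hij ⊢ <;> first
    | (refine ⟨u * (b - a), ?_⟩; linear_combination (b - a) * hu)
    | (refine ⟨u * (a - b), ?_⟩; linear_combination (a - b) * hu)
    | (refine ⟨a - v * (b - a), v * (b - a), by ring1, ?_⟩; linear_combination (b - a) * hv)
    | (refine ⟨b - v * (a - b), v * (a - b), ?_, by ring1⟩; linear_combination (a - b) * hv)
    | exact ⟨b - a, by ring1⟩
    | exact ⟨a - b, by ring1⟩
    | exact ⟨b - w * a, by ring1⟩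
    | exact ⟨a - w * b, by ring1⟩

theorem OAEx.odd {n : ℕ} (hn : Odd n) : OAEx n := by
  have : NeZero n := ⟨by rintro rfl; simp at hn⟩
  have h2 : IsUnit ((2 : ℕ) : ZMod n) := (ZMod.isUnit_iff_coprime 2 n).2 (by
    simpa using hn)
  have := OAEx.ring (ZMod n) 2 (by exact_mod_cast h2) (by norm_num)
  rwa [ZMod.card] at this

theorem OAEx.two_pow {k : ℕ} (hk : 2 ≤ k) : OAEx (2 ^ k) := by
  have : Fact (Nat.Prime 2) := ⟨Nat.prime_two⟩
  classical
  letI : Fintype (GaloisField 2 k) := Fintype.ofFinite _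
  have hc : Fintype.card (GaloisField 2 k) = 2 ^ k := by
    rw [← Nat.card_eq_fintype_card]; exact GaloisField.card 2 k (by omega)
  have : ∃ w : GaloisField 2 k, w ∉ ({0, 1} : Finset (GaloisField 2 k)) := by
    by_contra! h
    have h1 : (Finset.univ : Finset (GaloisField 2 k)) ⊆ {0, 1} := fun x _ => h x
    have h2 := (Finset.card_le_card h1).trans Finset.card_le_two
    rw [Finset.card_univ, hc] at h2
    have : 2 ^ 2 ≤ 2 ^ k := Nat.pow_le_pow_right (by norm_num) hk
    omega
  obtain ⟨w, hw⟩ := this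
  simp at hw
  rw [← hc]
  exact OAEx.ring _ w (isUnit_iff_ne_zero.2 hw.1) (isUnit_iff_ne_zero.2 (sub_ne_zero.2 hw.2))

/-- Quasi-difference matrices. -/
theorem OAEx.qdm (n u : ℕ) [NeZero n] (C : Type) [Fintype C] (c : C → Fin 4 → ZMod n ⊕ Fin u)
    (hu : OAEx u) (hC : Fintype.card C = n + 2 * u)
    (h1 : ∀ i j, i ≠ j → ∀ d : ZMod n, ∃ x, ∃ a, c x i = Sum.inl a ∧ c x j = Sum.inl (a + d))
    (h2 : ∀ i j, i ≠ j → ∀ k : Fin u, ∃ x, ∃ a, c x i = Sum.inr k ∧ c x j = Sum.inl a) :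
    OAEx (n + u) := by
  obtain ⟨β, κ, _, _, g, k1, k2, k3⟩ := hu
  let e : β ≃ Fin u := Fintype.equivFinOfCardEq k1
  refine ⟨ZMod n ⊕ Fin u, (C × ZMod n) ⊕ κ, inferInstance, inferInstance,
    Sum.elim (fun x i => (c x.1 i).map (· + x.2) id) (fun x i => Sum.inr (e (g x i))), ?_, ?_, ?_⟩
  · simp [ZMod.card]
  · simp only [Fintype.card_sum, Fintype.card_prod, hC, ZMod.card]
    nlinarith
  · rintro i j hij (a | a) (b | b)
    · obtain ⟨x, a', hx, hx'⟩ := h1 i j hij (b - a)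
      exact ⟨Sum.inl (x, a - a'), by simp [hx], by simp [hx']; ring⟩
    · obtain ⟨x, a', hx, hx'⟩ := h2 j i hij.symm b
      exact ⟨Sum.inl (x, a - a'), by simp [hx'], by simp [hx]⟩
    · obtain ⟨x, a', hx, hx'⟩ := h2 i j hij a
      exact ⟨Sum.inl (x, b - a'), by simp [hx], by simp [hx']⟩
    · obtain ⟨x, hx, hx'⟩ := k3 i j hij (e.symm a) (e.symm b)
      exact ⟨Sum.inr x, by simp [hx], by simp [hx']⟩

def base14 : Fin 4 → Fin 4 → ZMod 11 ⊕ Fin 3 :=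
  ![![.inl 0, .inl 1, .inl 4, .inl 6], ![.inr 0, .inl 0, .inl 4, .inl 1],
    ![.inr 1, .inl 0, .inl 6, .inl 2], ![.inr 2, .inl 0, .inl 9, .inl 8]]

def col14 : Option (Fin 4 × Fin 4) → Fin 4 → ZMod 11 ⊕ Fin 3
  | none, _ => .inl 0
  | some x, i => base14 x.1 (i + x.2)

def col10 : Option (Fin 3 × Fin 4) → Fin 4 → ZMod 7 ⊕ Fin 3
  | none, _ => .inl 0
  | some x, i =>
    (![![.inl 0, .inl (x.1.val + 1), .inl (-(x.1.val + 1)), .inr x.1],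
      ![.inl (x.1.val + 1), .inl 0, .inr x.1, .inl (-(x.1.val + 1))],
      ![.inl (-(x.1.val + 1)), .inr x.1, .inl 0, .inl (x.1.val + 1)],
      ![.inr x.1, .inl (-(x.1.val + 1)), .inl (x.1.val + 1), .inl 0]] :
        Fin 4 → Fin 4 → ZMod 7 ⊕ Fin 3) x.2 i

set_option maxRecDepth 100000 in
set_option maxHeartbeats 4000000 in
theorem OAEx.ten : OAEx 10 := by
  refine OAEx.qdm 7 3 _ col10 (OAEx.odd (by decide)) (by simp) ?_ ?_
  · decide +kernel
  · decide +kernel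

set_option maxRecDepth 100000 in
set_option maxHeartbeats 4000000 in
theorem OAEx.fourteen : OAEx 14 := by
  refine OAEx.qdm 11 3 _ col14 (OAEx.odd (by decide)) (by simp) ?_ ?_
  · decide +kernel
  · decide +kernel

/-- The field with four elements with zero renamed to infinity; blocks of a TD(4,4). -/
def sq4 : Fin 4 → Fin 4 → Option (Fin 3) :=
  ![![none, some 0, some 1, some 2], ![some 0, none, some 2, some 1],
    ![some 1, some 2, none, some 0], ![some 2, some 1, some 0, none]]

def mul4 : Fin 4 → Fin 4 := ![0, 2, 3, 1]

def el4 : Fin 4 → Option (Fin 3) := ![none, some 0, some 1, some 2]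

def td4 (x : Fin 4 × Fin 4) : Fin 4 → Option (Fin 3) :=
  ![el4 x.1, el4 x.2, sq4 x.1 x.2, sq4 x.1 (mul4 x.2)]

abbrev Blk := {x : Fin 4 × Fin 4 // x ≠ (0, 0)}

theorem td4_spec : ∀ i j, i ≠ j → ∀ a b, (a ≠ none ∨ b ≠ none) →
    ∃ x : Blk, td4 x.1 i = a ∧ td4 x.1 j = b := by
  decide +kernel

def td3 (x : Fin 3 × Fin 3) : Fin 4 → Fin 3 := ![x.1, x.2, x.1 + x.2, x.1 + 2 * x.2]

theorem td3_spec : ∀ i j, i ≠ j → ∀ a b, ∃ x, td3 x i = a ∧ td3 x j = b := by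
  decide +kernel

/-- Wilson's construction. -/
theorem OAEx.wilson (t u : ℕ) (ht : Nat.Coprime 6 t) (hut : u ≤ t) (hu : OAEx u) (ht0 : t ≠ 0) :
    OAEx (3 * t + u) := by
  classical
  have : NeZero t := ⟨ht0⟩
  obtain ⟨U, -, hU⟩ := Finset.exists_subset_card_eq
    (s := (Finset.univ : Finset (ZMod t))) (n := u) (by simpa [ZMod.card] using hut)
  obtain ⟨β, κ, _, _, g, k1, k2, k3⟩ := hu
  have hUc : Fintype.card {y // y ∈ U} = u := by simp [hU]
  have hUc' : Fintype.card {y // y ∉ U} = t - u := by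
    rw [Fintype.card_subtype_compl, hUc, ZMod.card]
  let e : β ≃ {y // y ∈ U} := Fintype.equivOfCardEq (by rw [k1, hUc])
  let co : ZMod t → ZMod t → Fin 4 → ZMod t := fun x y i => x + (i.val : ZMod t) * y
  have h2 : IsUnit (2 : ZMod t) := by
    have := (ZMod.isUnit_iff_coprime 2 t).2 (Nat.Coprime.coprime_dvd_left (by norm_num) ht)
    exact_mod_cast this
  have h3 : IsUnit (3 : ZMod t) := by
    have := (ZMod.isUnit_iff_coprime 3 t).2 (Nat.Coprime.coprime_dvd_left (by norm_num) ht)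
    exact_mod_cast this
  have hunit : ∀ i j : Fin 4, i ≠ j → IsUnit ((i.val : ZMod t) - (j.val : ZMod t)) := by
    intro i j hij
    fin_cases i <;> fin_cases j <;> simp at hij ⊢ <;> norm_num <;> assumption
  have hco : ∀ i j : Fin 4, i ≠ j → ∀ p q, ∃ x y, co x y i = p ∧ co x y j = q :=
    fun i j hij p q => solve_pair _ _ p q (hunit i j hij)
  let F : (((ZMod t × {y // y ∉ U}) × (Fin 3 × Fin 3)) ⊕ ((ZMod t × {y // y ∈ U}) × Blk)) ⊕ κ →
      Fin 4 → (ZMod t × Fin 3) ⊕ {y // y ∈ U} := fun z i =>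
    match z with
    | .inl (.inl ((x, y), w)) => .inl (co x y i, td3 w i)
    | .inl (.inr ((x, y), w)) =>
      match td4 w.1 i with
      | none => .inr y
      | some s => .inl (co x y i, s)
    | .inr k => .inr (e (g k i))
  refine ⟨_, _, inferInstance, inferInstance, F, ?_, ?_, ?_⟩
  · simp [ZMod.card, hU]; ring
  · have hb : Fintype.card Blk = 15 := by decide +kernel
    simp only [Fintype.card_sum, Fintype.card_prod, hUc, hUc', hb, ZMod.card, Fintype.card_fin]
    obtain ⟨v, rfl⟩ := Nat.exists_eq_add_of_le hut
    rw [Nat.add_sub_cancel_left]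
    nlinarith
  · rintro i j hij (⟨p, s⟩ | a) (⟨q, s'⟩ | b)
    · obtain ⟨x, y, hx, hy⟩ := hco i j hij p q
      by_cases hyU : y ∈ U
      · obtain ⟨w, hw, hw'⟩ := td4_spec i j hij (some s) (some s') (by simp)
        exact ⟨.inl (.inr ((x, ⟨y, hyU⟩), w)), by simp [F, hw, hx], by simp [F, hw', hy]⟩
      · obtain ⟨w, hw, hw'⟩ := td3_spec i j hij s s'
        exact ⟨.inl (.inl ((x, ⟨y, hyU⟩), w)), by simp [F, hw, hx], by simp [F, hw', hy]⟩
    · obtain ⟨w, hw, hw'⟩ := td4_spec i j hij (some s) none (by simp)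
      exact ⟨.inl (.inr ((p - (i.val : ZMod t) * b, b), w)), by simp [F, hw, co], by simp [F, hw']⟩
    · obtain ⟨w, hw, hw'⟩ := td4_spec i j hij none (some s') (by simp)
      exact ⟨.inl (.inr ((q - (j.val : ZMod t) * a, a), w)), by simp [F, hw], by simp [F, hw', co]⟩
    · obtain ⟨x, hx, hx'⟩ := k3 i j hij (e.symm a) (e.symm b)
      exact ⟨.inr x, by simp [F, hx], by simp [F, hx']⟩

theorem OAEx.all (n : ℕ) (h0 : 0 < n) (h2 : n ≠ 2) (h6 : n ≠ 6) : OAEx n := by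
  have hW : ∀ t, t % 2 = 1 → t % 3 ≠ 0 → n % 4 = 2 → 3 * t ≤ n → n ≤ 4 * t → OAEx n := by
    intro t ht ht3 hn h1 h2
    have : OAEx (3 * t + (n - 3 * t)) := by
      refine OAEx.wilson t _ ?_ (by omega) (OAEx.odd (Nat.odd_iff.2 (by omega))) (by omega)
      have a : Nat.Coprime 2 t := (Nat.Prime.coprime_iff_not_dvd Nat.prime_two).2 (by omega)
      have b : Nat.Coprime 3 t := (Nat.Prime.coprime_iff_not_dvd Nat.prime_three).2 (by omega)
      exact Nat.Coprime.mul_left a b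
    rwa [Nat.add_sub_cancel' h1] at this
  have hn : n % 2 = 1 ∨ n % 4 = 0 ∨ n % 4 = 2 := by omega
  rcases hn with hn | hn | hn
  · exact OAEx.odd (Nat.odd_iff.2 hn)
  · obtain ⟨k, m, hm, rfl⟩ := Nat.exists_eq_two_pow_mul_odd h0.ne'
    refine (OAEx.two_pow ?_).mul (OAEx.odd hm)
    by_contra hk
    have hm2 := Nat.odd_iff.1 hm
    interval_cases k <;> omega
  · by_cases h10 : n = 10
    · exact h10 ▸ OAEx.ten
    by_cases h14 : n = 14
    · exact h14 ▸ OAEx.fourteen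
    by_cases h30 : n = 30
    · exact h30 ▸ OAEx.mul (m := 3) (OAEx.odd (by decide)) OAEx.ten
    have : ∃ t, t % 2 = 1 ∧ t % 3 ≠ 0 ∧ 3 * t ≤ n ∧ n ≤ 4 * t := by
      by_cases hs : n < 60
      · have : n = 18 ∨ n = 22 ∨ n = 26 ∨ n = 34 ∨ n = 38 ∨ n = 42 ∨ n = 46 ∨ n = 50 ∨
          n = 54 ∨ n = 58 := by omega
        rcases this with h | h | h | h | h | h | h | h | h | h
        · exact ⟨5, by omega⟩
        · exact ⟨7, by omega⟩
        · exact ⟨7, by omega⟩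
        · exact ⟨11, by omega⟩
        · exact ⟨11, by omega⟩
        · exact ⟨11, by omega⟩
        · exact ⟨13, by omega⟩
        · exact ⟨13, by omega⟩
        · exact ⟨17, by omega⟩
        · exact ⟨17, by omega⟩
      · obtain ⟨s, hs⟩ : ∃ s, s = n / 3 := ⟨_, rfl⟩
        have : s % 6 < 6 := Nat.mod_lt _ (by norm_num)
        by_cases h5 : s % 6 = 5
        · exact ⟨s, by omega⟩
        by_cases h0 : s % 6 = 0
        · exact ⟨s - 1, by omega⟩
        · exact ⟨s - s % 6 + 1, by omega⟩
    obtain ⟨t, a, b, c, d⟩ := this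
    exact hW t a b hn c d

/-- Latin bitrades over an arbitrary type of labels. -/
def GPLS {R : Type*} (T : Finset (R × R × R)) : Prop :=
  (∀ x ∈ T, ∀ y ∈ T, x.1 = y.1 → x.2.1 = y.2.1 → x = y) ∧
  (∀ x ∈ T, ∀ y ∈ T, x.1 = y.1 → x.2.2 = y.2.2 → x = y) ∧
  (∀ x ∈ T, ∀ y ∈ T, x.2.1 = y.2.1 → x.2.2 = y.2.2 → x = y)

def GBT {R : Type*} (T T' : Finset (R × R × R)) : Prop :=
  GPLS T ∧ GPLS T' ∧
  Disjoint T T' ∧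
  (∀ r c, (∃ e, (r, c, e) ∈ T) ↔ (∃ e, (r, c, e) ∈ T')) ∧
  (∀ r e, (∃ c, (r, c, e) ∈ T) ↔ (∃ c, (r, c, e) ∈ T')) ∧
  (∀ c e, (∃ r, (r, c, e) ∈ T) ↔ (∃ r, (r, c, e) ∈ T'))

def GHB {R : Type*} [DecidableEq R] (k : ℕ) (T T' : Finset (R × R × R)) : Prop :=
  GBT T T' ∧
  (∀ r, (∃ x ∈ T, x.1 = r) → (T.filter (fun x => x.1 = r)).card = k) ∧
  (∀ c, (∃ x ∈ T, x.2.1 = c) → (T.filter (fun x => x.2.1 = c)).card = k) ∧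
  (∀ e, (∃ x ∈ T, x.2.2 = e) → (T.filter (fun x => x.2.2 = e)).card = k)

theorem GPLS.image {A B : Type*} [DecidableEq B] {T : Finset (A × A × A)} (h : GPLS T)
    (fr fc fe : A → B)
    (hr : ∀ x ∈ T, ∀ y ∈ T, fr x.1 = fr y.1 → x.1 = y.1)
    (hc : ∀ x ∈ T, ∀ y ∈ T, fc x.2.1 = fc y.2.1 → x.2.1 = y.2.1)
    (he : ∀ x ∈ T, ∀ y ∈ T, fe x.2.2 = fe y.2.2 → x.2.2 = y.2.2) :
    GPLS (T.image (fun x => (fr x.1, fc x.2.1, fe x.2.2))) := by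
  obtain ⟨h1, h2, h3⟩ := h
  refine ⟨?_, ?_, ?_⟩
  all_goals
    intro x hx' y hy' e1 e2
    obtain ⟨x, hx, rfl⟩ := Finset.mem_image.1 hx'
    obtain ⟨y, hy, rfl⟩ := Finset.mem_image.1 hy'
  · rw [h1 x hx y hy (hr x hx y hy e1) (hc x hx y hy e2)]
  · rw [h2 x hx y hy (hr x hx y hy e1) (he x hx y hy e2)]
  · rw [h3 x hx y hy (hc x hx y hy e1) (he x hx y hy e2)]

theorem GHB.image {A B : Type*} [DecidableEq A] [DecidableEq B] {k : ℕ}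
    {T T' : Finset (A × A × A)} (h : GHB k T T') (fr fc fe : A → B)
    (hr : ∀ x ∈ T, ∀ y ∈ T, fr x.1 = fr y.1 → x.1 = y.1)
    (hc : ∀ x ∈ T, ∀ y ∈ T, fc x.2.1 = fc y.2.1 → x.2.1 = y.2.1)
    (he : ∀ x ∈ T, ∀ y ∈ T, fe x.2.2 = fe y.2.2 → x.2.2 = y.2.2) :
    GHB k (T.image (fun x => (fr x.1, fc x.2.1, fe x.2.2)))
      (T'.image (fun x => (fr x.1, fc x.2.1, fe x.2.2))) := by
  obtain ⟨⟨p1, p2, hd, b1, b2, b3⟩, c1, c2, c3⟩ := h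
  have tr : ∀ x ∈ T', ∃ y ∈ T, y.1 = x.1 := by
    rintro ⟨r, c, e⟩ hx
    obtain ⟨e', h'⟩ := (b1 r c).2 ⟨e, hx⟩
    exact ⟨_, h', rfl⟩
  have tc : ∀ x ∈ T', ∃ y ∈ T, y.2.1 = x.2.1 := by
    rintro ⟨r, c, e⟩ hx
    obtain ⟨e', h'⟩ := (b1 r c).2 ⟨e, hx⟩
    exact ⟨_, h', rfl⟩
  have te : ∀ x ∈ T', ∃ y ∈ T, y.2.2 = x.2.2 := by
    rintro ⟨r, c, e⟩ hx
    obtain ⟨e', h'⟩ := (b2 r e).2 ⟨c, hx⟩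
    exact ⟨_, h', rfl⟩
  have inj : ∀ x ∈ T, ∀ y ∈ T, (fr x.1, fc x.2.1, fe x.2.2) = (fr y.1, fc y.2.1, fe y.2.2) →
      x = y := by
    intro x hx y hy hxy
    simp only [Prod.mk.injEq] at hxy
    exact p1.1 x hx y hy (hr x hx y hy hxy.1) (hc x hx y hy hxy.2.1)
  refine ⟨⟨p1.image fr fc fe hr hc he, p2.image fr fc fe ?_ ?_ ?_, ?_, ?_, ?_, ?_⟩, ?_, ?_, ?_⟩
  · intro x hx y hy hxy
    obtain ⟨x', hx', e1⟩ := tr x hx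
    obtain ⟨y', hy', e2⟩ := tr y hy
    rw [← e1, ← e2] at hxy ⊢
    exact hr _ hx' _ hy' hxy
  · intro x hx y hy hxy
    obtain ⟨x', hx', e1⟩ := tc x hx
    obtain ⟨y', hy', e2⟩ := tc y hy
    rw [← e1, ← e2] at hxy ⊢
    exact hc _ hx' _ hy' hxy
  · intro x hx y hy hxy
    obtain ⟨x', hx', e1⟩ := te x hx
    obtain ⟨y', hy', e2⟩ := te y hy
    rw [← e1, ← e2] at hxy ⊢
    exact he _ hx' _ hy' hxy
  · rw [Finset.disjoint_left]
    intro z hz hz'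
    obtain ⟨x, hx, rfl⟩ := Finset.mem_image.1 hz
    obtain ⟨y, hy, hxy⟩ := Finset.mem_image.1 hz'
    simp only [Prod.mk.injEq] at hxy
    obtain ⟨x1, hx1, e1⟩ := tr y hy
    obtain ⟨x2, hx2, e2⟩ := tc y hy
    obtain ⟨x3, hx3, e3⟩ := te y hy
    rw [← e1, ← e2, ← e3] at hxy
    have a1 := hr _ hx1 _ hx hxy.1
    have a2 := hc _ hx2 _ hx hxy.2.1
    have a3 := he _ hx3 _ hx hxy.2.2
    have : y = x := by
      ext
      · rw [← e1, a1]
      · rw [← e2, a2]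
      · rw [← e3, a3]
    exact Finset.disjoint_left.1 hd hx (this ▸ hy)
  · intro r c
    simp only [Finset.mem_image, Prod.mk.injEq, Prod.exists]
    constructor
    · rintro ⟨e, r', c', e', hm, rfl, rfl, rfl⟩
      obtain ⟨z, hz⟩ := (b1 _ _).1 ⟨_, hm⟩
      exact ⟨_, _, _, _, hz, rfl, rfl, rfl⟩
    · rintro ⟨e, r', c', e', hm, rfl, rfl, rfl⟩
      obtain ⟨z, hz⟩ := (b1 _ _).2 ⟨_, hm⟩
      exact ⟨_, _, _, _, hz, rfl, rfl, rfl⟩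
  · intro r c
    simp only [Finset.mem_image, Prod.mk.injEq, Prod.exists]
    constructor
    · rintro ⟨e, r', c', e', hm, rfl, rfl, rfl⟩
      obtain ⟨z, hz⟩ := (b2 _ _).1 ⟨_, hm⟩
      exact ⟨_, _, _, _, hz, rfl, rfl, rfl⟩
    · rintro ⟨e, r', c', e', hm, rfl, rfl, rfl⟩
      obtain ⟨z, hz⟩ := (b2 _ _).2 ⟨_, hm⟩
      exact ⟨_, _, _, _, hz, rfl, rfl, rfl⟩
  · intro r c
    simp only [Finset.mem_image, Prod.mk.injEq, Prod.exists]
    constructor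
    · rintro ⟨e, r', c', e', hm, rfl, rfl, rfl⟩
      obtain ⟨z, hz⟩ := (b3 _ _).1 ⟨_, hm⟩
      exact ⟨_, _, _, _, hz, rfl, rfl, rfl⟩
    · rintro ⟨e, r', c', e', hm, rfl, rfl, rfl⟩
      obtain ⟨z, hz⟩ := (b3 _ _).2 ⟨_, hm⟩
      exact ⟨_, _, _, _, hz, rfl, rfl, rfl⟩
  · rintro r ⟨z, hz, rfl⟩
    obtain ⟨x, hx, rfl⟩ := Finset.mem_image.1 hz
    rw [Finset.filter_image, Finset.card_image_of_injOn]
    · rw [← c1 x.1 ⟨x, hx, rfl⟩]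
      congr 1
      apply Finset.filter_congr
      intro y hy
      exact ⟨fun h => hr y hy x hx h, fun h => by rw [h]⟩
    · intro a ha b hb hab
      exact inj a (Finset.mem_filter.1 ha).1 b (Finset.mem_filter.1 hb).1 hab
  · rintro r ⟨z, hz, rfl⟩
    obtain ⟨x, hx, rfl⟩ := Finset.mem_image.1 hz
    rw [Finset.filter_image, Finset.card_image_of_injOn]
    · rw [← c2 x.2.1 ⟨x, hx, rfl⟩]
      congr 1
      apply Finset.filter_congr
      intro y hy
      exact ⟨fun h => hc y hy x hx h, fun h => by rw [h]⟩
    · intro a ha b hb hab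
      exact inj a (Finset.mem_filter.1 ha).1 b (Finset.mem_filter.1 hb).1 hab
  · rintro r ⟨z, hz, rfl⟩
    obtain ⟨x, hx, rfl⟩ := Finset.mem_image.1 hz
    rw [Finset.filter_image, Finset.card_image_of_injOn]
    · rw [← c3 x.2.2 ⟨x, hx, rfl⟩]
      congr 1
      apply Finset.filter_congr
      intro y hy
      exact ⟨fun h => he y hy x hx h, fun h => by rw [h]⟩
    · intro a ha b hb hab
      exact inj a (Finset.mem_filter.1 ha).1 b (Finset.mem_filter.1 hb).1 hab

/-- A labelling of the values of `g` on `T` by `Fin p`. -/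
theorem exists_label {X A : Type*} [DecidableEq A] (T : Finset X) (g : X → A) (k p : ℕ)
    (hk : 0 < k) (hp : 0 < p) (hT : T.card = k * p)
    (h : ∀ r, (∃ x ∈ T, g x = r) → (T.filter (fun x => g x = r)).card = k) :
    ∃ f : A → Fin p, (∀ x ∈ T, ∀ y ∈ T, f (g x) = f (g y) → g x = g y) ∧
      ∀ r, ∃ x ∈ T, f (g x) = r := by
  have hS : (T.image g).card = p := by
    have h1 : T.card = ∑ b ∈ T.image g, (T.filter (fun x => g x = b)).card :=
      Finset.card_eq_sum_card_image g T
    rw [Finset.sum_congr rfl (fun b hb => h b (by simpa using hb)), Finset.sum_const, hT,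
      smul_eq_mul, mul_comm] at h1
    exact (Nat.eq_of_mul_eq_mul_right hk h1).symm
  let e : {x // x ∈ T.image g} ≃ Fin p := Finset.equivFinOfCardEq hS
  have hm : ∀ x ∈ T, g x ∈ T.image g := fun x hx => Finset.mem_image_of_mem _ hx
  refine ⟨fun a => if ha : a ∈ T.image g then e ⟨a, ha⟩ else ⟨0, hp⟩, ?_, ?_⟩
  · intro x hx y hy hxy
    beta_reduce at hxy
    rw [dif_pos (hm x hx), dif_pos (hm y hy)] at hxy
    exact congrArg Subtype.val (e.injective hxy)
  · intro r
    obtain ⟨x, hx, hxr⟩ := Finset.mem_image.1 (e.symm r).2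
    refine ⟨x, hx, ?_⟩
    beta_reduce
    rw [dif_pos (hm x hx)]
    have : (⟨g x, hm x hx⟩ : {x // x ∈ T.image g}) = e.symm r := Subtype.ext hxr
    rw [this, Equiv.apply_symm_apply]

/-- Fully occupied homogeneous bitrades. -/
def FHB {R : Type*} [DecidableEq R] (k : ℕ) (T T' : Finset (R × R × R)) : Prop :=
  GBT T T' ∧
  (∀ r, (T.filter (fun x => x.1 = r)).card = k) ∧
  (∀ c, (T.filter (fun x => x.2.1 = c)).card = k) ∧
  (∀ e, (T.filter (fun x => x.2.2 = e)).card = k)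

theorem exists_FHB (k p : ℕ) (hp : 0 < p)
    (h : 0 < k → ∃ T T' : Finset (ℕ × ℕ × ℕ),
        IsHomogeneousLatinBitrade k T T' ∧ T.card = k * p) :
    ∃ T T' : Finset (Fin p × Fin p × Fin p), FHB k T T' := by
  rcases Nat.eq_zero_or_pos k with rfl | hk
  · exact ⟨∅, ∅, by simp [FHB, GBT, GPLS]⟩
  obtain ⟨T, T', hT, hc⟩ := h hk
  replace hT : GHB k T T' := hT
  obtain ⟨fr, r1, r2⟩ := exists_label T (fun x => x.1) k p hk hp hc hT.2.1
  obtain ⟨fc, c1, c2⟩ := exists_label T (fun x => x.2.1) k p hk hp hc hT.2.2.1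
  obtain ⟨fe, e1, e2⟩ := exists_label T (fun x => x.2.2) k p hk hp hc hT.2.2.2
  obtain ⟨a, b, c, d⟩ := hT.image fr fc fe r1 c1 e1
  refine ⟨_, _, a, fun r => b r ?_, fun r => c r ?_, fun r => d r ?_⟩
  · obtain ⟨x, hx, hh⟩ := r2 r
    exact ⟨_, Finset.mem_image_of_mem _ hx, hh⟩
  · obtain ⟨x, hx, hh⟩ := c2 r
    exact ⟨_, Finset.mem_image_of_mem _ hx, hh⟩
  · obtain ⟨x, hx, hh⟩ := e2 r
    exact ⟨_, Finset.mem_image_of_mem _ hx, hh⟩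

section Big
variable {α ι P : Type} [Fintype α] [Fintype ι] [DecidableEq α] [DecidableEq P]

def bigMap (f : ι → Fin 4 → α) (z : Σ _ : ι, P × P × P) : (α × P) × (α × P) × (α × P) :=
  ((f z.1 0, z.2.1), (f z.1 1, z.2.2.1), (f z.1 2, z.2.2.2))

def big (f : ι → Fin 4 → α) (T : α → Finset (P × P × P)) :
    Finset ((α × P) × (α × P) × (α × P)) :=
  (Finset.univ.sigma (fun b : ι => T (f b 3))).image (bigMap f)

theorem mem_big (f : ι → Fin 4 → α) (T : α → Finset (P × P × P)) (i j e : α) (r c s : P) :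
    ((i, r), (j, c), (e, s)) ∈ big f T ↔
      ∃ b, f b 0 = i ∧ f b 1 = j ∧ f b 2 = e ∧ (r, c, s) ∈ T (f b 3) := by
  simp only [big, bigMap, Finset.mem_image, Finset.mem_sigma, Finset.mem_univ, true_and,
    Sigma.exists, Prod.exists, Prod.mk.injEq]
  constructor
  · rintro ⟨b, r', c', s', hm, ⟨rfl, rfl⟩, ⟨rfl, rfl⟩, rfl, rfl⟩
    exact ⟨b, rfl, rfl, rfl, hm⟩
  · rintro ⟨b, rfl, rfl, rfl, hm⟩
    exact ⟨b, r, c, s, hm, ⟨rfl, rfl⟩, ⟨rfl, rfl⟩, rfl, rfl⟩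

theorem big_pls (f : ι → Fin 4 → α) (T : α → Finset (P × P × P))
    (hf : ∀ i j, i ≠ j → ∀ b b', f b i = f b' i → f b j = f b' j → b = b')
    (hT : ∀ a, GPLS (T a)) : GPLS (big f T) := by
  refine ⟨?_, ?_, ?_⟩
  all_goals
    rintro ⟨⟨i, r⟩, ⟨j, c⟩, ⟨e, s⟩⟩ hx ⟨⟨i', r'⟩, ⟨j', c'⟩, ⟨e', s'⟩⟩ hy h1 h2
    obtain ⟨b, rfl, rfl, rfl, hm⟩ := (mem_big _ _ _ _ _ _ _ _).1 hx
    obtain ⟨b', rfl, rfl, rfl, hm'⟩ := (mem_big _ _ _ _ _ _ _ _).1 hy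
    simp only [Prod.mk.injEq] at h1 h2
    obtain ⟨h1, g1⟩ := h1
    obtain ⟨h2, g2⟩ := h2
  · obtain rfl := hf 0 1 (by decide) _ _ h1 h2
    have := (hT _).1 _ hm _ hm' g1 g2
    simp only [Prod.mk.injEq] at this ⊢
    simp [this]
  · obtain rfl := hf 0 2 (by decide) _ _ h1 h2
    have := (hT _).2.1 _ hm _ hm' g1 g2
    simp only [Prod.mk.injEq] at this ⊢
    simp [this]
  · obtain rfl := hf 1 2 (by decide) _ _ h1 h2
    have := (hT _).2.2 _ hm _ hm' g1 g2
    simp only [Prod.mk.injEq] at this ⊢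
    simp [this]

theorem big_inj (f : ι → Fin 4 → α)
    (hf : ∀ i j, i ≠ j → ∀ b b', f b i = f b' i → f b j = f b' j → b = b') :
    Function.Injective (bigMap (P := P) f) := by
  rintro ⟨b, r, c, s⟩ ⟨b', r', c', s'⟩ h
  simp only [bigMap, Prod.mk.injEq] at h
  obtain ⟨⟨h1, rfl⟩, ⟨h2, rfl⟩, ⟨h3, rfl⟩⟩ := h
  obtain rfl := hf 0 1 (by decide) _ _ h1 h2
  rfl

theorem big_sum (f : ι → Fin 4 → α) (k : α → ℕ)
    (hf : ∀ i j, i ≠ j → ∀ b b', f b i = f b' i → f b j = f b' j → b = b')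
    (hs : ∀ i j, i ≠ j → ∀ a a', ∃ b, f b i = a ∧ f b j = a')
    (T : α → Finset (P × P × P)) (q : Fin 4) (hq : q ≠ 3) (a : α)
    (Q : P × P × P → Prop) [DecidablePred Q] (hk : ∀ m, ((T m).filter Q).card = k m)
    (Z : (α × P) × (α × P) × (α × P) → Prop) [DecidablePred Z]
    (hZ : ∀ z, Z (bigMap f z) ↔ f z.1 q = a ∧ Q z.2) :
    ((big f T).filter Z).card = ∑ m, k m := by
  classical
  rw [big, Finset.filter_image, Finset.card_image_of_injective _ (big_inj f hf)]
  have : (Finset.univ.sigma (fun b : ι => T (f b 3))).filter (fun z => Z (bigMap f z)) =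
      (Finset.univ.filter (fun b => f b q = a)).sigma (fun b => (T (f b 3)).filter Q) := by
    ext z
    simp only [Finset.mem_filter, Finset.mem_sigma, Finset.mem_univ, true_and, hZ]
    tauto
  rw [this, Finset.card_sigma]
  refine Finset.sum_bij (fun b _ => f b 3) (fun _ _ => Finset.mem_univ _) ?_ ?_ ?_
  · intro b hb b' hb' h
    simp only [Finset.mem_filter, Finset.mem_univ, true_and] at hb hb'
    exact hf q 3 hq _ _ (hb.trans hb'.symm) h
  · intro m _
    obtain ⟨b, h1, h2⟩ := hs q 3 hq a m
    exact ⟨b, by simpa using h1, h2⟩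
  · intro b _
    exact hk _

theorem big_FHB (f : ι → Fin 4 → α) (k : α → ℕ)
    (hf : ∀ i j, i ≠ j → ∀ b b', f b i = f b' i → f b j = f b' j → b = b')
    (hs : ∀ i j, i ≠ j → ∀ a a', ∃ b, f b i = a ∧ f b j = a')
    (T T' : α → Finset (P × P × P)) (hT : ∀ a, FHB (k a) (T a) (T' a)) :
    FHB (∑ a, k a) (big f T) (big f T') := by
  refine ⟨⟨big_pls f T hf fun a => (hT a).1.1, big_pls f T' hf fun a => (hT a).1.2.1,
    ?_, ?_, ?_, ?_⟩, ?_, ?_, ?_⟩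
  · rw [Finset.disjoint_left]
    rintro ⟨⟨i, r⟩, ⟨j, c⟩, ⟨e, s⟩⟩ hx hy
    obtain ⟨b, h1, h2, h3, hm⟩ := (mem_big _ _ _ _ _ _ _ _).1 hx
    obtain ⟨b', h1', h2', h3', hm'⟩ := (mem_big _ _ _ _ _ _ _ _).1 hy
    obtain rfl := hf 0 1 (by decide) _ _ (h1.trans h1'.symm) (h2.trans h2'.symm)
    exact Finset.disjoint_left.1 (hT _).1.2.2.1 hm hm'
  · rintro ⟨i, r⟩ ⟨j, c⟩
    simp only [Prod.exists, mem_big]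
    constructor
    · rintro ⟨e, s, b, h1, h2, h3, hm⟩
      obtain ⟨z, hz⟩ := ((hT _).1.2.2.2.1 _ _).1 ⟨_, hm⟩
      exact ⟨e, z, b, h1, h2, h3, hz⟩
    · rintro ⟨e, s, b, h1, h2, h3, hm⟩
      obtain ⟨z, hz⟩ := ((hT _).1.2.2.2.1 _ _).2 ⟨_, hm⟩
      exact ⟨e, z, b, h1, h2, h3, hz⟩
  · rintro ⟨i, r⟩ ⟨j, c⟩
    simp only [Prod.exists, mem_big]
    constructor
    · rintro ⟨e, s, b, h1, h2, h3, hm⟩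
      obtain ⟨z, hz⟩ := ((hT _).1.2.2.2.2.1 _ _).1 ⟨_, hm⟩
      exact ⟨e, z, b, h1, h2, h3, hz⟩
    · rintro ⟨e, s, b, h1, h2, h3, hm⟩
      obtain ⟨z, hz⟩ := ((hT _).1.2.2.2.2.1 _ _).2 ⟨_, hm⟩
      exact ⟨e, z, b, h1, h2, h3, hz⟩
  · rintro ⟨i, r⟩ ⟨j, c⟩
    simp only [Prod.exists, mem_big]
    constructor
    · rintro ⟨e, s, b, h1, h2, h3, hm⟩
      obtain ⟨z, hz⟩ := ((hT _).1.2.2.2.2.2 _ _).1 ⟨_, hm⟩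
      exact ⟨e, z, b, h1, h2, h3, hz⟩
    · rintro ⟨e, s, b, h1, h2, h3, hm⟩
      obtain ⟨z, hz⟩ := ((hT _).1.2.2.2.2.2 _ _).2 ⟨_, hm⟩
      exact ⟨e, z, b, h1, h2, h3, hz⟩
  · rintro ⟨a, r⟩
    exact big_sum f k hf hs T 0 (by decide) a (fun x => x.1 = r) (fun m => (hT m).2.1 r) _
      (fun z => by simp [bigMap])
  · rintro ⟨a, r⟩
    exact big_sum f k hf hs T 1 (by decide) a (fun x => x.2.1 = r) (fun m => (hT m).2.2.1 r) _
      (fun z => by simp [bigMap])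
  · rintro ⟨a, r⟩
    exact big_sum f k hf hs T 2 (by decide) a (fun x => x.2.2 = r) (fun m => (hT m).2.2.2 r) _
      (fun z => by simp [bigMap])

end Big

theorem stmt_13 (l p : ℕ) (hl : 0 < l) (hp : 0 < p) (hl2 : l ≠ 2) (hl6 : l ≠ 6)
    (ks : Fin l → ℕ) (hpos : 0 < ∑ i, ks i)
    (h : ∀ i : Fin l, 0 < ks i →
      ∃ T T' : Finset (ℕ × ℕ × ℕ),
        IsHomogeneousLatinBitrade (ks i) T T' ∧ T.card = ks i * p) :
    ∃ T T' : Finset (ℕ × ℕ × ℕ),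
      IsHomogeneousLatinBitrade (∑ i, ks i) T T' ∧
      T.card = (∑ i, ks i) * l * p := by
  classical
  obtain ⟨α, ι, _, _, f, hα, hι, hs⟩ := OAEx.all l hl hl2 hl6
  have hf : ∀ i j, i ≠ j → ∀ b b', f b i = f b' i → f b j = f b' j → b = b' := by
    intro i j hij b b' h1 h2
    let g : ι → α × α := fun b => (f b i, f b j)
    have hg : Function.Surjective g := by
      rintro ⟨a, a'⟩
      obtain ⟨b, h1, h2⟩ := hs i j hij a a'
      exact ⟨b, by simp [g, h1, h2]⟩
    have hcard : Fintype.card ι = Fintype.card (α × α) := by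
      apply le_antisymm
      · rw [Fintype.card_prod, hα, ← sq]; exact hι
      · exact Fintype.card_le_of_surjective g hg
    have hb := (Fintype.bijective_iff_surjective_and_card g).2 ⟨hg, hcard⟩
    exact hb.1 (by simp [g, h1, h2])
  let e : α ≃ Fin l := Fintype.equivFinOfCardEq hα
  have hT := fun a : α => exists_FHB (ks (e a)) p hp (h (e a))
  choose T T' hT using hT
  have hB := big_FHB f (fun a => ks (e a)) hf hs T T' hT
  rw [Equiv.sum_comp e ks] at hB
  have hG : GHB (∑ i, ks i) (big f T) (big f T') :=
    ⟨hB.1, fun r _ => hB.2.1 r, fun r _ => hB.2.2.1 r, fun r _ => hB.2.2.2 r⟩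
  let v : α × Fin p → ℕ := fun x => (Fintype.equivFin (α × Fin p) x).val
  have hv : Function.Injective v := Fin.val_injective.comp (Equiv.injective _)
  have hI := hG.image v v v (fun x _ y _ h => hv h) (fun x _ y _ h => hv h)
    (fun x _ y _ h => hv h)
  refine ⟨_, _, hI, ?_⟩
  rw [Finset.card_image_of_injective]
  · rw [Finset.card_eq_sum_card_fiberwise (f := fun x => x.1) (t := Finset.univ)
      (fun _ _ => Finset.mem_coe.2 (Finset.mem_univ _)),
      Finset.sum_congr rfl (fun r _ => hB.2.1 r), Finset.sum_const, Finset.card_univ,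
      Fintype.card_prod, hα, Fintype.card_fin, smul_eq_mul]
    ring
  · rintro ⟨a, b, c⟩ ⟨a', b', c'⟩ hh
    simp only [Prod.mk.injEq] at hh
    rw [hv hh.1, hv hh.2.1, hv hh.2.2]
end

section
/- For every integer k with k > 2, there exists a k-homogeneous Latin bitrade of volume k·(k+1). -/
/-- Off-diagonal array: each row `r` omits the symbol `ρ r`, each column `c` omits `κ c`. -/
def HalfArr {α : Type} (A : α → α → α) (ρ κ : α → α) : Prop :=
  (∀ r c c', c ≠ r → c' ≠ r → A r c = A r c' → c = c') ∧
  (∀ r c, c ≠ r → A r c ≠ ρ r) ∧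
  (∀ r r' c, c ≠ r → c ≠ r' → A r c = A r' c → r = r') ∧
  (∀ r c, c ≠ r → A r c ≠ κ c)

theorem HalfArr.row {α : Type} [Fintype α] [DecidableEq α] {A : α → α → α} {ρ κ : α → α}
    (h : HalfArr A ρ κ) (r s : α) : (∃ c, c ≠ r ∧ A r c = s) ↔ s ≠ ρ r := by
  obtain ⟨h1, h2, h3, h4⟩ := h
  constructor
  · rintro ⟨c, hc, rfl⟩
    exact h2 r c hc
  · intro hs
    have hinj : Function.Injective (fun c => if c = r then ρ r else A r c) := by
      intro c c' hcc
      have := h1 r c c'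
      have := h2 r c
      have := h2 r c'
      grind
    obtain ⟨c, hc⟩ := (Finite.injective_iff_surjective.mp hinj) s
    refine ⟨c, ?_⟩
    grind

theorem HalfArr.col {α : Type} [Fintype α] [DecidableEq α] {A : α → α → α} {ρ κ : α → α}
    (h : HalfArr A ρ κ) (c s : α) : (∃ r, c ≠ r ∧ A r c = s) ↔ s ≠ κ c := by
  obtain ⟨h1, h2, h3, h4⟩ := h
  constructor
  · rintro ⟨r, hc, rfl⟩
    exact h4 r c hc
  · intro hs
    have hinj : Function.Injective (fun r => if r = c then κ c else A r c) := by
      intro r r' hcc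
      have := h3 r r' c
      have := h4 r c
      have := h4 r' c
      grind
    obtain ⟨c, hc⟩ := (Finite.injective_iff_surjective.mp hinj) s
    refine ⟨c, ?_⟩
    grind

/-- The set of triples of an off-diagonal array. -/
def arrSet {α : Type} [Fintype α] [DecidableEq α] (i : α → ℕ) (A : α → α → α) :
    Finset (ℕ × ℕ × ℕ) :=
  ((Finset.univ : Finset (α × α)).filter (fun p => p.2 ≠ p.1)).image
    (fun p => (i p.1, i p.2, i (A p.1 p.2)))

theorem mem_arrSet {α : Type} [Fintype α] [DecidableEq α] (i : α → ℕ) (A : α → α → α)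
    (x : ℕ × ℕ × ℕ) :
    x ∈ arrSet i A ↔ ∃ r c, c ≠ r ∧ x = (i r, i c, i (A r c)) := by
  simp only [arrSet, Finset.mem_image, Finset.mem_filter, Finset.mem_univ, true_and, Prod.exists]
  constructor
  · rintro ⟨r, c, h, rfl⟩
    exact ⟨r, c, h, rfl⟩
  · rintro ⟨r, c, h, rfl⟩
    exact ⟨r, c, h, rfl⟩

theorem pls_arrSet {α : Type} [Fintype α] [DecidableEq α] (i : α → ℕ) (hi : Function.Injective i)
    {A : α → α → α} {ρ κ : α → α} (h : HalfArr A ρ κ) : IsPartialLatinSquare (arrSet i A) := by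
  obtain ⟨h1, h2, h3, h4⟩ := h
  refine ⟨?_, ?_, ?_⟩
  · intro x hx y hy e1 e2
    obtain ⟨r, c, hc, rfl⟩ := (mem_arrSet i A x).1 hx
    obtain ⟨r', c', hc', rfl⟩ := (mem_arrSet i A y).1 hy
    obtain rfl := hi e1
    obtain rfl := hi e2
    rfl
  · intro x hx y hy e1 e2
    obtain ⟨r, c, hc, rfl⟩ := (mem_arrSet i A x).1 hx
    obtain ⟨r', c', hc', rfl⟩ := (mem_arrSet i A y).1 hy
    obtain rfl := hi e1
    obtain rfl := h1 _ _ _ hc hc' (hi e2)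
    rfl
  · intro x hx y hy e1 e2
    obtain ⟨r, c, hc, rfl⟩ := (mem_arrSet i A x).1 hx
    obtain ⟨r', c', hc', rfl⟩ := (mem_arrSet i A y).1 hy
    obtain rfl := hi e1
    obtain rfl := h3 _ _ _ hc hc' (hi e2)
    rfl

theorem main_arr {α : Type} [Fintype α] [DecidableEq α] (A B : α → α → α) (ρ κ : α → α)
    (hρ : Function.Injective ρ)
    (hA : HalfArr A ρ κ) (hB : HalfArr B ρ κ) (hAB : ∀ r c, c ≠ r → A r c ≠ B r c)
    (k : ℕ) (hk : Fintype.card α = k + 1) :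
    ∃ T T' : Finset (ℕ × ℕ × ℕ),
      IsHomogeneousLatinBitrade k T T' ∧ T.card = k * (k + 1) := by
  obtain ⟨i, hi⟩ : ∃ i : α → ℕ, Function.Injective i :=
    ⟨fun a => (Fintype.equivFin α a : ℕ), fun a b h => by
      exact (Fintype.equivFin α).injective (Fin.ext h)⟩
  have hcard : ∀ a : α, (Finset.univ.erase a).card = k := by
    intro a
    rw [Finset.card_erase_of_mem (Finset.mem_univ a), Finset.card_univ, hk]
    rfl
  have hmem : ∀ (C : α → α → α) r c e, (r, c, e) ∈ arrSet i C ↔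
      ∃ r' c', c' ≠ r' ∧ i r' = r ∧ i c' = c ∧ i (C r' c') = e := by
    intro C r c e
    rw [mem_arrSet]
    simp only [Prod.mk.injEq, eq_comm]
  have cells : ∀ (C D : α → α → α), ∀ r c, (∃ e, (r, c, e) ∈ arrSet i C) →
      (∃ e, (r, c, e) ∈ arrSet i D) := by
    rintro C D r c ⟨e, he⟩
    obtain ⟨r', c', h, rfl, rfl, -⟩ := (hmem _ _ _ _).1 he
    exact ⟨_, (hmem _ _ _ _).2 ⟨r', c', h, rfl, rfl, rfl⟩⟩
  have rows : ∀ (C D : α → α → α), HalfArr C ρ κ → HalfArr D ρ κ →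
      ∀ r e, (∃ c, (r, c, e) ∈ arrSet i C) → (∃ c, (r, c, e) ∈ arrSet i D) := by
    rintro C D hC hD r e ⟨c, he⟩
    obtain ⟨r', c', h, rfl, rfl, rfl⟩ := (hmem _ _ _ _).1 he
    obtain ⟨c2, h2, h3⟩ := (hD.row r' (C r' c')).2 ((hC.row _ _).1 ⟨c', h, rfl⟩)
    exact ⟨i c2, (hmem _ _ _ _).2 ⟨r', c2, h2, rfl, rfl, by rw [h3]⟩⟩
  have cols : ∀ (C D : α → α → α), HalfArr C ρ κ → HalfArr D ρ κ →
      ∀ c e, (∃ r, (r, c, e) ∈ arrSet i C) → (∃ r, (r, c, e) ∈ arrSet i D) := by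
    rintro C D hC hD c e ⟨r, he⟩
    obtain ⟨r', c', h, rfl, rfl, rfl⟩ := (hmem _ _ _ _).1 he
    obtain ⟨r2, h2, h3⟩ := (hD.col c' (C r' c')).2 ((hC.col _ _).1 ⟨r', h, rfl⟩)
    exact ⟨i r2, (hmem _ _ _ _).2 ⟨r2, c', h2, rfl, rfl, by rw [h3]⟩⟩
  refine ⟨arrSet i A, arrSet i B, ⟨⟨pls_arrSet i hi hA, pls_arrSet i hi hB, ?_,
    fun r c => ⟨cells A B r c, cells B A r c⟩,
    fun r c => ⟨rows A B hA hB r c, rows B A hB hA r c⟩,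
    fun r c => ⟨cols A B hA hB r c, cols B A hB hA r c⟩⟩, ?_, ?_, ?_⟩, ?_⟩
  · rw [Finset.disjoint_left]
    intro x hx hy
    obtain ⟨r, c, hc, rfl⟩ := (mem_arrSet i A x).1 hx
    obtain ⟨r', c', hc', h⟩ := (mem_arrSet i B _).1 hy
    simp only [Prod.mk.injEq] at h
    obtain ⟨e1, e2, e3⟩ := h
    obtain rfl := hi e1
    obtain rfl := hi e2
    exact hAB _ _ hc (hi e3)
  · rintro _ ⟨x, hx, rfl⟩
    obtain ⟨r, c, hc, rfl⟩ := (mem_arrSet i A x).1 hx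
    rw [← hcard r]
    have : (arrSet i A).filter (fun x => x.1 = i r) =
        (Finset.univ.erase r).image (fun c => (i r, i c, i (A r c))) := by
      ext y
      simp only [Finset.mem_filter, mem_arrSet, Finset.mem_image, Finset.mem_erase,
        Finset.mem_univ, and_true]
      constructor
      · rintro ⟨⟨r', c', h, rfl⟩, h2⟩
        obtain rfl := hi h2
        exact ⟨c', h, rfl⟩
      · rintro ⟨c', h, rfl⟩
        exact ⟨⟨r, c', h, rfl⟩, rfl⟩
    rw [this, Finset.card_image_of_injective]
    intro a b hab
    simp only [Prod.mk.injEq] at hab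
    exact hi hab.2.1
  · rintro _ ⟨x, hx, rfl⟩
    obtain ⟨r, c, hc, rfl⟩ := (mem_arrSet i A x).1 hx
    rw [← hcard c]
    have : (arrSet i A).filter (fun x => x.2.1 = i c) =
        (Finset.univ.erase c).image (fun r => (i r, i c, i (A r c))) := by
      ext y
      simp only [Finset.mem_filter, mem_arrSet, Finset.mem_image, Finset.mem_erase,
        Finset.mem_univ, and_true]
      constructor
      · rintro ⟨⟨r', c', h, rfl⟩, h2⟩
        obtain rfl := hi h2
        exact ⟨r', h.symm, rfl⟩
      · rintro ⟨r', h, rfl⟩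
        exact ⟨⟨r', c, h.symm, rfl⟩, rfl⟩
    rw [this, Finset.card_image_of_injective]
    intro a b hab
    simp only [Prod.mk.injEq] at hab
    exact hi hab.1
  · rintro _ ⟨x, hx, rfl⟩
    obtain ⟨r, c, hc, rfl⟩ := (mem_arrSet i A x).1 hx
    simp only
    generalize A r c = s
    obtain ⟨r0, rfl⟩ := (Finite.injective_iff_surjective.mp hρ) s
    rw [← hcard r0]
    have hex : ∀ r, ∃ c, r ≠ r0 → c ≠ r ∧ A r c = ρ r0 := by
      intro r
      by_cases hr : r = r0
      · exact ⟨r, fun h => absurd hr h⟩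
      · obtain ⟨c, hc⟩ := (hA.row r (ρ r0)).2 (fun h => hr (hρ h).symm)
        exact ⟨c, fun _ => hc⟩
    choose cc hcc using hex
    have : (arrSet i A).filter (fun x => x.2.2 = i (ρ r0)) =
        (Finset.univ.erase r0).image (fun r => (i r, i (cc r), i (ρ r0))) := by
      ext y
      simp only [Finset.mem_filter, mem_arrSet, Finset.mem_image, Finset.mem_erase,
        Finset.mem_univ, and_true]
      constructor
      · rintro ⟨⟨r', c', h, rfl⟩, h2⟩
        have h3 := hi h2
        have hne : r' ≠ r0 := by
          rintro rfl
          exact hA.2.1 _ _ h h3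
        refine ⟨r', hne, ?_⟩
        have := hA.1 r' c' (cc r') h (hcc r' hne).1 (h3.trans (hcc r' hne).2.symm)
        rw [← this, h3]
      · rintro ⟨r', h, rfl⟩
        exact ⟨⟨r', cc r', (hcc r' h).1, by rw [(hcc r' h).2]⟩, rfl⟩
    rw [this, Finset.card_image_of_injective]
    intro a b hab
    simp only [Prod.mk.injEq] at hab
    exact hi hab.1
  · rw [arrSet, Finset.card_image_of_injective]
    · have : (Finset.univ.filter (fun p : α × α => p.2 ≠ p.1)) =
          (Finset.univ : Finset α).offDiag := by
        ext ⟨a, b⟩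
        simp [eq_comm]
      rw [this, Finset.offDiag_card, Finset.card_univ, hk]
      have : (k + 1) * (k + 1) = k * (k + 1) + (k + 1) := by ring
      omega
    · rintro ⟨a, b⟩ ⟨a', b'⟩ hab
      simp only [Prod.mk.injEq] at hab
      rw [hi hab.1, hi hab.2.1]

/-- A near-orthomorphism of a group `G`, in terms of `p d = f d - d`. -/
def NearOrth {G : Type} [AddCommGroup G] (b : G) (p : G → G) : Prop :=
  (∀ d d', d ≠ 0 → d' ≠ 0 → p d = p d' → d = d') ∧
  (∀ d, d ≠ 0 → p d ≠ b) ∧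
  (∀ d d', d ≠ 0 → d' ≠ 0 → d + p d = d' + p d' → d = d') ∧
  (∀ d, d ≠ 0 → d + p d ≠ 0)

theorem NearOrth.half {G : Type} [AddCommGroup G] {b : G} {p : G → G} (h : NearOrth b p) :
    HalfArr (fun r c => c + p (c - r)) (fun r => r) (fun c => c + b) := by
  obtain ⟨h1, h2, h3, h4⟩ := h
  refine ⟨?_, ?_, ?_, ?_⟩
  · intro r c c' hc hc' e
    have := h3 (c - r) (c' - r) (sub_ne_zero.2 hc) (sub_ne_zero.2 hc') (by
      have : c + p (c - r) - r = c' + p (c' - r) - r := by simp only at e; rw [e]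
      rw [sub_add_eq_add_sub, sub_add_eq_add_sub, this])
    exact sub_left_injective this
  · intro r c hc e
    refine h4 (c - r) (sub_ne_zero.2 hc) ?_
    simp only at e
    rw [sub_add_eq_add_sub, e, sub_self]
  · intro r r' c hc hc' e
    have := h1 (c - r) (c - r') (sub_ne_zero.2 hc) (sub_ne_zero.2 hc') (add_left_cancel e)
    exact sub_right_injective this
  · intro r c hc e
    exact h2 (c - r) (sub_ne_zero.2 hc) (add_left_cancel e)

/-- Prolongation of the array along the diagonal `d0`. -/
def prolong {G : Type} [AddCommGroup G] [DecidableEq G] (p : G → G) (d0 : G) :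
    Option G → Option G → Option G
  | some r, some c => if c - r = d0 then none else some (c + p (c - r))
  | some r, none => some (r + (d0 + p d0))
  | none, some c => some (c + p d0)
  | none, none => none

theorem NearOrth.prolong {G : Type} [AddCommGroup G] [DecidableEq G] {b : G} {p : G → G}
    (h : NearOrth b p) (d0 : G) (hd : d0 ≠ 0) :
    HalfArr (prolong p d0) (fun r => r) (Option.map (fun c => c + b)) := by
  have hh := h.half
  obtain ⟨g1, g2, g3, g4⟩ := hh
  obtain ⟨h1, h2, h3, h4⟩ := h
  have key : ∀ r c : G, c - r ≠ d0 → c ≠ r → c + p (c - r) ≠ r + (d0 + p d0) := by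
    intro r c hne hc e
    refine hne (h3 (c - r) d0 (sub_ne_zero.2 hc) hd ?_)
    rw [sub_add_eq_add_sub, e, add_sub_cancel_left]
  have key2 : ∀ r c : G, c - r ≠ d0 → c ≠ r → c + p (c - r) ≠ c + p d0 := by
    intro r c hne hc e
    exact hne (h1 (c - r) d0 (sub_ne_zero.2 hc) hd (add_left_cancel e))
  refine ⟨?_, ?_, ?_, ?_⟩
  · rintro (_ | r) (_ | c) (_ | c') hc hc' e <;> simp only [_root_.prolong] at e
    · rfl
    · exact absurd rfl hc
    · exact absurd rfl hc'
    · rw [add_right_cancel (Option.some.inj e)]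
    · rfl
    · have := key r c'
      grind
    · have := key r c
      grind
    · have := g1 r c c'
      have h5 : c - r = c' - r → c = c' := fun h => sub_left_injective h
      grind
  · rintro (_ | r) (_ | c) hc e <;> simp only [_root_.prolong] at e
    · exact hc rfl
    · cases e
    · have := h4 d0 hd
      have h5 := Option.some.inj e
      exact this (by simpa using h5)
    · have := g2 r c
      grind
  · rintro (_ | r) (_ | r') (_ | c) hc hc' e <;> simp only [_root_.prolong] at e
    · rfl
    · rfl
    · exact absurd rfl hc
    · have := key2 r' c
      grind
    · exact absurd rfl hc'
    · have := key2 r c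
      grind
    · rw [add_right_cancel (Option.some.inj e)]
    · have := g3 r r' c
      have h5 : c - r = c - r' → r = r' := fun h => sub_right_injective h
      grind
  · rintro (_ | r) (_ | c) hc e <;> simp only [_root_.prolong, Option.map] at e
    · exact hc rfl
    · exact h2 d0 hd (add_left_cancel (Option.some.inj e))
    · cases e
    · have := g4 r c
      grind

theorem cast_cases {N a b : ℕ} (h : (a : ZMod N) = b) (ha : a < 2 * N) (hb : b < 2 * N) :
    a = b ∨ a = b + N ∨ b = a + N := by
  rw [ZMod.natCast_eq_natCast_iff'] at h
  have h1 := Nat.div_add_mod a N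
  have h2 := Nat.div_add_mod b N
  have h3 : a / N < 2 := Nat.div_lt_of_lt_mul (by omega)
  have h4 : b / N < 2 := Nat.div_lt_of_lt_mul (by omega)
  rw [h] at h1
  generalize a / N = x at *
  generalize b / N = y at *
  interval_cases x <;> interval_cases y <;> omega

def pN (m x : ℕ) : ℕ := if x < m then x else x + 1
def qN (m x : ℕ) : ℕ := if x ≤ m then x - 1 else x

theorem near_of_nat {N m : ℕ} [NeZero N] (hm : m < N) (u : ℕ → ℕ)
    (hu : ∀ x, 0 < x → x < N → u x ≤ N ∧ u x ≠ m)
    (h1 : ∀ x y, 0 < x → x < N → 0 < y → y < N → 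
      u x = u y ∨ u x = u y + N ∨ u y = u x + N → x = y)
    (h2 : ∀ x y, 0 < x → x < N → 0 < y → y < N → 
      x + u x = y + u y ∨ x + u x = y + u y + N ∨ y + u y = x + u x + N → x = y)
    (h3 : ∀ x, 0 < x → x < N → x + u x ≠ N)
    (hu' : ∀ x, 0 < x → x < N → u x + N ≠ m ∧ u x ≠ m + N) :
    NearOrth (m : ZMod N) (fun d => (u d.val : ZMod N)) := by
  have pos : ∀ d : ZMod N, d ≠ 0 → 0 < d.val := fun d hd =>
    Nat.pos_of_ne_zero (fun h => hd ((ZMod.val_eq_zero d).1 h))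
  have lt : ∀ d : ZMod N, d.val < N := ZMod.val_lt
  have add : ∀ d : ZMod N, d + (u d.val : ZMod N) = ((d.val + u d.val : ℕ) : ZMod N) := by
    intro d
    rw [Nat.cast_add, ZMod.natCast_zmod_val]
  refine ⟨?_, ?_, ?_, ?_⟩
  · intro d d' hd hd' e
    apply ZMod.val_injective
    have a1 := hu _ (pos d hd) (lt d)
    have a2 := hu _ (pos d' hd') (lt d')
    exact h1 _ _ (pos d hd) (lt d) (pos d' hd') (lt d') (cast_cases e (by omega) (by omega))
  · intro d hd e
    have a1 := hu _ (pos d hd) (lt d)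
    have a2 := hu' _ (pos d hd) (lt d)
    have := cast_cases e (by omega) (by omega)
    omega
  · intro d d' hd hd' e
    apply ZMod.val_injective
    have a1 := hu _ (pos d hd) (lt d)
    have a2 := hu _ (pos d' hd') (lt d')
    have b1 := lt d
    have b2 := lt d'
    simp only [add] at e
    exact h2 _ _ (pos d hd) (lt d) (pos d' hd') (lt d') (cast_cases e (by omega) (by omega))
  · intro d hd e
    have a1 := hu _ (pos d hd) (lt d)
    have a2 := h3 _ (pos d hd) (lt d)
    have b1 := lt d
    have b2 := pos d hd
    simp only [add] at e
    rw [← Nat.cast_zero] at e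
    have := cast_cases e (by omega) (by omega)
    omega

theorem near_p (m : ℕ) [NeZero (2 * m)] :
    NearOrth (m : ZMod (2 * m)) (fun d => (pN m d.val : ZMod (2 * m))) := by
  have : 2 * m ≠ 0 := NeZero.ne _
  apply near_of_nat (by omega)
  · intro x; unfold pN; split_ifs <;> omega
  · intro x y; unfold pN; split_ifs <;> omega
  · intro x y; unfold pN; split_ifs <;> omega
  · intro x; unfold pN; split_ifs <;> omega
  · intro x; unfold pN; split_ifs <;> omega

theorem near_q (m : ℕ) [NeZero (2 * m)] :
    NearOrth (m : ZMod (2 * m)) (fun d => (qN m d.val : ZMod (2 * m))) := by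
  have : 2 * m ≠ 0 := NeZero.ne _
  apply near_of_nat (by omega)
  · intro x; unfold qN; split_ifs <;> omega
  · intro x y; unfold qN; split_ifs <;> omega
  · intro x y; unfold qN; split_ifs <;> omega
  · intro x; unfold qN; split_ifs <;> omega
  · intro x; unfold qN; split_ifs <;> omega

theorem p_ne_q (m : ℕ) (hm : 2 ≤ m) [NeZero (2 * m)] (d : ZMod (2 * m)) (hd : d ≠ 0) :
    (pN m d.val : ZMod (2 * m)) ≠ (qN m d.val : ZMod (2 * m)) := by
  intro e
  have pos : 0 < d.val := Nat.pos_of_ne_zero (fun h => hd ((ZMod.val_eq_zero d).1 h))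
  have lt := ZMod.val_lt d
  have b1 : pN m d.val ≤ 2 * m := by unfold pN; split_ifs <;> omega
  have b2 : qN m d.val ≤ 2 * m := by unfold qN; split_ifs <;> omega
  have := cast_cases e (by omega) (by omega)
  revert this
  unfold pN qN
  split_ifs <;> omega

theorem stmt_14 (k : ℕ) (hk : 2 < k) :
    ∃ T T' : Finset (ℕ × ℕ × ℕ),
      IsHomogeneousLatinBitrade k T T' ∧ T.card = k * (k + 1) := by
  rcases Nat.even_or_odd' k with ⟨m, rfl | rfl⟩
  · by_cases hm2 : m = 2
    · subst hm2
      refine main_arr (α := ZMod 5) (fun r c => c + (c - r)) (fun r c => c + 3 * (c - r))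
        (fun r => r) (fun c => c + 0) (fun _ _ h => h) (NearOrth.half (p := fun d => d) ?_)
        (NearOrth.half (p := fun d => 3 * d) ?_) ?_ _ (by simp [ZMod.card])
      · unfold NearOrth; decide
      · unfold NearOrth; decide
      · decide
    · have : NeZero (2 * m) := ⟨by omega⟩
      have v1 : (1 : ZMod (2 * m)).val = 1 := by
        have := ZMod.val_natCast_of_lt (n := 2 * m) (a := 1) (by omega)
        simpa using this
      have v3 : (3 : ZMod (2 * m)).val = 3 := by
        have := ZMod.val_natCast_of_lt (n := 2 * m) (a := 3) (by omega)
        simpa using this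
      have n1 : (1 : ZMod (2 * m)) ≠ 0 := by
        intro h; rw [h] at v1; simp at v1
      have n3 : (3 : ZMod (2 * m)) ≠ 0 := by
        intro h; rw [h] at v3; simp at v3
      have n13 : (1 : ZMod (2 * m)) ≠ 3 := by
        intro h; rw [h] at v1; omega
      have p1 : pN m 1 = 1 := by unfold pN; split_ifs <;> omega
      have q3 : qN m 3 = 2 := by unfold qN; split_ifs <;> omega
      refine main_arr (α := Option (ZMod (2 * m)))
        (prolong (fun d => (pN m d.val : ZMod (2 * m))) 1)
        (prolong (fun d => (qN m d.val : ZMod (2 * m))) 3)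
        (fun r => r) _ (fun _ _ h => h) ((near_p m).prolong 1 n1)
        ((near_q m).prolong 3 n3) ?_ _ (by simp [ZMod.card])
      rintro (_ | r) (_ | c) hc e <;> simp only [prolong, v1, v3, p1, q3] at e
      · exact hc rfl
      · have := cast_cases (add_left_cancel (Option.some.inj e)) (by omega) (by omega)
        omega
      · have e2 := add_left_cancel (Option.some.inj e)
        have e3 : ((2 : ℕ) : ZMod (2 * m)) = ((5 : ℕ) : ZMod (2 * m)) := by
          push_cast at e2 ⊢
          convert e2 using 1 <;> norm_num
        have := cast_cases e3 (by omega) (by omega)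
        omega
      · have := p_ne_q m (by omega) (c - r) (sub_ne_zero.2 (fun h => hc (by rw [h])))
        have h5 := fun h => this (add_left_cancel (a := c) h)
        grind
  · have : NeZero (2 * (m + 1)) := ⟨by omega⟩
    refine main_arr (α := ZMod (2 * (m + 1))) _ _ _ _ (fun _ _ h => h) (near_p (m + 1)).half
      (near_q (m + 1)).half ?_ _ (by rw [ZMod.card]; ring)
    intro r c hc e
    exact p_ne_q (m + 1) (by omega) (c - r) (sub_ne_zero.2 hc) (add_left_cancel e)
end

section
/- For every integer m with m ≥ 1, there exists a 2-homogeneous Latin bitrade of volume 2·m if and only if m is even. -/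
lemma two_fiber {T : Finset (ℕ × ℕ × ℕ)} {f : ℕ × ℕ × ℕ → ℕ}
    (h : ∀ r, (∃ x ∈ T, f x = r) → (T.filter (fun x => f x = r)).card = 2)
    {x y z : ℕ × ℕ × ℕ} (hx : x ∈ T) (hy : y ∈ T) (hz : z ∈ T)
    (hxy : f y = f x) (hxz : f z = f x) (hne : y ≠ x) : z = x ∨ z = y := by
  obtain ⟨a, b, hab, hs⟩ := Finset.card_eq_two.1 (h (f x) ⟨x, hx, rfl⟩)
  have key : ∀ w ∈ T, f w = f x → w = a ∨ w = b := by
    intro w hw hwx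
    have : w ∈ T.filter (fun u => f u = f x) := Finset.mem_filter.2 ⟨hw, hwx⟩
    rw [hs] at this
    simpa using this
  have h1 := key x hx rfl
  have h2 := key y hy hxy
  have h3 := key z hz hxz
  grind

lemma key_block {T T' : Finset (ℕ × ℕ × ℕ)} (H : IsHomogeneousLatinBitrade 2 T T')
    {r c e : ℕ} (hx : (r, c, e) ∈ T) :
    ∃ r' c' e', r' ≠ r ∧ c' ≠ c ∧ e' ≠ e ∧
      (r, c', e') ∈ T ∧ (r', c, e') ∈ T ∧ (r', c', e) ∈ T := by
  obtain ⟨⟨⟨p1, p2, p3⟩, ⟨q1, q2, q3⟩, hd, hrc, hre, hce⟩, hr, hc, he⟩ := H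
  obtain ⟨g, hg⟩ := (hrc r c).1 ⟨e, hx⟩
  have hge : g ≠ e := by
    rintro rfl
    exact Finset.disjoint_left.1 hd hx hg
  obtain ⟨c2, hc2⟩ := (hre r g).2 ⟨c, hg⟩
  obtain ⟨r', hr'⟩ := (hce c g).2 ⟨r, hg⟩
  have hcc : c2 ≠ c := by
    rintro rfl
    have := p1 _ hx _ hc2 rfl rfl
    simp at this; exact hge this.symm
  have hrr : r' ≠ r := by
    rintro rfl
    have := p1 _ hx _ hr' rfl rfl
    simp at this; exact hge this.symm
  obtain ⟨s, hs⟩ := (hce c e).1 ⟨r, hx⟩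
  obtain ⟨u, hu⟩ := (hrc s c).2 ⟨e, hs⟩
  have hsr : s ≠ r := by
    rintro rfl
    have := q1 _ hg _ hs rfl rfl
    simp at this; exact hge this
  have hsr' : s = r' := by
    rcases two_fiber hc hx hr' hu rfl rfl (by simp [hrr]) with h | h <;> simp at h
    · exact absurd h.1 hsr
    · exact h.1
  subst hsr'
  obtain ⟨d, hd1⟩ := (hre s e).2 ⟨c, hs⟩
  obtain ⟨t, ht⟩ := (hre r e).1 ⟨c, hx⟩
  obtain ⟨v, hv⟩ := (hrc r t).2 ⟨e, ht⟩
  have htc : t ≠ c := by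
    rintro rfl
    have := q1 _ hg _ ht rfl rfl
    simp at this; exact hge this
  have htc2 : t = c2 := by
    rcases two_fiber hr hx hc2 hv rfl rfl (by simp [hcc]) with h | h <;> simp at h
    · exact absurd h.1 htc
    · exact h.1
  subst htc2
  obtain ⟨w, hw⟩ := (hce t e).2 ⟨r, ht⟩
  have : d = t := by
    rcases two_fiber he hx hd1 hw rfl rfl (by simp [hrr]) with h | h <;> simp at h
    · exact absurd h.2 htc
    · exact h.2.symm
  subst this
  exact ⟨s, d, g, hrr, hcc, hge, hc2, hr', hd1⟩

def RowRel (T : Finset (ℕ × ℕ × ℕ)) (r s : ℕ) : Prop :=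
  s ≠ r ∧ ∃ c e f, (r, c, e) ∈ T ∧ (s, c, f) ∈ T

lemma rowRel_unique {T T' : Finset (ℕ × ℕ × ℕ)} (H : IsHomogeneousLatinBitrade 2 T T')
    {r a b : ℕ} (ha : RowRel T r a) (hb : RowRel T r b) : a = b := by
  obtain ⟨har, c, e, f, h1, h2⟩ := ha
  obtain ⟨hbr, c', e', f', h3, h4⟩ := hb
  obtain ⟨s, d, g, hs, hd, hg, k1, k2, k3⟩ := key_block H h1
  obtain ⟨-, hr, hc, he⟩ := H
  have hA : a = s := by
    rcases two_fiber hc h1 k2 h2 rfl rfl (by simp [hs]) with h | h <;> simp at h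
    · exact absurd h.1 har
    · exact h.1
  have hB : b = s := by
    rcases two_fiber hr h1 k1 h3 rfl rfl (by simp [hd]) with h | h <;> simp at h
    · obtain ⟨rfl, rfl⟩ := h
      rcases two_fiber hc h1 k2 h4 rfl rfl (by simp [hs]) with h | h <;> simp at h
      · exact absurd h.1 hbr
      · exact h.1
    · obtain ⟨rfl, rfl⟩ := h
      rcases two_fiber hc k1 k3 h4 rfl rfl (by simp [hs]) with h | h <;> simp at h
      · exact absurd h.1 hbr
      · exact h.1
  rw [hA, hB]

lemma rows_even {T T' : Finset (ℕ × ℕ × ℕ)} (H : IsHomogeneousLatinBitrade 2 T T') :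
    Even (T.image (fun x => x.1)).card := by
  have ex : ∀ r ∈ T.image (fun x => x.1), ∃ s ∈ T.image (fun x => x.1), RowRel T r s := by
    intro r hr
    obtain ⟨⟨r, c, e⟩, hx, rfl⟩ := Finset.mem_image.1 hr
    obtain ⟨s, d, g, hs, hd, hg, k1, k2, k3⟩ := key_block H hx
    exact ⟨s, Finset.mem_image.2 ⟨_, k2, rfl⟩, hs, c, e, g, hx, k2⟩
  choose g hg hrel using ex
  have : ∑ r ∈ T.image (fun x => x.1), (1 : ZMod 2) = 0 := by
    refine Finset.sum_involution g ?_ ?_ hg ?_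
    · intros; decide
    · intro a ha _
      exact (hrel a ha).1
    · intro a ha
      refine rowRel_unique H (hrel (g a ha) (hg a ha)) ?_
      obtain ⟨h1, c, e, f, h2, h3⟩ := hrel a ha
      exact ⟨h1.symm, c, f, e, h3, h2⟩
  rw [Finset.sum_const, nsmul_eq_mul, mul_one, ZMod.natCast_eq_zero_iff] at this
  exact even_iff_two_dvd.2 this

/-- The disjoint union of `m / 2` intercalates, for `m` even; `p` is the parity. -/
def blk (m p : ℕ) : Finset (ℕ × ℕ × ℕ) :=
  (Finset.range m ×ˢ Finset.range m ×ˢ Finset.range m).filter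
    (fun x => x.1 / 2 = x.2.1 / 2 ∧ x.1 / 2 = x.2.2 / 2 ∧ (x.1 + x.2.1 + x.2.2) % 2 = p)

lemma mem_blk (m p r c e : ℕ) : (r, c, e) ∈ blk m p ↔
    (r < m ∧ c < m ∧ e < m) ∧ r / 2 = c / 2 ∧ r / 2 = e / 2 ∧ (r + c + e) % 2 = p := by
  simp [blk]

lemma pls_blk (m p : ℕ) : IsPartialLatinSquare (blk m p) := by
  refine ⟨?_, ?_, ?_⟩ <;> rintro ⟨r, c, e⟩ h ⟨r', c', e'⟩ h' h1 h2 <;>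
    rw [mem_blk] at h h' <;> simp only [Prod.mk.injEq] at * <;> omega

lemma blk_hom (k : ℕ) : IsHomogeneousLatinBitrade 2 (blk (2 * k) 0) (blk (2 * k) 1) := by
  refine ⟨⟨pls_blk _ _, pls_blk _ _, ?_, ?_, ?_, ?_⟩, ?_, ?_, ?_⟩
  · rw [Finset.disjoint_left]
    rintro ⟨r, c, e⟩ h h'
    rw [mem_blk] at h h'
    omega
  · intro r c
    simp only [mem_blk]
    constructor <;> rintro ⟨e, h⟩
    · exact ⟨2 * (e / 2) + (1 - e % 2), by omega⟩
    · exact ⟨2 * (e / 2) + (1 - e % 2), by omega⟩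
  · intro r c
    simp only [mem_blk]
    constructor <;> rintro ⟨e, h⟩
    · exact ⟨2 * (e / 2) + (1 - e % 2), by omega⟩
    · exact ⟨2 * (e / 2) + (1 - e % 2), by omega⟩
  · intro r c
    simp only [mem_blk]
    constructor <;> rintro ⟨e, h⟩
    · exact ⟨2 * (e / 2) + (1 - e % 2), by omega⟩
    · exact ⟨2 * (e / 2) + (1 - e % 2), by omega⟩
  · rintro r ⟨⟨r', c, e⟩, h, rfl⟩
    rw [mem_blk] at h
    rw [Finset.card_eq_two]
    refine ⟨(r', c, e), (r', 2 * (c / 2) + (1 - c % 2), 2 * (e / 2) + (1 - e % 2)), ?_, ?_⟩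
    · simp only [ne_eq, Prod.mk.injEq]; omega
    · ext ⟨a, b, d⟩
      simp only [Finset.mem_filter, mem_blk, Finset.mem_insert, Finset.mem_singleton,
        Prod.mk.injEq]
      omega
  · rintro r ⟨⟨r', c, e⟩, h, rfl⟩
    rw [mem_blk] at h
    rw [Finset.card_eq_two]
    refine ⟨(r', c, e), (2 * (r' / 2) + (1 - r' % 2), c, 2 * (e / 2) + (1 - e % 2)), ?_, ?_⟩
    · simp only [ne_eq, Prod.mk.injEq]; omega
    · ext ⟨a, b, d⟩
      simp only [Finset.mem_filter, mem_blk, Finset.mem_insert, Finset.mem_singleton,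
        Prod.mk.injEq]
      omega
  · rintro r ⟨⟨r', c, e⟩, h, rfl⟩
    rw [mem_blk] at h
    rw [Finset.card_eq_two]
    refine ⟨(r', c, e), (2 * (r' / 2) + (1 - r' % 2), 2 * (c / 2) + (1 - c % 2), e), ?_, ?_⟩
    · simp only [ne_eq, Prod.mk.injEq]; omega
    · ext ⟨a, b, d⟩
      simp only [Finset.mem_filter, mem_blk, Finset.mem_insert, Finset.mem_singleton,
        Prod.mk.injEq]
      omega

lemma card_rows {T T' : Finset (ℕ × ℕ × ℕ)} (H : IsHomogeneousLatinBitrade 2 T T') :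
    T.card = 2 * (T.image (fun x => x.1)).card := by
  rw [Finset.card_eq_sum_card_image (fun x => x.1) T, Finset.sum_const_nat (m := 2), mul_comm]
  intro r hr
  exact H.2.1 r (Finset.mem_image.1 hr)

theorem stmt_15 (m : ℕ) (hm : 1 ≤ m) :
    (∃ T T' : Finset (ℕ × ℕ × ℕ),
      IsHomogeneousLatinBitrade 2 T T' ∧ T.card = 2 * m) ↔ Even m := by
  constructor
  · rintro ⟨T, T', H, hT⟩
    have h1 := rows_even H
    have h2 := card_rows H
    have : m = (T.image (fun x => x.1)).card := by omega
    rw [this]; exact h1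
  · intro h
    obtain ⟨k, rfl⟩ := even_iff_two_dvd.1 h
    refine ⟨blk (2 * k) 0, blk (2 * k) 1, blk_hom k, ?_⟩
    rw [card_rows (blk_hom k)]
    have : (blk (2 * k) 0).image (fun x => x.1) = Finset.range (2 * k) := by
      ext r
      simp only [Finset.mem_image, Finset.mem_range]
      constructor
      · rintro ⟨⟨a, b, c⟩, h, rfl⟩
        rw [mem_blk] at h
        exact h.1.1
      · intro hr
        refine ⟨(r, r, 2 * (r / 2)), ?_, rfl⟩
        rw [mem_blk]
        omega
    rw [this, Finset.card_range]
end

section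
/- Let ℓ be a positive integer, let m = 5·ℓ, and let k be an integer with 3 ≤ k ≤ m. Then there exists a k-homogeneous Latin bitrade of volume k·m. -/
/-- One-sided bitrade conditions on a pair of ternary relations. -/
def SideCond {α : Type} (T T' : α → α → α → Prop) (k : ℕ) : Prop :=
  (∀ x y z z', T x y z → T x y z' → z = z') ∧
  (∀ x y z z', T' x y z → T' x y z' → z = z') ∧
  (∀ x y, (∃ z, T x y z) ↔ (∃ z, T' x y z)) ∧
  (∀ x, Nat.card {p : α × α // T x p.1 p.2} = k)

def rotRel {α : Type} (T : α → α → α → Prop) : α → α → α → Prop := fun y z x => T x y z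

/-- Full relational bitrade in which every row, column and symbol is used `k` times. -/
def TradeRel {α : Type} (T T' : α → α → α → Prop) (k : ℕ) : Prop :=
  SideCond T T' k ∧ SideCond (rotRel T) (rotRel T') k ∧
  SideCond (rotRel (rotRel T)) (rotRel (rotRel T')) k ∧ ∀ x y z, T x y z → ¬ T' x y z

def HasHom (α : Type) (k : ℕ) : Prop := ∃ T T' : α → α → α → Prop, TradeRel T T' k

/-! ### Cyclic construction -/

def cycRel {G J : Type} [AddCommGroup G] (a b c : J → G) : G → G → G → Prop :=
  fun x y z => ∃ j, y - z = a j ∧ z - x = b j ∧ x - y = c j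

lemma cyc_side {G J : Type} [AddCommGroup G] (a b c a' b' c' : J → G)
    (h0 : ∀ j, a j + b j + c j = 0) (h0' : ∀ j, a' j + b' j + c' j = 0)
    (hc : Function.Injective c) (hc' : Function.Injective c')
    (hr : ∀ j, ∃ i, c' i = c j) (hr' : ∀ j, ∃ i, c i = c' j) :
    SideCond (cycRel a b c) (cycRel a' b' c') (Nat.card J) := by
  refine ⟨?_, ?_, ?_, ?_⟩
  · rintro x y z z' ⟨j, h1, h2, h3⟩ ⟨i, h4, h5, h6⟩
    have : j = i := hc (h3.symm.trans h6)
    subst this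
    have := h2.trans h5.symm
    exact sub_left_inj.mp this
  · rintro x y z z' ⟨j, h1, h2, h3⟩ ⟨i, h4, h5, h6⟩
    have : j = i := hc' (h3.symm.trans h6)
    subst this
    have := h2.trans h5.symm
    exact sub_left_inj.mp this
  · intro x y
    constructor
    · rintro ⟨z, j, h1, h2, h3⟩
      obtain ⟨i, hi⟩ := hr j
      refine ⟨x + b' i, i, ?_, by abel, by rw [h3, hi]⟩
      have e1 := h0' i
      rw [hi, ← h3] at e1
      have : a' i = -(b' i + (x - y)) := by
        rw [eq_neg_iff_add_eq_zero, ← add_assoc]; exact e1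
      rw [this]; abel
    · rintro ⟨z, j, h1, h2, h3⟩
      obtain ⟨i, hi⟩ := hr' j
      refine ⟨x + b i, i, ?_, by abel, by rw [h3, hi]⟩
      have e1 := h0 i
      rw [hi, ← h3] at e1
      have : a i = -(b i + (x - y)) := by
        rw [eq_neg_iff_add_eq_zero, ← add_assoc]; exact e1
      rw [this]; abel
  · intro x
    symm
    have hmem : ∀ j, cycRel a b c x (x - c j, x + b j).1 (x - c j, x + b j).2 := by
      intro j
      refine ⟨j, ?_, ?_, ?_⟩
      · have e1 := h0 j
        have : a j = -(b j + c j) := by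
          rw [eq_neg_iff_add_eq_zero, ← add_assoc]; exact e1
        simp only [this]; abel
      · simp
      · simp
    refine Nat.card_congr (Equiv.ofBijective
      (fun j => ⟨(x - c j, x + b j), hmem j⟩) ⟨?_, ?_⟩)
    · intro i j h
      have h' := congrArg (fun q => q.1.1) h
      exact hc (sub_right_inj.mp h')
    · rintro ⟨⟨y, z⟩, j, h1, h2, h3⟩
      refine ⟨j, Subtype.ext (Prod.ext ?_ ?_)⟩
      · change x - c j = y
        have h3' : x - y = c j := h3
        rw [← h3']; abel
      · change x + b j = z
        have h2' : z - x = b j := h2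
        rw [← h2']; abel

lemma cyc_rot {G J : Type} [AddCommGroup G] (a b c : J → G) :
    rotRel (cycRel a b c) = cycRel b c a := by
  funext x y z
  simp only [rotRel, cycRel]
  apply propext
  constructor <;> rintro ⟨j, h1, h2, h3⟩ <;> exact ⟨j, by assumption, by assumption, by assumption⟩

lemma cast_inj_small (m : ℕ) (u v : ℤ) (h1 : u - v < m) (h2 : v - u < m)
    (h : (u : ZMod m) = (v : ZMod m)) : u = v := by
  rw [ZMod.intCast_eq_intCast_iff_dvd_sub] at h
  have := Int.eq_zero_of_abs_lt_dvd h (by rw [abs_lt]; constructor <;> linarith)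
  linarith

lemma cyc_int (m : ℕ) {J : Type} (a b c a' b' c' : J → ℤ)
    (h0 : ∀ j, a j + b j + c j = 0) (h0' : ∀ j, a' j + b' j + c' j = 0)
    (ha : Function.Injective a) (hb : Function.Injective b) (hc : Function.Injective c)
    (ha' : Function.Injective a') (hb' : Function.Injective b') (hc' : Function.Injective c')
    (ra : ∀ j, ∃ i, a' i = a j) (ra' : ∀ j, ∃ i, a i = a' j)
    (rb : ∀ j, ∃ i, b' i = b j) (rb' : ∀ j, ∃ i, b i = b' j)
    (rc : ∀ j, ∃ i, c' i = c j) (rc' : ∀ j, ∃ i, c i = c' j)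
    (sa : ∀ i j, a i - a j < m) (sb : ∀ i j, b i - b j < m) (sc : ∀ i j, c i - c j < m)
    (hd : ∀ i j, a i = a' j → b i ≠ b' j) :
    HasHom (ZMod m) (Nat.card J) := by
  have key : ∀ f : J → ℤ, Function.Injective f → (∀ i j, f i - f j < m) →
      Function.Injective (fun j => ((f j : ℤ) : ZMod m)) := by
    intro f hf sf i j h
    exact hf (cast_inj_small m _ _ (sf i j) (sf j i) h)
  have key' : ∀ f f' : J → ℤ, (∀ i j, f i - f j < m) → (∀ j, ∃ i, f i = f' j) →
      (∀ i j, f' i - f' j < m) := by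
    intro f f' sf hf i j
    obtain ⟨p, hp⟩ := hf i
    obtain ⟨q, hq⟩ := hf j
    rw [← hp, ← hq]; exact sf p q
  have kr : ∀ f f' : J → ℤ, (∀ j, ∃ i, f' i = f j) →
      ∀ j, ∃ i, ((f' i : ℤ) : ZMod m) = ((f j : ℤ) : ZMod m) := by
    intro f f' h j
    obtain ⟨i, hi⟩ := h j
    exact ⟨i, by rw [hi]⟩
  have kd : ∀ f f' : J → ℤ, (∀ i j, f i - f j < m) → (∀ j, ∃ i, f i = f' j) →
      ∀ i j, ((f i : ℤ) : ZMod m) = ((f' j : ℤ) : ZMod m) → f i = f' j := by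
    intro f f' sf hf i j h
    obtain ⟨q, hq⟩ := hf j
    rw [← hq] at h ⊢
    exact cast_inj_small m _ _ (sf i q) (sf q i) h
  refine ⟨cycRel (fun j => ((a j : ℤ) : ZMod m)) (fun j => ((b j : ℤ) : ZMod m))
      (fun j => ((c j : ℤ) : ZMod m)),
    cycRel (fun j => ((a' j : ℤ) : ZMod m)) (fun j => ((b' j : ℤ) : ZMod m))
      (fun j => ((c' j : ℤ) : ZMod m)), ?_, ?_, ?_, ?_⟩
  · apply cyc_side
    · intro j; exact_mod_cast congrArg (Int.cast : ℤ → ZMod m) (h0 j)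
    · intro j; exact_mod_cast congrArg (Int.cast : ℤ → ZMod m) (h0' j)
    · exact key c hc sc
    · exact key c' hc' (key' c c' sc rc')
    · exact kr c c' rc
    · exact kr c' c rc'
  · rw [cyc_rot, cyc_rot]
    apply cyc_side
    · intro j
      have : b j + c j + a j = 0 := by linarith [h0 j]
      exact_mod_cast congrArg (Int.cast : ℤ → ZMod m) this
    · intro j
      have : b' j + c' j + a' j = 0 := by linarith [h0' j]
      exact_mod_cast congrArg (Int.cast : ℤ → ZMod m) this
    · exact key a ha sa
    · exact key a' ha' (key' a a' sa ra')
    · exact kr a a' ra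
    · exact kr a' a ra'
  · rw [cyc_rot, cyc_rot, cyc_rot, cyc_rot]
    apply cyc_side
    · intro j
      have : c j + a j + b j = 0 := by linarith [h0 j]
      exact_mod_cast congrArg (Int.cast : ℤ → ZMod m) this
    · intro j
      have : c' j + a' j + b' j = 0 := by linarith [h0' j]
      exact_mod_cast congrArg (Int.cast : ℤ → ZMod m) this
    · exact key b hb sb
    · exact key b' hb' (key' b b' sb rb')
    · exact kr b b' rb
    · exact kr b' b rb'
  · rintro x y z ⟨i, h1, h2, h3⟩ ⟨j, h4, h5, h6⟩
    exact hd i j (kd a a' sa ra' i j (h1.symm.trans h4)) (kd b b' sb rb' i j (h2.symm.trans h5))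

lemma hom_odd (m t : ℕ) (ht : 0 < t) (hm : 2 * t + 1 ≤ m) : HasHom (ZMod m) (2 * t + 1) := by
  let J := {x : ℤ // x ∈ Finset.Icc (-(t : ℤ)) t}
  have hJ : Nat.card J = 2 * t + 1 := by
    simp only [J, Nat.card_eq_fintype_card, Fintype.card_coe, Int.card_Icc]
    omega
  let f : ℤ → ℤ := fun x => if x ≤ 0 then x + t else x - 1 - t
  have hf : ∀ x : ℤ, f x = if x ≤ 0 then x + t else x - 1 - t := fun _ => rfl
  have fmem : ∀ x : ℤ, x ∈ Finset.Icc (-(t : ℤ)) t → f x ∈ Finset.Icc (-(t : ℤ)) t := by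
    intro x; rw [hf]; simp only [Finset.mem_Icc]; split_ifs <;> omega
  have finj : ∀ x y : J, f x.1 = f y.1 → x = y := by
    rintro ⟨x, hx⟩ ⟨y, hy⟩ h
    have hx' := Finset.mem_Icc.mp hx
    have hy' := Finset.mem_Icc.mp hy
    simp only [hf] at h
    apply Subtype.ext
    change x = y
    split_ifs at h <;> omega
  have fsurj : ∀ x : J, ∃ i : J, f i.1 = x.1 := by
    rintro ⟨x, hx⟩
    have hx' := Finset.mem_Icc.mp hx
    by_cases h : 0 ≤ x
    · refine ⟨⟨x - t, Finset.mem_Icc.mpr (by omega)⟩, ?_⟩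
      simp only [hf]; split_ifs <;> omega
    · refine ⟨⟨x + 1 + t, Finset.mem_Icc.mpr (by omega)⟩, ?_⟩
      simp only [hf]; split_ifs <;> omega
  have ginj : ∀ x y : J, -(x.1 + f x.1) = -(y.1 + f y.1) → x = y := by
    rintro ⟨x, hx⟩ ⟨y, hy⟩ h
    have hx' := Finset.mem_Icc.mp hx
    have hy' := Finset.mem_Icc.mp hy
    simp only [hf] at h
    apply Subtype.ext
    change x = y
    split_ifs at h <;> omega
  rw [← hJ]
  refine cyc_int m (J := J) (fun x => x.1) (fun x => f x.1) (fun x => -(x.1 + f x.1))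
    (fun x => f x.1) (fun x => x.1) (fun x => -(x.1 + f x.1))
    (fun j => by ring) (fun j => by ring) Subtype.val_injective (fun x y h => finj x y h)
    (fun x y h => ginj x y h) (fun x y h => finj x y h) Subtype.val_injective
    (fun x y h => ginj x y h) fsurj (fun j => ⟨⟨f j.1, fmem _ j.2⟩, rfl⟩)
    (fun j => ⟨⟨f j.1, fmem _ j.2⟩, rfl⟩) fsurj (fun j => ⟨j, rfl⟩) (fun j => ⟨j, rfl⟩)
    ?_ ?_ ?_ ?_
  · rintro ⟨x, hx⟩ ⟨y, hy⟩
    have hx' := Finset.mem_Icc.mp hx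
    have hy' := Finset.mem_Icc.mp hy
    change x - y < m
    omega
  · rintro ⟨x, hx⟩ ⟨y, hy⟩
    have h1 := Finset.mem_Icc.mp (fmem x hx)
    have h2 := Finset.mem_Icc.mp (fmem y hy)
    change f x - f y < m
    omega
  · rintro ⟨x, hx⟩ ⟨y, hy⟩
    have hx' := Finset.mem_Icc.mp hx
    have hy' := Finset.mem_Icc.mp hy
    simp only [hf]
    split_ifs <;> omega
  · rintro ⟨x, hx⟩ ⟨y, hy⟩ h1 h2
    have hx' := Finset.mem_Icc.mp hx
    have hy' := Finset.mem_Icc.mp hy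
    simp only [hf] at h1 h2
    split_ifs at h1 h2 <;> omega

lemma hom_four (m : ℕ) (hm : 5 ≤ m) : HasHom (ZMod m) 4 := by
  have hm' : (5 : ℤ) ≤ m := by exact_mod_cast hm
  have h4 : Nat.card (Fin 4) = 4 := by simp
  rw [← h4]
  have small : ∀ f : Fin 4 → ℤ, (∀ i j, f i - f j < 5) → ∀ i j, f i - f j < (m : ℤ) :=
    fun f h i j => lt_of_lt_of_le (h i j) hm'
  refine cyc_int m (J := Fin 4) ![0, 1, 2, 3] ![-1, -3, 0, -2] ![1, 2, -2, -1]
    ![1, 3, 0, 2] ![0, -1, -2, -3] ![-1, -2, 2, 1]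
    (by decide) (by decide) (by decide) (by decide) (by decide) (by decide) (by decide) (by decide)
    (by decide) (by decide) (by decide) (by decide) (by decide) (by decide)
    (small _ (by decide)) (small _ (by decide)) (small _ (by decide)) (by decide)

lemma hom_zero (α : Type) : HasHom α 0 := by
  refine ⟨fun _ _ _ => False, fun _ _ _ => False, ?_, ?_, ?_, ?_⟩ <;>
    simp [SideCond, rotRel]

/-! ### Block construction -/

def blockRel {G β : Type} [AddCommGroup G] (S : G → G → G → β → β → β → Prop) :
    G × β → G × β → G × β → Prop :=
  fun p q r => p.1 + q.1 + r.1 = 0 ∧ S p.1 q.1 r.1 p.2 q.2 r.2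

lemma block_side {G β : Type} [AddCommGroup G] [Fintype G] [Finite β]
    (S S' : G → G → G → β → β → β → Prop) (w : G → G → G → ℕ) (k : ℕ)
    (h : ∀ i j s, SideCond (S i j s) (S' i j s) (w i j s))
    (hw : ∀ i, ∑ j, w i j (-i - j) = k) :
    SideCond (blockRel S) (blockRel S') k := by
  refine ⟨?_, ?_, ?_, ?_⟩
  · rintro ⟨i, x⟩ ⟨j, y⟩ ⟨s, z⟩ ⟨s', z'⟩ ⟨h1, h2⟩ ⟨h3, h4⟩
    simp only at h1 h2 h3 h4
    have : s = s' := add_left_cancel (h1.trans h3.symm)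
    subst this
    rw [(h i j s).1 x y z z' h2 h4]
  · rintro ⟨i, x⟩ ⟨j, y⟩ ⟨s, z⟩ ⟨s', z'⟩ ⟨h1, h2⟩ ⟨h3, h4⟩
    simp only at h1 h2 h3 h4
    have : s = s' := add_left_cancel (h1.trans h3.symm)
    subst this
    rw [(h i j s).2.1 x y z z' h2 h4]
  · rintro ⟨i, x⟩ ⟨j, y⟩
    constructor
    · rintro ⟨⟨s, z⟩, h1, h2⟩
      obtain ⟨z', hz⟩ := ((h i j s).2.2.1 x y).1 ⟨z, h2⟩
      exact ⟨⟨s, z'⟩, h1, hz⟩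
    · rintro ⟨⟨s, z⟩, h1, h2⟩
      obtain ⟨z', hz⟩ := ((h i j s).2.2.1 x y).2 ⟨z, h2⟩
      exact ⟨⟨s, z'⟩, h1, hz⟩
  · rintro ⟨i, x⟩
    have hmem : ∀ q : (Σ j : G, {p : β × β // S i j (-i - j) x p.1 p.2}),
        blockRel S (i, x) ((q.1, q.2.1.1), (-i - q.1, q.2.1.2)).1
          ((q.1, q.2.1.1), (-i - q.1, q.2.1.2)).2 := by
      intro q
      refine ⟨?_, q.2.2⟩
      simp
    have e : {p : (G × β) × (G × β) // blockRel S (i, x) p.1 p.2} ≃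
        (Σ j : G, {p : β × β // S i j (-i - j) x p.1 p.2}) := by
      refine (Equiv.ofBijective
        (fun q => ⟨((q.1, q.2.1.1), (-i - q.1, q.2.1.2)), hmem q⟩) ⟨?_, ?_⟩).symm
      · rintro ⟨j, ⟨⟨y, z⟩, hq⟩⟩ ⟨j', ⟨⟨y', z'⟩, hq'⟩⟩ heq
        have heq' := congrArg Subtype.val heq
        simp only [Prod.mk.injEq] at heq'
        obtain ⟨⟨rfl, rfl⟩, -, rfl⟩ := heq'
        rfl
      · rintro ⟨⟨⟨j, y⟩, ⟨s, z⟩⟩, h1, h2⟩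
        have h1' : i + j + s = 0 := h1
        have : s = -i - j := by
          have := eq_neg_of_add_eq_zero_right h1'
          rw [this]; abel
        subst this
        exact ⟨⟨j, ⟨(y, z), h2⟩⟩, rfl⟩
    rw [Nat.card_congr e, Nat.card_sigma, ← hw i]
    exact Finset.sum_congr rfl (fun j _ => (h i j _).2.2.2 x)

lemma block_rot {G β : Type} [AddCommGroup G] (S : G → G → G → β → β → β → Prop) :
    rotRel (blockRel S) = blockRel (fun j s i => rotRel (S i j s)) := by
  funext p q r
  simp only [rotRel, blockRel]
  rw [show r.1 + p.1 + q.1 = p.1 + q.1 + r.1 by abel]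

lemma block_hom {G β : Type} [AddCommGroup G] [Fintype G] [Finite β]
    (w : G → G → G → ℕ) (k : ℕ) (h : ∀ i j s, HasHom β (w i j s))
    (h1 : ∀ i, ∑ j, w i j (-i - j) = k)
    (h2 : ∀ j, ∑ s, w (-j - s) j s = k)
    (h3 : ∀ s, ∑ i, w i (-s - i) s = k) : HasHom (G × β) k := by
  choose S S' hS using h
  refine ⟨blockRel S, blockRel S', ?_, ?_, ?_, ?_⟩
  · exact block_side S S' w k (fun i j s => (hS i j s).1) h1
  · rw [block_rot, block_rot]
    exact block_side _ _ (fun j s i => w i j s) k (fun j s i => (hS i j s).2.1) h2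
  · rw [block_rot, block_rot, block_rot, block_rot]
    exact block_side _ _ (fun s i j => w i j s) k (fun s i j => (hS i j s).2.2.1) h3
  · rintro ⟨i, x⟩ ⟨j, y⟩ ⟨s, z⟩ ⟨-, q1⟩ ⟨-, q2⟩
    exact (hS i j s).2.2.2 x y z q1 q2

lemma exists_weights (l : ℕ) : ∀ k, k ≤ 5 * l → k ≠ 1 → k ≠ 2 →
    ∃ f : Fin l → ℕ, (∀ i, f i = 0 ∨ f i = 3 ∨ f i = 4 ∨ f i = 5) ∧ ∑ i, f i = k := by
  induction l with
  | zero => intro k hk _ _; exact ⟨fun _ => 0, by simp, by simp; omega⟩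
  | succ l ih =>
    intro k hk h1 h2
    have step : ∀ d, (d = 0 ∨ d = 3 ∨ d = 4 ∨ d = 5) → d ≤ k → k - d ≤ 5 * l → k - d ≠ 1 →
        k - d ≠ 2 → ∃ f : Fin (l + 1) → ℕ, (∀ i, f i = 0 ∨ f i = 3 ∨ f i = 4 ∨ f i = 5) ∧
          ∑ i, f i = k := by
      intro d hd hdk a1 a2 a3
      obtain ⟨f, hf, hs⟩ := ih (k - d) a1 a2 a3
      refine ⟨Fin.cons d f, ?_, ?_⟩
      · intro i
        refine Fin.cases ?_ ?_ i
        · simpa using hd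
        · intro j; simpa using hf j
      · rw [Fin.sum_univ_succ]; simp [hs]; omega
    by_cases c1 : k ≤ 5 * l
    · exact step 0 (by omega) (by omega) (by omega) (by omega) (by omega)
    · by_cases c2 : k = 3
      · exact step 3 (by omega) (by omega) (by omega) (by omega) (by omega)
      · by_cases c3 : k = 4
        · exact step 4 (by omega) (by omega) (by omega) (by omega) (by omega)
        · by_cases c4 : k = 6 ∨ k = 7
          · exact step 3 (by omega) (by omega) (by omega) (by omega) (by omega)
          · exact step 5 (by omega) (by omega) (by omega) (by omega) (by omega)

lemma hom_five (d : ℕ) (hd : d = 0 ∨ d = 3 ∨ d = 4 ∨ d = 5) : HasHom (ZMod 5) d := by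
  rcases hd with rfl | rfl | rfl | rfl
  · exact hom_zero _
  · exact hom_odd 5 1 (by norm_num) (by norm_num)
  · exact hom_four 5 le_rfl
  · exact hom_odd 5 2 (by norm_num) (by norm_num)

lemma hom_oddl (l k : ℕ) [NeZero l] (hl : Odd l) (hk : 3 ≤ k) (hkl : k ≤ 5 * l) :
    HasHom (ZMod l × ZMod 5) k := by
  obtain ⟨f, hf, hs⟩ := exists_weights l k hkl (by omega) (by omega)
  have e : ZMod l ≃ Fin l := Fintype.equivFinOfCardEq (ZMod.card l)
  have hsum : ∑ i : ZMod l, f (e i) = k := by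
    rw [← hs]; exact Equiv.sum_comp e f
  have hu : IsUnit (2 : ZMod l) := by
    have : IsUnit ((2 : ℕ) : ZMod l) := by
      rw [ZMod.isUnit_iff_coprime]
      exact (Nat.coprime_two_left).mpr hl
    simpa using this
  have hbij : ∀ g : ZMod l → ZMod l, Function.Injective g → ∑ i, f (e (g i)) = k := by
    intro g hg
    rw [← hsum]
    exact (Finite.injective_iff_bijective.mp hg).sum_comp (fun i => f (e i))
  refine block_hom (fun i j _ => f (e (i - j))) k (fun i j s => hom_five _ (hf _)) ?_ ?_ ?_
  · intro i
    exact hbij (fun j => i - j) (fun a b h => sub_right_inj.mp h)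
  · intro j
    exact hbij (fun s => -j - s - j) (fun a b h => sub_right_inj.mp (sub_left_inj.mp h))
  · intro s
    refine hbij (fun i => i - (-s - i)) (fun a b h => ?_)
    have h' : a - (-s - a) = b - (-s - b) := h
    have : (2 : ZMod l) * a = 2 * b := by linear_combination h'
    exact hu.mul_left_cancel this

lemma hom_double {β : Type} [Finite β] (k : ℕ) (h : HasHom β k) :
    HasHom (ZMod 2 × β) (2 * k) := by
  refine block_hom (fun _ _ _ => k) (2 * k) (fun _ _ _ => h) ?_ ?_ ?_ <;>
  · intro i; simp [ZMod.card]

lemma hom_main (l : ℕ) : ∀ k, 0 < l → 3 ≤ k → k ≤ 5 * l →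
    ∃ (α : Type) (_ : Fintype α), Fintype.card α = 5 * l ∧ HasHom α k := by
  induction l using Nat.strong_induction_on with
  | _ l ih =>
    intro k hl hk hkl
    have : NeZero l := ⟨by omega⟩
    have : NeZero (5 * l) := ⟨by omega⟩
    rcases Nat.even_or_odd l with he | ho
    · obtain ⟨n, hn⟩ := he
      rcases Nat.even_or_odd k with hke | hko
      · obtain ⟨q, hq⟩ := hke
        by_cases h4 : k = 4
        · subst h4
          exact ⟨ZMod (5 * l), inferInstance, ZMod.card _, hom_four _ (by omega)⟩
        · obtain ⟨α, _, hα, hh⟩ := ih n (by omega) q (by omega) (by omega) (by omega)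
          refine ⟨ZMod 2 × α, inferInstance, ?_, ?_⟩
          · rw [Fintype.card_prod, hα, ZMod.card]; omega
          · have := hom_double q hh
            rwa [show 2 * q = k by omega] at this
      · obtain ⟨t, ht⟩ := hko
        refine ⟨ZMod (5 * l), inferInstance, ZMod.card _, ?_⟩
        rw [ht]
        exact hom_odd _ t (by omega) (by omega)
    · refine ⟨ZMod l × ZMod 5, inferInstance, ?_, hom_oddl l k ho hk hkl⟩
      rw [Fintype.card_prod, ZMod.card, ZMod.card]; ring

/-! ### Transfer to the natural numbers -/

open Classical in
noncomputable def toNat3 {α : Type} [Fintype α] (φ : α → ℕ) (T : α → α → α → Prop) :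
    Finset (ℕ × ℕ × ℕ) :=
  (Finset.univ.filter (fun p : α × α × α => T p.1 p.2.1 p.2.2)).image
    (fun p => (φ p.1, φ p.2.1, φ p.2.2))

lemma mem_toNat3 {α : Type} [Fintype α] (φ : α → ℕ) (T : α → α → α → Prop) (a b c : ℕ) :
    (a, b, c) ∈ toNat3 φ T ↔ ∃ x y z, T x y z ∧ φ x = a ∧ φ y = b ∧ φ z = c := by
  simp [toNat3]

lemma card_of_bij {γ : Type} (s : Finset (ℕ × ℕ × ℕ)) (f : γ → ℕ × ℕ × ℕ)
    (hf : Function.Injective f) (hs : ∀ p, p ∈ s ↔ ∃ g, f g = p) : s.card = Nat.card γ := by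
  have h1 : Nat.card γ = Nat.card s := by
    refine Nat.card_congr (Equiv.ofBijective (fun g => (⟨f g, (hs _).2 ⟨g, rfl⟩⟩ : s)) ⟨?_, ?_⟩)
    · intro a b h
      exact hf (congrArg Subtype.val h)
    · rintro ⟨p, hp⟩
      obtain ⟨g, hg⟩ := (hs p).1 hp
      exact ⟨g, Subtype.ext hg⟩
  rw [h1]
  simp

lemma toNat3_pls {α : Type} [Fintype α] (φ : α → ℕ) (hφ : Function.Injective φ)
    (T : α → α → α → Prop)
    (h1 : ∀ x y z z', T x y z → T x y z' → z = z')
    (h2 : ∀ x y z z', rotRel T x y z → rotRel T x y z' → z = z')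
    (h3 : ∀ x y z z', rotRel (rotRel T) x y z → rotRel (rotRel T) x y z' → z = z') :
    IsPartialLatinSquare (toNat3 φ T) := by
  refine ⟨?_, ?_, ?_⟩ <;>
  · rintro ⟨a, b, c⟩ hx ⟨a', b', c'⟩ hy e1 e2
    obtain ⟨x, y, z, hT, rfl, rfl, rfl⟩ := (mem_toNat3 φ T _ _ _).1 hx
    obtain ⟨x', y', z', hT', rfl, rfl, rfl⟩ := (mem_toNat3 φ T _ _ _).1 hy
    have e1' := hφ e1
    have e2' := hφ e2
    subst e1' e2'
    first
      | rw [h1 _ _ _ _ hT hT']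
      | rw [h2 _ _ _ _ hT hT']
      | rw [h3 _ _ _ _ hT hT']

lemma transfer {α : Type} [Fintype α] (k : ℕ) (h : HasHom α k) :
    ∃ T T' : Finset (ℕ × ℕ × ℕ),
      IsHomogeneousLatinBitrade k T T' ∧ T.card = k * Fintype.card α := by
  obtain ⟨T, T', h1, h2, h3, hd⟩ := h
  obtain ⟨φ, hφ⟩ : ∃ φ : α → ℕ, Function.Injective φ :=
    ⟨fun x => (Fintype.equivFin α x).val,
      fun x y h => (Fintype.equivFin α).injective (Fin.ext h)⟩
  have hφ' : ∀ {x y}, φ x = φ y → x = y := fun h => hφ h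
  refine ⟨toNat3 φ T, toNat3 φ T', ⟨⟨?_, ?_, ?_, ?_, ?_, ?_⟩, ?_, ?_, ?_⟩, ?_⟩
  · exact toNat3_pls φ hφ T h1.1 h2.1 h3.1
  · exact toNat3_pls φ hφ T' h1.2.1 h2.2.1 h3.2.1
  · rw [Finset.disjoint_left]
    rintro ⟨a, b, c⟩ hx hy
    obtain ⟨x, y, z, hT, rfl, rfl, rfl⟩ := (mem_toNat3 φ T _ _ _).1 hx
    obtain ⟨x', y', z', hT', e1, e2, e3⟩ := (mem_toNat3 φ T' _ _ _).1 hy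
    rw [hφ' e1, hφ' e2, hφ' e3] at hT'
    exact hd _ _ _ hT hT'
  · intro r c
    simp only [mem_toNat3]
    constructor
    · rintro ⟨e, x, y, z, hT, rfl, rfl, rfl⟩
      obtain ⟨z', hz⟩ := (h1.2.2.1 x y).1 ⟨z, hT⟩
      exact ⟨_, x, y, z', hz, rfl, rfl, rfl⟩
    · rintro ⟨e, x, y, z, hT, rfl, rfl, rfl⟩
      obtain ⟨z', hz⟩ := (h1.2.2.1 x y).2 ⟨z, hT⟩
      exact ⟨_, x, y, z', hz, rfl, rfl, rfl⟩
  · intro r e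
    simp only [mem_toNat3]
    constructor
    · rintro ⟨c, x, y, z, hT, rfl, rfl, rfl⟩
      obtain ⟨y', hz⟩ := (h3.2.2.1 z x).1 ⟨y, hT⟩
      exact ⟨_, x, y', z, hz, rfl, rfl, rfl⟩
    · rintro ⟨c, x, y, z, hT, rfl, rfl, rfl⟩
      obtain ⟨y', hz⟩ := (h3.2.2.1 z x).2 ⟨y, hT⟩
      exact ⟨_, x, y', z, hz, rfl, rfl, rfl⟩
  · intro c e
    simp only [mem_toNat3]
    constructor
    · rintro ⟨r, x, y, z, hT, rfl, rfl, rfl⟩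
      obtain ⟨x', hz⟩ := (h2.2.2.1 y z).1 ⟨x, hT⟩
      exact ⟨_, x', y, z, hz, rfl, rfl, rfl⟩
    · rintro ⟨r, x, y, z, hT, rfl, rfl, rfl⟩
      obtain ⟨x', hz⟩ := (h2.2.2.1 y z).2 ⟨x, hT⟩
      exact ⟨_, x', y, z, hz, rfl, rfl, rfl⟩
  · rintro r ⟨⟨a, b, c⟩, hx, rfl⟩
    obtain ⟨x, y, z, hT, rfl, rfl, rfl⟩ := (mem_toNat3 φ T _ _ _).1 hx
    rw [← h1.2.2.2 x]
    apply card_of_bij _ (fun q => (φ x, φ q.1.1, φ q.1.2))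
    · rintro ⟨⟨p, q⟩, h⟩ ⟨⟨p', q'⟩, h'⟩ he
      simp only [Prod.mk.injEq, true_and] at he
      exact Subtype.ext (Prod.ext (hφ he.1) (hφ he.2))
    · rintro ⟨a, b, c⟩
      simp only [Finset.mem_filter, mem_toNat3]
      constructor
      · rintro ⟨⟨x', y', z', hT', e1, rfl, rfl⟩, rfl⟩
        have := hφ e1
        subst this
        exact ⟨⟨(y', z'), hT'⟩, rfl⟩
      · rintro ⟨⟨⟨y', z'⟩, hT'⟩, he⟩
        simp only [Prod.mk.injEq] at he
        exact ⟨⟨x, y', z', hT', he⟩, he.1.symm⟩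
  · rintro r ⟨⟨a, b, c⟩, hx, rfl⟩
    obtain ⟨x, y, z, hT, rfl, rfl, rfl⟩ := (mem_toNat3 φ T _ _ _).1 hx
    rw [← h2.2.2.2 y]
    apply card_of_bij _ (fun q => (φ q.1.2, φ y, φ q.1.1))
    · rintro ⟨⟨p, q⟩, h⟩ ⟨⟨p', q'⟩, h'⟩ he
      simp only [Prod.mk.injEq, true_and] at he
      exact Subtype.ext (Prod.ext (hφ he.2) (hφ he.1))
    · rintro ⟨a, b, c⟩
      simp only [Finset.mem_filter, mem_toNat3]
      constructor
      · rintro ⟨⟨x', y', z', hT', rfl, e1, rfl⟩, rfl⟩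
        have := hφ e1
        subst this
        exact ⟨⟨(z', x'), hT'⟩, rfl⟩
      · rintro ⟨⟨⟨z', x'⟩, hT'⟩, he⟩
        simp only [Prod.mk.injEq] at he
        exact ⟨⟨x', y, z', hT', he⟩, he.2.1.symm⟩
  · rintro r ⟨⟨a, b, c⟩, hx, rfl⟩
    obtain ⟨x, y, z, hT, rfl, rfl, rfl⟩ := (mem_toNat3 φ T _ _ _).1 hx
    rw [← h3.2.2.2 z]
    apply card_of_bij _ (fun q => (φ q.1.1, φ q.1.2, φ z))
    · rintro ⟨⟨p, q⟩, h⟩ ⟨⟨p', q'⟩, h'⟩ he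
      simp only [Prod.mk.injEq, and_true] at he
      exact Subtype.ext (Prod.ext (hφ he.1) (hφ he.2))
    · rintro ⟨a, b, c⟩
      simp only [Finset.mem_filter, mem_toNat3]
      constructor
      · rintro ⟨⟨x', y', z', hT', rfl, rfl, e1⟩, rfl⟩
        have := hφ e1
        subst this
        exact ⟨⟨(x', y'), hT'⟩, rfl⟩
      · rintro ⟨⟨⟨x', y'⟩, hT'⟩, he⟩
        simp only [Prod.mk.injEq] at he
        exact ⟨⟨x', y', z, hT', he⟩, he.2.2.symm⟩
  · rw [card_of_bij (γ := Σ x : α, {p : α × α // T x p.1 p.2}) _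
      (fun q => (φ q.1, φ q.2.1.1, φ q.2.1.2)), Nat.card_sigma,
      Finset.sum_congr rfl (fun x _ => h1.2.2.2 x)]
    · simp [mul_comm]
    · rintro ⟨x, ⟨⟨p, q⟩, h⟩⟩ ⟨x', ⟨⟨p', q'⟩, h'⟩⟩ he
      simp only [Prod.mk.injEq] at he
      obtain ⟨e1, e2, e3⟩ := he
      obtain rfl := hφ e1
      obtain rfl := hφ e2
      obtain rfl := hφ e3
      rfl
    · rintro ⟨a, b, c⟩
      rw [mem_toNat3]
      constructor
      · rintro ⟨x, y, z, hT, rfl, rfl, rfl⟩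
        exact ⟨⟨x, ⟨(y, z), hT⟩⟩, rfl⟩
      · rintro ⟨⟨x, ⟨⟨y, z⟩, hT⟩⟩, he⟩
        simp only [Prod.mk.injEq] at he
        exact ⟨x, y, z, hT, he⟩

theorem stmt_16 (l m k : ℕ) (hl : 0 < l) (hm : m = 5 * l)
    (hk3 : 3 ≤ k) (hkm : k ≤ m) :
    ∃ T T' : Finset (ℕ × ℕ × ℕ),
      IsHomogeneousLatinBitrade k T T' ∧ T.card = k * m := by
  obtain ⟨α, hα, hc, hh⟩ := hom_main l k hl hk3 (by omega)
  have := transfer k hh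
  rwa [hc, ← hm] at this
end
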